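/- arXiv:1907.06461 — 2 statements merged into one kernel-verified Lean document; each statement's English description precedes it below -/
import Mathlib

section
/- Let n ≥ 2 and let h : 𝕏 → 𝕐 be an orientation-preserving homeomorphism between domains 𝕏, 𝕐 ⊂ ℝⁿ belonging to the Sobolev class W^{1,n}(𝕏, ℝⁿ). Then h is quasiconformal (i.e., there exists a constant 1 ≤ K < ∞ with |Dh(x)|ⁿ ≤ K·J_h(x) for almost every x ∈ 𝕏) if and only if the inner distortion K_I(·,h) belongs to L^∞(𝕏). -/
open MeasureTheory Metric Set
open scoped ENNReal NNReal

noncomputable section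

abbrev Euc (n : ℕ) : Type := EuclideanSpace ℝ (Fin n)

/-- Operator norm of an `n × n` real matrix, viewed as a linear operator on Euclidean space. -/
noncomputable def opNorm {n : ℕ} (M : Matrix (Fin n) (Fin n) ℝ) : ℝ :=
  ‖LinearMap.toContinuousLinearMap (Matrix.toEuclideanLin M)‖

/-- `g` belongs to the Sobolev class `W^{1,p}(Ω, ℝⁿ)` with weak differential `Dg`:
`g` and `Dg` are locally integrable on `Ω`, the integration-by-parts identity holds against
every smooth compactly supported test function supported in `Ω`, and `|Dg| ∈ L^p(Ω)`. -/
structure MemSobolev {n : ℕ} (p : ℝ) (Ω : Set (Euc n))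
    (g : Euc n → Euc n) (Dg : Euc n → Matrix (Fin n) (Fin n) ℝ) : Prop where
  locInt : ∀ i : Fin n, LocallyIntegrableOn (fun x => g x i) Ω volume
  locIntD : ∀ i j : Fin n, LocallyIntegrableOn (fun x => Dg x i j) Ω volume
  parts : ∀ φ : Euc n → ℝ, ContDiff ℝ ((⊤ : ℕ∞) : WithTop ℕ∞) φ → HasCompactSupport φ →
    tsupport φ ⊆ Ω → ∀ i j : Fin n,
      ∫ x in Ω, g x i * fderiv ℝ φ x (EuclideanSpace.single j 1) =
        - ∫ x in Ω, Dg x i j * φ x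
  lp : IntegrableOn (fun x => opNorm (Dg x) ^ p) Ω volume

/-- `g` belongs to the local Sobolev class `W^{1,1}_loc(Ω, ℝⁿ)` with weak differential `Dg`. -/
structure MemSobolevLoc {n : ℕ} (Ω : Set (Euc n))
    (g : Euc n → Euc n) (Dg : Euc n → Matrix (Fin n) (Fin n) ℝ) : Prop where
  locInt : ∀ i : Fin n, LocallyIntegrableOn (fun x => g x i) Ω volume
  locIntD : ∀ i j : Fin n, LocallyIntegrableOn (fun x => Dg x i j) Ω volume
  parts : ∀ φ : Euc n → ℝ, ContDiff ℝ ((⊤ : ℕ∞) : WithTop ℕ∞) φ → HasCompactSupport φ →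
    tsupport φ ⊆ Ω → ∀ i j : Fin n,
      ∫ x in Ω, g x i * fderiv ℝ φ x (EuclideanSpace.single j 1) =
        - ∫ x in Ω, Dg x i j * φ x

/-- `h : 𝕏 → 𝕐` is a homeomorphism of `𝕏` onto `𝕐` with inverse `f`. -/
structure IsHomeoOn {n : ℕ} (h f : Euc n → Euc n) (𝕏 𝕐 : Set (Euc n)) : Prop where
  mapsTo : Set.MapsTo h 𝕏 𝕐
  mapsTo_inv : Set.MapsTo f 𝕐 𝕏
  left_inv : ∀ x ∈ 𝕏, f (h x) = x
  right_inv : ∀ y ∈ 𝕐, h (f y) = y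
  continuousOn : ContinuousOn h 𝕏
  continuousOn_inv : ContinuousOn f 𝕐

/-- The inner distortion function `K_I(·, h)` of a Sobolev map with weak differential `Dh`;
`D♯h` is the cofactor (adjugate) matrix, given by Cramer's rule `(D♯h)(Dh) = (det Dh)·Id`. -/
noncomputable def innerDistortion {n : ℕ} (Dh : Euc n → Matrix (Fin n) (Fin n) ℝ)
    (x : Euc n) : ℝ≥0∞ :=
  if 0 < (Dh x).det then
    ENNReal.ofReal (opNorm ((Dh x).adjugate) ^ n / (Dh x).det ^ (n - 1))
  else if (Dh x).adjugate = 0 then 1 else ⊤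

/-- The open unit ball `𝔹 ⊂ ℝⁿ`. -/
def unitBall (n : ℕ) : Set (Euc n) := Metric.ball 0 1

/-- The slit `I = {(t,0) : 0 ≤ t < 1}`, the first coordinate playing the role of `t`. -/
def slit (n : ℕ) [NeZero n] : Set (Euc n) :=
  {p | 0 ≤ p 0 ∧ p 0 < 1 ∧ ∀ i : Fin n, i ≠ 0 → p i = 0}

/-- The model inward-cusp ball `𝔹_u = 𝔹 \ {(t,x) : t ≥ 0, |x| ≤ u(t)}`. -/
noncomputable def cuspBall (n : ℕ) [NeZero n] (u : ℝ → ℝ) : Set (Euc n) :=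
  Metric.ball 0 1 \
    {p | 0 ≤ p 0 ∧ Real.sqrt (∑ i ∈ Finset.univ.erase (0 : Fin n), p i ^ 2) ≤ u (p 0)}

/-- `u` is a model cusp profile: a strictly increasing continuous surjection of `[0,∞)` onto
itself, `C¹` on `(0,∞)`, with `u′` increasing on `(0,∞)`, `u′(s) → 0` as `s → 0⁺`, `u(1) = 1`. -/
structure IsModelCusp (u : ℝ → ℝ) : Prop where
  continuousOn : ContinuousOn u (Set.Ici 0)
  contDiffOn : ContDiffOn ℝ 1 u (Set.Ioi 0)
  strictMonoOn : StrictMonoOn u (Set.Ici 0)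
  mapsTo : Set.MapsTo u (Set.Ici 0) (Set.Ici 0)
  surjOn : Set.SurjOn u (Set.Ici 0) (Set.Ici 0)
  deriv_mono : MonotoneOn (deriv u) (Set.Ioi 0)
  deriv_tendsto : Filter.Tendsto (deriv u) (nhdsWithin 0 (Set.Ioi 0)) (nhds 0)
  one : u 1 = 1

/-- The cusp profile `u(t) = e / exp(t^{-α})` for `t > 0`, and `u(0) = 0`. -/
noncomputable def cuspFun (α : ℝ) (t : ℝ) : ℝ :=
  if 0 < t then Real.exp 1 / Real.exp (t ^ (-α)) else 0

/-- The sphere `S_t = {y ∈ 𝔹_u : |y| = t}` inside the cusp ball. -/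
def cuspS (n : ℕ) [NeZero n] (u : ℝ → ℝ) (t : ℝ) : Set (Euc n) :=
  {y ∈ cuspBall n u | ‖y‖ = t}

/-- The boundary circle `C_t = {y ∈ ∂𝔹_u : |y| = t}`. -/
def cuspC (n : ℕ) [NeZero n] (u : ℝ → ℝ) (t : ℝ) : Set (Euc n) :=
  {y ∈ frontier (cuspBall n u) | ‖y‖ = t}

/-- `S′_t = h⁻¹(S_t) ⊆ 𝔹`. -/
def cuspS' (n : ℕ) [NeZero n] (u : ℝ → ℝ) (h : Euc n → Euc n) (t : ℝ) : Set (Euc n) :=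
  {x ∈ unitBall n | h x ∈ cuspS n u t}

/-- `C′_t = cl(S′_t) ∩ ∂𝔹`. -/
def cuspC' (n : ℕ) [NeZero n] (u : ℝ → ℝ) (h : Euc n → Euc n) (t : ℝ) : Set (Euc n) :=
  closure (cuspS' n u h t) ∩ Metric.sphere (0 : Euc n) 1

open MeasureTheory Metric Set
open scoped ENNReal NNReal

namespace QC

open scoped ContDiff Topology
open Filter

variable {n : ℕ}

/-- Partial derivative. -/
def pd (i : Fin n) (g : Euc n → ℝ) (x : Euc n) : ℝ :=
  fderiv ℝ g x (EuclideanSpace.single i (1 : ℝ))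

lemma pd_smooth (i : Fin n) {g : Euc n → ℝ} (hg : ContDiff ℝ ∞ g) : ContDiff ℝ ∞ (pd i g) := by
  have : ContDiff ℝ ∞ (fderiv ℝ g) := hg.fderiv_right (by simp)
  exact this.clm_apply contDiff_const

lemma pd_symm (i j : Fin n) {g : Euc n → ℝ} (hg : ContDiff ℝ ∞ g) (x : Euc n) :
    pd i (pd j g) x = pd j (pd i g) x := by
  have h1 : IsSymmSndFDerivAt ℝ g x := by
    apply ContDiffAt.isSymmSndFDerivAt (n := ∞) hg.contDiffAt
    simp only [minSmoothness_of_isRCLikeNormedField]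
    have h2 : ((2 : ℕ∞) : WithTop ℕ∞) ≤ ((⊤ : ℕ∞) : WithTop ℕ∞) := WithTop.coe_le_coe.2 le_top
    exact h2
  have hd : DifferentiableAt ℝ (fderiv ℝ g) x :=
    ((hg.fderiv_right (m := ∞) (by simp)).differentiable (by simp)) x
  have key : ∀ a b : Fin n, pd a (pd b g) x =
      fderiv ℝ (fderiv ℝ g) x (EuclideanSpace.single a 1) (EuclideanSpace.single b 1) := by
    intro a b
    unfold pd
    rw [fderiv_clm_apply hd (differentiableAt_const _)]
    simp
  rw [key, key]
  exact h1 _ _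

lemma pd_compact (i : Fin n) {g : Euc n → ℝ} (hg : HasCompactSupport g) :
    HasCompactSupport (pd i g) := by
  exact hg.fderiv_apply ℝ _

lemma pd_prod {ι : Type*} [DecidableEq ι] (i : Fin n) (s : Finset ι) (g : ι → Euc n → ℝ)
    (hg : ∀ k, ContDiff ℝ ∞ (g k)) (x : Euc n) :
    pd i (fun x => ∏ k ∈ s, g k x) x = ∑ m ∈ s, (∏ k ∈ s.erase m, g k x) * pd i (g m) x := by
  unfold pd
  have := HasFDerivAt.finsetProd (u := s) (g := g) (x := x)
    (g' := fun k => fderiv ℝ (g k) x)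
    (fun k _ => ((hg k).differentiable (by simp) x).hasFDerivAt)
  rw [this.fderiv]
  simp

/-- Jacobian matrix of a tuple of functions. -/
def jac (Ψ : Fin n → Euc n → ℝ) (x : Euc n) : Matrix (Fin n) (Fin n) ℝ :=
  Matrix.of fun k i => pd i (Ψ k) x

lemma det_jac (Ψ : Fin n → Euc n → ℝ) (x : Euc n) : (jac Ψ x).det =
    ∑ σ : Equiv.Perm (Fin n), ((Equiv.Perm.sign σ : ℤ) : ℝ) * ∏ k, pd (σ k) (Ψ k) x := by
  rw [← Matrix.det_transpose, Matrix.det_apply']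
  rfl

lemma det_jac_smooth (Ψ : Fin n → Euc n → ℝ) (h : ∀ k, ContDiff ℝ ∞ (Ψ k)) :
    ContDiff ℝ ∞ (fun x => (jac Ψ x).det) := by
  simp_rw [det_jac]
  apply ContDiff.sum
  intro σ _
  apply contDiff_const.mul
  apply contDiff_prod
  intro k _
  exact pd_smooth _ (h k)

lemma det_jac_compact (Ψ : Fin n → Euc n → ℝ) (j : Fin n) (hc : HasCompactSupport (Ψ j)) :
    HasCompactSupport (fun x => (jac Ψ x).det) := by
  apply hc.mono'
  intro x hx
  by_contra hx'
  apply hx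
  apply Matrix.det_eq_zero_of_row_eq_zero j
  intro i
  have : Ψ j =ᶠ[𝓝 x] fun _ => 0 := notMem_tsupport_iff_eventuallyEq.1 hx'
  simp [jac, pd, this.fderiv_eq]

/-- Null-Lagrangian property of the Jacobian determinant. -/
lemma integral_det_eq_zero (Ψ : Fin n → Euc n → ℝ) (h : ∀ k, ContDiff ℝ ∞ (Ψ k))
    (j : Fin n) (hc : HasCompactSupport (Ψ j)) : ∫ x, (jac Ψ x).det = 0 := by
  classical
  simp_rw [det_jac]
  have hsm : ∀ (σ : Equiv.Perm (Fin n)) (s : Finset (Fin n)),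
      ContDiff ℝ ∞ (fun x => ∏ k ∈ s, pd (σ k) (Ψ k) x) := by
    intro σ s
    exact contDiff_prod (fun k _ => pd_smooth _ (h k))
  have step : ∀ σ : Equiv.Perm (Fin n), ∫ x, ∏ k, pd (σ k) (Ψ k) x =
      - ∫ x, Ψ j x * ∑ m ∈ Finset.univ.erase j,
        (∏ k ∈ (Finset.univ.erase j).erase m, pd (σ k) (Ψ k) x) * pd (σ j) (pd (σ m) (Ψ m)) x := by
    intro σ
    have e1 : ∀ x, ∏ k, pd (σ k) (Ψ k) x =
        (∏ k ∈ Finset.univ.erase j, pd (σ k) (Ψ k) x) * pd (σ j) (Ψ j) x := by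
      intro x
      rw [Finset.prod_erase_mul _ _ (Finset.mem_univ j)]
    have e2 : ∀ x, pd (σ j) (fun x => ∏ k ∈ Finset.univ.erase j, pd (σ k) (Ψ k) x) x =
       ∑ m ∈ Finset.univ.erase j,
        (∏ k ∈ (Finset.univ.erase j).erase m, pd (σ k) (Ψ k) x) * pd (σ j) (pd (σ m) (Ψ m)) x :=
      fun x => pd_prod (σ j) _ (fun k => pd (σ k) (Ψ k)) (fun k => pd_smooth _ (h k)) x
    simp_rw [e1, ← e2]
    have := integral_mul_fderiv_eq_neg_fderiv_mul_of_integrable (μ := (volume : Measure (Euc n)))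
      (f := fun x => ∏ k ∈ Finset.univ.erase j, pd (σ k) (Ψ k) x) (g := Ψ j)
      (v := EuclideanSpace.single (σ j) (1 : ℝ))
      (Continuous.integrable_of_hasCompactSupport
        ((pd_smooth (σ j) (hsm σ _)).continuous.mul (h j).continuous) hc.mul_left)
      (Continuous.integrable_of_hasCompactSupport
        ((hsm σ _).continuous.mul (pd_smooth (σ j) (h j)).continuous)
        (pd_compact (σ j) hc).mul_left)
      (Continuous.integrable_of_hasCompactSupport
        ((hsm σ _).continuous.mul (h j).continuous) hc.mul_left)
      (fun x _ => (hsm σ _).differentiable (by simp) x)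
      (fun x _ => (h j).differentiable (by simp) x)
    refine this.trans ?_
    congr 1
    apply integral_congr_ae
    filter_upwards with x
    rw [mul_comm]
    rfl
  rw [integral_finsetSum]
  swap
  · intro σ _
    apply Integrable.const_mul
    apply Continuous.integrable_of_hasCompactSupport (hsm σ _).continuous
    apply (pd_compact (σ j) hc).mono
    intro x hx
    simp only [Function.mem_support, ne_eq] at hx ⊢
    intro h0
    exact hx (Finset.prod_eq_zero (Finset.mem_univ j) h0)
  simp_rw [integral_const_mul, step]
  have hinteg : ∀ σ : Equiv.Perm (Fin n), Integrable (fun x => Ψ j x * ∑ m ∈ Finset.univ.erase j,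
        (∏ k ∈ (Finset.univ.erase j).erase m, pd (σ k) (Ψ k) x) *
          pd (σ j) (pd (σ m) (Ψ m)) x) := by
    intro σ
    apply Continuous.integrable_of_hasCompactSupport
    · apply (h j).continuous.mul
      apply continuous_finsetSum
      intro m _
      exact (hsm σ _).continuous.mul (pd_smooth _ (pd_smooth _ (h m))).continuous
    · exact hc.mul_right
  simp_rw [mul_neg, ← integral_const_mul]
  rw [Finset.sum_neg_distrib, ← integral_finsetSum _ (fun σ _ => (hinteg σ).const_mul _)]
  rw [neg_eq_zero]
  rw [show (0 : ℝ) = ∫ x : Euc n, (0 : ℝ) by simp]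
  congr 1
  ext x
  simp_rw [Finset.mul_sum]
  rw [Finset.sum_comm]
  apply Finset.sum_eq_zero
  intro m hm
  have hmj : m ≠ j := Finset.ne_of_mem_erase hm
  set T : Equiv.Perm (Fin n) → ℝ := fun σ => ((Equiv.Perm.sign σ : ℤ) : ℝ) * (Ψ j x *
    ((∏ k ∈ (Finset.univ.erase j).erase m, pd (σ k) (Ψ k) x) * pd (σ j) (pd (σ m) (Ψ m)) x))
    with hT
  have hneg : ∀ σ, T (σ * Equiv.swap j m) = - T σ := by
    intro σ
    simp only [hT]
    have e1 : ∏ k ∈ (Finset.univ.erase j).erase m, pd ((σ * Equiv.swap j m) k) (Ψ k) x =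
        ∏ k ∈ (Finset.univ.erase j).erase m, pd (σ k) (Ψ k) x := by
      apply Finset.prod_congr rfl
      intro k hk
      have hk1 : k ≠ m := Finset.ne_of_mem_erase hk
      have hk2 : k ≠ j := Finset.ne_of_mem_erase (Finset.mem_of_mem_erase hk)
      rw [Equiv.Perm.mul_apply, Equiv.swap_apply_of_ne_of_ne hk2 hk1]
    rw [e1, Equiv.Perm.sign_mul, Equiv.Perm.sign_swap hmj.symm, Equiv.Perm.mul_apply,
      Equiv.Perm.mul_apply, Equiv.swap_apply_left, Equiv.swap_apply_right,
      pd_symm (σ m) (σ j) (h m)]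
    push_cast
    ring
  have : ∑ σ, T σ = - ∑ σ, T σ := by
    rw [← Finset.sum_neg_distrib]
    simp_rw [← hneg]
    exact (Equiv.sum_comp (Equiv.mulRight (Equiv.swap j m)) T).symm
  linarith

end QC

open MeasureTheory Metric Set
open scoped ENNReal NNReal

namespace QC

open scoped ContDiff Topology
open Filter

variable {n : ℕ}

lemma pd_sub (i : Fin n) {g g' : Euc n → ℝ} (hg : ContDiff ℝ ∞ g) (hg' : ContDiff ℝ ∞ g')
    (x : Euc n) : pd i (fun x => g x - g' x) x = pd i g x - pd i g' x := by
  unfold pd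
  rw [fderiv_fun_sub (hg.differentiable (by simp) x) (hg'.differentiable (by simp) x)]
  simp

lemma pd_mul (i : Fin n) {g g' : Euc n → ℝ} (hg : ContDiff ℝ ∞ g) (hg' : ContDiff ℝ ∞ g')
    (x : Euc n) : pd i (fun x => g x * g' x) x = g x * pd i g' x + g' x * pd i g x := by
  unfold pd
  rw [fderiv_fun_mul (hg.differentiable (by simp) x) (hg'.differentiable (by simp) x)]
  simp

lemma integral_det_diff (P Q : Fin n → Euc n → ℝ) (hP : ∀ k, ContDiff ℝ ∞ (P k))
    (hQ : ∀ k, ContDiff ℝ ∞ (Q k)) (hc : ∀ k, HasCompactSupport (fun x => P k x - Q k x)) :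
    Integrable (fun x => (jac P x).det - (jac Q x).det) ∧
    ∫ x, ((jac P x).det - (jac Q x).det) = 0 := by
  classical
  let A : Finset (Fin n) → Fin n → Euc n → ℝ := fun s k => if k ∈ s then P k else Q k
  have hA : ∀ s k, ContDiff ℝ ∞ (A s k) := by
    intro s k
    by_cases hk : k ∈ s
    · simpa [A, hk] using hP k
    · simpa [A, hk] using hQ k
  have main : ∀ s : Finset (Fin n), Integrable (fun x => (jac (A s) x).det - (jac Q x).det) ∧
    ∫ x, ((jac (A s) x).det - (jac Q x).det) = 0 := by
    intro s
    induction s using Finset.induction_on with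
    | empty => simp [A]
    | insert k s hk ih =>
      let B : Fin n → Euc n → ℝ := fun m => if m = k then fun x => P k x - Q k x else A s m
      have hB : ∀ m, ContDiff ℝ ∞ (B m) := by
        intro m
        by_cases hm : m = k
        · simpa [B, hm] using (hP k).sub (hQ k)
        · simpa [B, hm] using hA s m
      have hBc : HasCompactSupport (B k) := by simpa [B] using hc k
      have hBA : ∀ x, (jac (A (insert k s)) x).det = (jac B x).det + (jac (A s) x).det := by
        intro x
        have e1 : jac (A (insert k s)) x = (jac (A s) x).updateRow k
            ((fun i => pd i (fun x => P k x - Q k x) x) + (jac (A s) x k)) := by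
          ext m i
          by_cases hm : m = k
          · subst hm
            rw [Matrix.updateRow_self]
            simp [jac, A, hk, pd_sub i (hP m) (hQ m)]
          · rw [Matrix.updateRow_ne hm]
            simp [jac, A, hm]
        have e2 : jac B x = (jac (A s) x).updateRow k
            (fun i => pd i (fun x => P k x - Q k x) x) := by
          ext m i
          by_cases hm : m = k
          · subst hm
            rw [Matrix.updateRow_self]
            simp [jac, B]
          · rw [Matrix.updateRow_ne hm]
            simp [jac, B, hm]
        rw [e1, Matrix.det_updateRow_add, e2, Matrix.updateRow_eq_self]
      have hBi : Integrable (fun x => (jac B x).det) :=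
        Continuous.integrable_of_hasCompactSupport (det_jac_smooth B hB).continuous
          (det_jac_compact B k hBc)
      have e : (fun x => (jac (A (insert k s)) x).det - (jac Q x).det) =
          fun x => (jac B x).det + ((jac (A s) x).det - (jac Q x).det) := by
        ext x; rw [hBA]; ring
      rw [e]
      refine ⟨hBi.add ih.1, ?_⟩
      rw [integral_add hBi ih.1, ih.2, integral_det_eq_zero B hB k hBc, add_zero]
  have := main Finset.univ
  simpa [A] using this

/-- components -/
def comps (F : Euc n → Euc n) : Fin n → Euc n → ℝ := fun k x => F x k

/-- Jacobian matrix of a map. -/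
abbrev JM (F : Euc n → Euc n) (x : Euc n) : Matrix (Fin n) (Fin n) ℝ := jac (comps F) x

/-- coordinate projection -/
abbrev pr (k : Fin n) : Euc n →L[ℝ] ℝ := EuclideanSpace.proj k

lemma coord_smooth (k : Fin n) : ContDiff ℝ ∞ (fun x : Euc n => x k) :=
  (pr k).contDiff

lemma comps_smooth {F : Euc n → Euc n} (hF : ContDiff ℝ ∞ F) (k : Fin n) :
    ContDiff ℝ ∞ (comps F k) := (coord_smooth k).comp hF

lemma pd_comp (i : Fin n) {w : Euc n → ℝ} (hw : ContDiff ℝ ∞ w) {F : Euc n → Euc n}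
    (hF : ContDiff ℝ ∞ F) (x : Euc n) :
    pd i (fun x => w (F x)) x = ∑ k, pd k w (F x) * JM F x k i := by
  have hFd : DifferentiableAt ℝ F x := hF.differentiable (by simp) x
  have h1 : ∀ k, JM F x k i = (fderiv ℝ F x (EuclideanSpace.single i 1)) k := by
    intro k
    simp only [jac, pd, Matrix.of_apply]
    have := (pr k).hasFDerivAt.comp x
      hFd.hasFDerivAt
    have e : comps F k =
      (pr k) ∘ F := rfl
    rw [e, this.fderiv]
    rfl
  simp_rw [h1]
  unfold pd
  rw [fderiv_fun_comp x (hw.differentiable (by simp) _) hFd]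
  simp only [ContinuousLinearMap.comp_apply]
  set v := fderiv ℝ F x (EuclideanSpace.single i 1)
  have hv : v = ∑ k, v k • EuclideanSpace.single k (1 : ℝ) := by
    ext m
    simp [Finset.sum_apply, Pi.single_apply]
  conv_lhs => rw [hv]
  rw [map_sum]
  simp [mul_comm]

lemma pd_coord (i k : Fin n) (x : Euc n) : pd i (fun x : Euc n => x k) x = if k = i then 1 else 0 := by
  have e : (fun x : Euc n => x k) =
      (pr k) := rfl
  unfold pd
  rw [e, ContinuousLinearMap.fderiv]
  simp [Pi.single_apply]

lemma JM_id (x : Euc n) : JM (fun x : Euc n => x) x = 1 := by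
  ext k i
  have := pd_coord i k x
  simp only [jac, Matrix.of_apply, Matrix.one_apply]
  exact this

lemma JM_comp {g F : Euc n → Euc n} (hg : ContDiff ℝ ∞ g) (hF : ContDiff ℝ ∞ F) (x : Euc n) :
    JM (fun x => g (F x)) x = JM g (F x) * JM F x := by
  ext k i
  rw [Matrix.mul_apply]
  exact pd_comp i (comps_smooth hg k) hF x

/-- replacing the row `i0` by the gradient of `V ∘ H` -/
lemma det_jac_replace (i0 : Fin n) {V : Euc n → ℝ} (hV : ContDiff ℝ ∞ V) {H : Euc n → Euc n}
    (hH : ContDiff ℝ ∞ H) (x : Euc n) :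
    (jac (fun k => if k = i0 then fun x => V (H x) else comps H k) x).det =
      pd i0 V (H x) * (JM H x).det := by
  have e : jac (fun k => if k = i0 then fun x => V (H x) else comps H k) x =
      (JM H x).updateRow i0 (∑ k, pd k V (H x) • JM H x k) := by
    ext m i
    by_cases hm : m = i0
    · subst hm
      rw [Matrix.updateRow_self]
      simp only [jac, if_true, Matrix.of_apply]
      rw [pd_comp i hV hH]
      simp [Finset.sum_apply, jac]
    · rw [Matrix.updateRow_ne hm]
      simp [jac, hm]
  rw [e, Matrix.det_updateRow_sum]
  rfl

lemma deg_smooth (i0 : Fin n) {V : Euc n → ℝ} (hV : ContDiff ℝ ∞ V)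
    (hVc : HasCompactSupport (pd i0 V)) {H : Euc n → Euc n} (hH : ContDiff ℝ ∞ H)
    (hHc : HasCompactSupport (fun x => H x - x)) :
    ∫ x, pd i0 V (H x) * (JM H x).det = ∫ x, pd i0 V x := by
  classical
  have hid : ContDiff ℝ ∞ (fun x : Euc n => x) := contDiff_id
  have key := integral_det_diff (fun k => if k = i0 then fun x => V (H x) else comps H k)
    (fun k => if k = i0 then fun x => V x else comps (fun x => x) k)
    (by
      intro k
      by_cases hk : k = i0
      · subst hk; simp only [if_true]; exact hV.comp hH
      · simpa [hk] using comps_smooth hH k)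
    (by
      intro k
      by_cases hk : k = i0
      · simpa [hk] using hV
      · simpa [hk] using comps_smooth hid k)
    (by
      intro k
      apply hHc.mono
      intro x hx
      simp only [Function.mem_support, ne_eq] at hx ⊢
      intro h0
      apply hx
      have h0' : H x = x := sub_eq_zero.1 h0
      by_cases hk : k = i0
      · simp [hk, h0']
      · simp [hk, comps, h0'])
  simp_rw [det_jac_replace i0 hV hH] at key
  have e2 := fun x => det_jac_replace i0 hV hid x
  simp only [JM_id, Matrix.det_one, mul_one] at e2
  simp_rw [e2] at key
  have hi : Integrable (pd i0 V) := (pd_smooth i0 hV).continuous.integrable_of_hasCompactSupport hVc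
  have := integral_add key.1 hi
  simp only [sub_add_cancel] at this
  rw [this, key.2, zero_add]

/-- The weak Piola identity for smooth maps. -/
lemma piola_smooth {F : Euc n → Euc n} (hF : ContDiff ℝ ∞ F) {η : Euc n → ℝ}
    (hη : ContDiff ℝ ∞ η) (hηc : HasCompactSupport η) {w : Euc n → ℝ} (hw : ContDiff ℝ ∞ w)
    (j : Fin n) :
    ∫ x, (η x * (pd j w (F x) * (JM F x).det) +
      w (F x) * ((JM F x).updateRow j (fun i => pd i η x)).det) = 0 := by
  have hwF : ContDiff ℝ ∞ (fun x => w (F x)) := hw.comp hF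
  rw [← integral_det_eq_zero (fun k => if k = j then fun x => η x * w (F x) else comps F k)
    (by
      intro k
      by_cases hk : k = j
      · simpa [hk] using hη.mul hwF
      · simpa [hk] using comps_smooth hF k) j (by simp only [if_true]; exact hηc.mul_right)]
  congr 1
  ext x
  have e : jac (fun k => if k = j then fun x => η x * w (F x) else comps F k) x =
      (JM F x).updateRow j (η x • (∑ k, pd k w (F x) • JM F x k) +
        w (F x) • (fun i => pd i η x)) := by
    ext m i
    by_cases hm : m = j
    · subst hm
      rw [Matrix.updateRow_self]
      simp only [jac, if_true, Matrix.of_apply]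
      rw [pd_mul i hη hwF, pd_comp i hw hF]
      simp [Finset.sum_apply, jac]
    · rw [Matrix.updateRow_ne hm]
      simp [jac, hm]
  rw [e, Matrix.det_updateRow_add, Matrix.det_updateRow_smul, Matrix.det_updateRow_smul,
    Matrix.det_updateRow_sum]
  rfl

/-- A suitable positive bump which is a partial derivative. -/
lemma exists_bump (i0 : Fin n) (x0 : Euc n) {s : ℝ} (hs : 0 < s) :
    ∃ V : Euc n → ℝ, ContDiff ℝ ∞ V ∧ HasCompactSupport (pd i0 V) ∧
      (∀ x, 0 ≤ pd i0 V x) ∧ 0 < pd i0 V x0 ∧ (∀ x, pd i0 V x ≠ 0 → dist x x0 < s) := by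
  obtain ⟨b, hb⟩ : ∃ b : ContDiffBump (0 : ℝ), b.rOut = s / (n + 1) := by
    refine ⟨⟨s / (n + 1) / 2, s / (n + 1), by positivity, by
      have : 0 < s / (n + 1) := by positivity
      linarith⟩, rfl⟩
  have hbs : ContDiff ℝ ∞ b := b.contDiff
  set B : ℝ → ℝ := fun t => ∫ z in (0 : ℝ)..t, b z with hB
  have hBd : ∀ t, HasDerivAt B (b t) t := fun t =>
    b.continuous.integral_hasStrictDerivAt 0 t |>.hasDerivAt
  have hBs : ContDiff ℝ ∞ B := by
    rw [contDiff_infty_iff_deriv]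
    refine ⟨fun t => (hBd t).differentiableAt, ?_⟩
    have : deriv B = b := by ext t; exact (hBd t).deriv
    rw [this]; exact hbs
  have hco : ∀ k : Fin n, ContDiff ℝ ∞ (fun x : Euc n => x k - x0 k) := fun k =>
    (coord_smooth k).sub contDiff_const
  set V : Euc n → ℝ := fun x => ∏ k, (if k = i0 then B else b) (x k - x0 k) with hV
  have hfac : ∀ k : Fin n, ContDiff ℝ ∞ (fun x : Euc n => (if k = i0 then B else b) (x k - x0 k)) := by
    intro k
    by_cases hk : k = i0
    · subst hk; simp only [if_true]; exact hBs.comp (hco k)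
    · simp only [hk, if_false]; exact hbs.comp (hco k)
  have hVs : ContDiff ℝ ∞ V := contDiff_prod (fun k _ => hfac k)
  have hpdcoord : ∀ (k : Fin n) (φ : ℝ → ℝ) (φ' : ℝ) (x : Euc n), HasDerivAt φ φ' (x k - x0 k) →
      pd i0 (fun x : Euc n => φ (x k - x0 k)) x = if k = i0 then φ' else 0 := by
    intro k φ φ' x hφ
    have h1 : HasFDerivAt (fun x : Euc n => x k - x0 k)
      (pr k) x :=
      (pr k).hasFDerivAt.sub_const _
    have h2 := hφ.comp_hasFDerivAt x h1
    unfold pd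
    have e : (fun x : Euc n => φ (x k - x0 k)) = φ ∘ (fun x : Euc n => x k - x0 k) := rfl
    rw [e, h2.fderiv]
    simp [Pi.single_apply]
  have hu : ∀ x, pd i0 V x = ∏ k, b (x k - x0 k) := by
    intro x
    rw [hV, pd_prod i0 _ _ hfac x, Finset.sum_eq_single i0]
    · rw [← Finset.prod_erase_mul _ _ (Finset.mem_univ i0)]
      congr 1
      · apply Finset.prod_congr rfl
        intro k hk
        simp [Finset.ne_of_mem_erase hk]
      · have := hpdcoord i0 B _ x (hBd _)
        simpa using this
    · intro k _ hk
      have := hpdcoord k b _ x ((hbs.differentiable (by simp) _).hasDerivAt)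
      simp only [hk, if_false] at this ⊢
      rw [this, mul_zero]
    · simp
  have hsupp : ∀ x, pd i0 V x ≠ 0 → dist x x0 < s := by
    intro x hx
    rw [hu, Finset.prod_ne_zero_iff] at hx
    have hk : ∀ k, |x k - x0 k| < s / (n + 1) := by
      intro k
      have : (x k - x0 k) ∈ Function.support b := hx k (Finset.mem_univ k)
      rw [b.support_eq, hb] at this
      simpa using this
    rw [EuclideanSpace.dist_eq, Real.sqrt_lt' hs]
    calc ∑ k, dist (x k) (x0 k) ^ 2 ≤ ∑ k : Fin n, (s / (n + 1)) ^ 2 := by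
          apply Finset.sum_le_sum
          intro k _
          rw [Real.dist_eq]
          exact pow_le_pow_left₀ (abs_nonneg _) (hk k).le 2
      _ = n * (s / (n + 1)) ^ 2 := by simp
      _ < s ^ 2 := by
          rw [div_pow, mul_div_assoc', div_lt_iff₀ (by positivity)]
          have : (0 : ℝ) ≤ n := by positivity
          nlinarith [pow_pos hs 2, mul_nonneg this (pow_pos hs 2).le]
  refine ⟨V, hVs, ?_, ?_, ?_, hsupp⟩
  · apply HasCompactSupport.of_support_subset_isCompact (isCompact_closedBall x0 s)
    intro x hx
    exact (hsupp x hx).le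
  · intro x
    rw [hu]
    exact Finset.prod_nonneg (fun k _ => b.nonneg)
  · rw [hu]
    apply Finset.prod_pos
    intro k _
    apply b.pos_of_mem_ball
    simp [b.rOut_pos]

end QC

open MeasureTheory Metric Set
open scoped ENNReal NNReal

namespace QC

open scoped ContDiff Topology Convolution
open Filter

variable {n : ℕ}

/-- Generalized dominated convergence. -/
lemma pratt {α : Type*} [MeasurableSpace α] {μ : Measure α} (g : ℕ → α → ℝ) (g' : α → ℝ)
    (m : ℕ → α → ℝ) (m' : α → ℝ) (hg : ∀ k, AEStronglyMeasurable (g k) μ)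
    (hm : ∀ k, Integrable (m k) μ) (hm' : Integrable m' μ)
    (hb : ∀ k, ∀ᵐ x ∂μ, |g k x| ≤ m k x)
    (hgl : ∀ᵐ x ∂μ, Tendsto (fun k => g k x) atTop (𝓝 (g' x)))
    (hml : ∀ᵐ x ∂μ, Tendsto (fun k => m k x) atTop (𝓝 (m' x)))
    (hi : Tendsto (fun k => ∫ x, m k x ∂μ) atTop (𝓝 (∫ x, m' x ∂μ))) :
    Tendsto (fun k => ∫ x, g k x ∂μ) atTop (𝓝 (∫ x, g' x ∂μ)) := by
  have hgi : ∀ k, Integrable (g k) μ := fun k => (hm k).mono' (hg k) (hb k)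
  have hb' : ∀ᵐ x ∂μ, ∀ k, |g k x| ≤ m k x := ae_all_iff.2 hb
  have hm0 : ∀ᵐ x ∂μ, 0 ≤ m' x := by
    filter_upwards [hb', hml] with x h1 h2
    exact ge_of_tendsto' h2 (fun k => (abs_nonneg _).trans (h1 k))
  have hg'b : ∀ᵐ x ∂μ, |g' x| ≤ m' x := by
    filter_upwards [hb', hml, hgl] with x h1 h2 h3
    exact le_of_tendsto_of_tendsto' h3.abs h2 h1
  -- clipped functions
  let c : ℕ → α → ℝ := fun k x => max (-m' x) (min (g k x) (m' x))
  have hcm : ∀ k, AEStronglyMeasurable (c k) μ := fun k =>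
    hm'.1.neg.sup ((hg k).inf hm'.1)
  have hcb : ∀ k, ∀ᵐ x ∂μ, ‖c k x‖ ≤ m' x := by
    intro k
    filter_upwards [hm0] with x h0
    rw [Real.norm_eq_abs, abs_le]
    exact ⟨le_max_left _ _, max_le (by linarith) (min_le_right _ _)⟩
  have hcl : Tendsto (fun k => ∫ x, c k x ∂μ) atTop (𝓝 (∫ x, g' x ∂μ)) := by
    apply tendsto_integral_of_dominated_convergence m' hcm hm' hcb
    filter_upwards [hgl, hg'b] with x h1 h2
    have : g' x = max (-m' x) (min (g' x) (m' x)) := by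
      rw [abs_le] at h2
      rw [min_eq_left h2.2, max_eq_right h2.1]
    rw [this]
    exact tendsto_const_nhds.max (h1.min tendsto_const_nhds)
  have hci : ∀ k, Integrable (c k) μ := fun k => hm'.mono' (hcm k) (hcb k)
  let q : ℕ → α → ℝ := fun k x => max (m' x - m k x) 0
  have hqm : ∀ k, AEStronglyMeasurable (q k) μ := fun k =>
    (hm'.1.sub (hm k).1).sup aestronglyMeasurable_const
  have hqb : ∀ k, ∀ᵐ x ∂μ, ‖q k x‖ ≤ m' x := by
    intro k
    filter_upwards [hm0, hb k] with x h0 h1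
    rw [Real.norm_eq_abs, abs_of_nonneg (le_max_right _ _)]
    exact max_le (by linarith [abs_nonneg (g k x)]) h0
  have hql : Tendsto (fun k => ∫ x, q k x ∂μ) atTop (𝓝 0) := by
    have : (0 : ℝ) = ∫ x, (0 : ℝ) ∂μ := by simp
    rw [this]
    apply tendsto_integral_of_dominated_convergence m' hqm hm' hqb
    filter_upwards [hml] with x h1
    have : (0 : ℝ) = max (m' x - m' x) 0 := by simp
    rw [this]
    exact (tendsto_const_nhds.sub h1).max tendsto_const_nhds
  have hqi : ∀ k, Integrable (q k) μ := fun k => hm'.mono' (hqm k) (hqb k)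
  have hbd : ∀ k, |∫ x, g k x ∂μ - ∫ x, c k x ∂μ| ≤
      (∫ x, m k x ∂μ - ∫ x, m' x ∂μ) + ∫ x, q k x ∂μ := by
    intro k
    rw [← integral_sub (hgi k) (hci k), ← integral_sub (hm k) hm',
      ← integral_add (f := fun x => m k x - m' x) ((hm k).sub hm') (hqi k)]
    rw [← Real.norm_eq_abs]
    refine (norm_integral_le_integral_norm _).trans ?_
    apply integral_mono_ae ((hgi k).sub (hci k)).norm (((hm k).sub hm').add (hqi k))
    filter_upwards [hb k, hm0] with x h1 h0
    simp only [Pi.sub_apply, Pi.add_apply, Real.norm_eq_abs, c, q]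
    rw [abs_le] at h1
    rcases le_total (g k x) (m' x) with h | h
    · rw [min_eq_left h]
      rcases le_total (-m' x) (g k x) with h2 | h2
      · rw [max_eq_right h2, sub_self, abs_zero]
        linarith [le_max_left (m' x - m k x) 0]
      · rw [max_eq_left h2, abs_of_nonpos (by linarith)]
        linarith [le_max_right (m' x - m k x) 0]
    · rw [min_eq_right h, max_eq_right (by linarith), abs_of_nonneg (by linarith)]
      linarith [le_max_right (m' x - m k x) 0]
  have h0 : Tendsto (fun k => ∫ x, g k x ∂μ - ∫ x, c k x ∂μ) atTop (𝓝 0) := by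
    apply squeeze_zero_norm hbd
    have := (hi.sub_const (∫ x, m' x ∂μ)).add hql
    simpa using this
  have := h0.add hcl
  simpa using this

lemma jensen_pow {α : Type*} [MeasurableSpace α] {μ : Measure α} (ρ g : α → ℝ) (hρ : ∀ x, 0 ≤ ρ x)
    (hρi : Integrable ρ μ) (hρ1 : ∫ x, ρ x ∂μ = 1)
    (h1 : Integrable (fun x => ρ x * g x) μ) (n : ℕ)
    (h2 : Integrable (fun x => ρ x * |g x| ^ n) μ) :
    |∫ x, ρ x * g x ∂μ| ^ n ≤ ∫ x, ρ x * |g x| ^ n ∂μ := by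
  rcases Nat.eq_zero_or_pos n with hn | hn
  · subst hn; simp [hρ1]
  set a := |∫ x, ρ x * g x ∂μ| with ha
  have h1' : Integrable (fun x => ρ x * |g x|) μ := by
    have := h1.abs
    refine this.congr ?_
    filter_upwards with x
    rw [abs_mul, abs_of_nonneg (hρ x)]
  have hle : a ≤ ∫ x, ρ x * |g x| ∂μ := by
    rw [ha, ← Real.norm_eq_abs]
    refine (norm_integral_le_integral_norm _).trans (le_of_eq ?_)
    congr 1
    ext x
    rw [Real.norm_eq_abs, abs_mul, abs_of_nonneg (hρ x)]
  have ha0 : 0 ≤ a := abs_nonneg _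
  rcases ha0.eq_or_lt with h0 | h0
  · rw [← h0, zero_pow hn.ne']
    exact integral_nonneg (fun x => mul_nonneg (hρ x) (by positivity))
  have tang : ∀ t : ℝ, 0 ≤ t → a ^ n + n * a ^ (n - 1) * (t - a) ≤ t ^ n := by
    intro t ht
    have := one_add_mul_sub_le_pow (a := t / a) (n := n) (by
      have : 0 ≤ t / a := by positivity
      linarith)
    have e : t ^ n = a ^ n * (t / a) ^ n := by
      rw [← mul_pow, mul_div_cancel₀ _ h0.ne']
    have e2 : a ^ n = a ^ (n - 1) * a := by
      rw [← pow_succ, Nat.sub_add_cancel hn]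
    rw [e]
    calc a ^ n + n * a ^ (n - 1) * (t - a) = a ^ n * (1 + n * (t / a - 1)) := by
          rw [e2]; field_simp
      _ ≤ _ := mul_le_mul_of_nonneg_left this (by positivity)
  calc a ^ n ≤ a ^ n + n * a ^ (n - 1) * ((∫ x, ρ x * |g x| ∂μ) - a) := by
        have : 0 ≤ n * a ^ (n - 1) * ((∫ x, ρ x * |g x| ∂μ) - a) :=
          mul_nonneg (by positivity) (by linarith)
        linarith
    _ = ∫ x, (a ^ n - n * a ^ (n - 1) * a) * ρ x + n * a ^ (n - 1) * (ρ x * |g x|) ∂μ := by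
        rw [integral_add (hρi.const_mul _) (h1'.const_mul _), integral_const_mul,
          integral_const_mul, hρ1]
        ring
    _ ≤ _ := by
        apply integral_mono ((hρi.const_mul _).add (h1'.const_mul _)) h2
        intro x
        have := mul_le_mul_of_nonneg_left (tang |g x| (abs_nonneg _)) (hρ x)
        simp only [Pi.add_apply]
        linarith

end QC

open MeasureTheory Metric Set
open scoped ENNReal NNReal

namespace QC

open scoped ContDiff Topology Convolution
open Filter

variable {n : ℕ}

/-- continuous `W^{1,n}_loc` maps -/
structure WS (Ω : Set (Euc n)) (F : Euc n → Euc n) (D : Euc n → Matrix (Fin n) (Fin n) ℝ) :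
    Prop where
  cont : ContinuousOn F Ω
  int : ∀ i j, LocallyIntegrableOn (fun x => D x i j) Ω volume
  intp : ∀ i j, LocallyIntegrableOn (fun x => |D x i j| ^ n) Ω volume
  parts : ∀ φ : Euc n → ℝ, ContDiff ℝ ∞ φ → HasCompactSupport φ → tsupport φ ⊆ Ω →
    ∀ i j : Fin n, ∫ x in Ω, F x i * pd j φ x = - ∫ x in Ω, D x i j * φ x

lemma conv_eq (ρ g : Euc n → ℝ) (x : Euc n) :
    (ρ ⋆[ContinuousLinearMap.lsmul ℝ ℝ, volume] g) x = ∫ t, ρ (x - t) * g t := by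
  rw [convolution_eq_swap]; rfl

lemma pd_conv (ρ g : Euc n → ℝ) (hρ : ContDiff ℝ ∞ ρ) (hρc : HasCompactSupport ρ)
    (hg : LocallyIntegrable g volume) (x : Euc n) (j : Fin n) :
    pd j (ρ ⋆[ContinuousLinearMap.lsmul ℝ ℝ, volume] g) x = ∫ t, pd j ρ (x - t) * g t := by
  have h1 := hρc.hasFDerivAt_convolution_left (ContinuousLinearMap.lsmul ℝ ℝ)
    (hρ.of_le (by simp)) hg x
  unfold pd
  rw [h1.fderiv, convolution_eq_swap]
  have hex := (hρc.fderiv ℝ).convolutionExists_left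
    ((ContinuousLinearMap.lsmul ℝ ℝ).precompL (Euc n)) (g := g)
    (hρ.continuous_fderiv (by simp)) hg x
  have hex2 := hex.integrable_swap
  rw [ContinuousLinearMap.integral_apply hex2]
  rfl

lemma pd_refl (ρ : Euc n → ℝ) (hρ : ContDiff ℝ ∞ ρ) (x t : Euc n) (j : Fin n) :
    pd j (fun t => ρ (x - t)) t = - pd j ρ (x - t) := by
  unfold pd
  have h1 : HasFDerivAt (fun t : Euc n => x - t) (-ContinuousLinearMap.id ℝ (Euc n)) t :=
    (hasFDerivAt_id t).const_sub x
  have h2 : HasFDerivAt ρ (fderiv ℝ ρ (x - t)) (x - t) :=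
    (hρ.differentiable (by simp) _).hasFDerivAt
  have h3 : HasFDerivAt (fun t : Euc n => ρ (x - t)) _ t := h2.comp t h1
  rw [h3.fderiv]
  simp

section moll

variable {Ω : Set (Euc n)} {F : Euc n → Euc n} {D : Euc n → Matrix (Fin n) (Fin n) ℝ}

/-- derivative of the mollification -/
lemma moll_deriv (hΩ : IsOpen Ω) (hW : WS Ω F D) {K' : Set (Euc n)} (hK' : IsCompact K')
    (hK'Ω : K' ⊆ Ω) (φ : ContDiffBump (0 : Euc n)) (x : Euc n)
    (hx : closedBall x φ.rOut ⊆ K') (i j : Fin n) :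
    JM (φ.normed volume ⋆[ContinuousLinearMap.lsmul ℝ ℝ, volume] (K'.indicator F)) x i j =
      ((φ.normed volume : Euc n → ℝ) ⋆[ContinuousLinearMap.lsmul ℝ ℝ, volume]
        (K'.indicator (fun x => D x i j))) x := by
  set ρ : Euc n → ℝ := φ.normed volume with hρdef
  have hρ : ContDiff ℝ ∞ ρ := φ.contDiff_normed
  have hρc : HasCompactSupport ρ := φ.hasCompactSupport_normed
  have hFi : Integrable (K'.indicator F) :=
    (integrable_indicator_iff hK'.measurableSet).2 ((hW.cont.mono hK'Ω).integrableOn_compact hK')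
  have hcomp : comps (ρ ⋆[ContinuousLinearMap.lsmul ℝ ℝ, volume] (K'.indicator F)) i =
      ρ ⋆[ContinuousLinearMap.lsmul ℝ ℝ, volume] (K'.indicator (fun x => F x i)) := by
    ext z
    have hex := hρc.convolutionExists_left (ContinuousLinearMap.lsmul ℝ ℝ)
      hρ.continuous hFi.locallyIntegrable z
    have := (pr i).integral_comp_comm hex.integrable_swap
    simp only [comps]
    rw [convolution_eq_swap, conv_eq]
    refine this.symm.trans ?_
    congr 1
    ext t
    by_cases ht : t ∈ K' <;> simp [ht]
  have hFi2 : Integrable (K'.indicator (fun x => F x i)) := by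
    have := (pr i).integrable_comp hFi
    refine this.congr ?_
    filter_upwards with t
    by_cases ht : t ∈ K' <;> simp [ht]
  simp only [jac, Matrix.of_apply]
  rw [hcomp, pd_conv ρ _ hρ hρc hFi2.locallyIntegrable, conv_eq]
  -- test function
  have hts : Function.support (fun t => ρ (x - t)) ⊆ ball x φ.rOut := by
    intro t ht
    have : x - t ∈ Function.support ρ := ht
    rw [hρdef, φ.support_normed_eq] at this
    simpa [dist_eq_norm, norm_sub_rev] using this
  have htts : tsupport (fun t => ρ (x - t)) ⊆ closedBall x φ.rOut :=
    closure_minimal (hts.trans ball_subset_closedBall) isClosed_closedBall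
  have hsm : ContDiff ℝ ∞ (fun t => ρ (x - t)) := hρ.comp (contDiff_const.sub contDiff_id)
  have hparts := hW.parts (fun t => ρ (x - t)) hsm
    (HasCompactSupport.of_support_subset_isCompact (isCompact_closedBall x φ.rOut)
      (hts.trans ball_subset_closedBall)) (htts.trans (hx.trans hK'Ω)) i j
  have e1 : ∫ t in Ω, F t i * pd j (fun t => ρ (x - t)) t =
      - ∫ t, pd j ρ (x - t) * K'.indicator (fun x => F x i) t := by
    rw [← integral_indicator hΩ.measurableSet, ← integral_neg]
    congr 1
    ext t
    by_cases ht : t ∈ K'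
    · simp only [indicator_of_mem (hK'Ω ht), indicator_of_mem ht, pd_refl ρ hρ]
      ring
    · have hz : pd j (fun t => ρ (x - t)) t = 0 := by
        have : (fun t => ρ (x - t)) =ᶠ[𝓝 t] fun _ => 0 :=
          notMem_tsupport_iff_eventuallyEq.1 (fun h => ht (hx (htts h)))
        simp [pd, this.fderiv_eq]
      rw [indicator_of_notMem ht]
      by_cases ht2 : t ∈ Ω
      · rw [indicator_of_mem ht2, hz]; simp
      · rw [indicator_of_notMem ht2]; simp
  have e2 : ∫ t in Ω, D t i j * ρ (x - t) =
      ∫ t, ρ (x - t) * K'.indicator (fun x => D x i j) t := by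
    rw [← integral_indicator hΩ.measurableSet]
    congr 1
    ext t
    by_cases ht : t ∈ K'
    · simp only [indicator_of_mem (hK'Ω ht), indicator_of_mem ht]
      ring
    · have hz : ρ (x - t) = 0 := by
        by_contra h0
        exact ht (hx (ball_subset_closedBall (hts h0)))
      rw [indicator_of_notMem ht]
      by_cases ht2 : t ∈ Ω
      · rw [indicator_of_mem ht2, hz]; simp
      · rw [indicator_of_notMem ht2]; simp
  rw [e1, e2] at hparts
  linarith

/-- The approximation lemma. -/
lemma approx (hΩ : IsOpen Ω) (hW : WS Ω F D) {K : Set (Euc n)} (hK : IsCompact K) (hKΩ : K ⊆ Ω) :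
    ∃ Fk : ℕ → Euc n → Euc n, (∀ k, ContDiff ℝ ∞ (Fk k)) ∧ (∀ k, HasCompactSupport (Fk k)) ∧
      (∀ ε > 0, ∀ᶠ k in atTop, ∀ x ∈ K, dist (Fk k x) (F x) ≤ ε) ∧
      ∀ (Θ : Euc n → Euc n → Matrix (Fin n) (Fin n) ℝ → ℝ) (C : ℝ),
        Continuous (fun p : Euc n × Euc n × Matrix (Fin n) (Fin n) ℝ => Θ p.1 p.2.1 p.2.2) →
        (∀ x y A, |Θ x y A| ≤ C * (1 + ∑ i, ∑ j, |A i j| ^ n)) →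
        Tendsto (fun k => ∫ x in K, Θ x (Fk k x) (JM (Fk k) x)) atTop
          (𝓝 (∫ x in K, Θ x (F x) (D x))) := by
  obtain ⟨δ, hδ, hδΩ⟩ := hK.exists_cthickening_subset_open hΩ hKΩ
  set K' := cthickening δ K with hK'def
  have hK' : IsCompact K' := hK.cthickening
  have hKK' : K ⊆ K' := self_subset_cthickening K
  let φ : ℕ → ContDiffBump (0 : Euc n) := fun k =>
    ⟨δ / (k + 2) / 2, δ / (k + 2), by positivity, by
      have : 0 < δ / (k + 2) := by positivity
      linarith⟩
  have hrO : ∀ k, (φ k).rOut = δ / (k + 2) := fun k => rfl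
  have hrI : ∀ k, (φ k).rIn = δ / (k + 2) / 2 := fun k => rfl
  have hrle : ∀ k, (φ k).rOut ≤ δ := by
    intro k
    rw [hrO]
    apply div_le_self hδ.le
    have : (0 : ℝ) ≤ k := by positivity
    linarith
  have hr0 : Tendsto (fun k => (φ k).rOut) atTop (𝓝 0) := by
    simp_rw [hrO]
    apply Tendsto.const_div_atTop
    exact tendsto_atTop_add_const_right _ _ tendsto_natCast_atTop_atTop
  have hball : ∀ k, ∀ x ∈ K, closedBall x (φ k).rOut ⊆ K' := by
    intro k x hx
    exact (closedBall_subset_cthickening hx _).trans (cthickening_mono (hrle k) K)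
  have hFi : Integrable (K'.indicator F) :=
    (integrable_indicator_iff hK'.measurableSet).2 ((hW.cont.mono hδΩ).integrableOn_compact hK')
  set Fk : ℕ → Euc n → Euc n := fun k =>
    ((φ k).normed volume ⋆[ContinuousLinearMap.lsmul ℝ ℝ, volume] (K'.indicator F)) with hFk
  have hsm : ∀ k, ContDiff ℝ ∞ (Fk k) := fun k =>
    (φ k).hasCompactSupport_normed.contDiff_convolution_left _ (φ k).contDiff_normed
      hFi.locallyIntegrable
  have hcs : ∀ k, HasCompactSupport (Fk k) := fun k =>
    (φ k).hasCompactSupport_normed.convolution _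
      (HasCompactSupport.of_support_subset_isCompact hK' support_indicator_subset)
  have hunif : ∀ ε > 0, ∀ᶠ k in atTop, ∀ x ∈ K, dist (Fk k x) (F x) ≤ ε := by
    intro ε hε
    have huc := hK'.uniformContinuousOn_of_continuous (hW.cont.mono hδΩ)
    rw [Metric.uniformContinuousOn_iff] at huc
    obtain ⟨r, hr, hr2⟩ := huc ε hε
    filter_upwards [hr0.eventually (gt_mem_nhds hr)] with k hk x hx
    have e : F x = K'.indicator F x := by rw [indicator_of_mem (hKK' hx)]
    rw [e]
    apply ContDiffBump.dist_normed_convolution_le hFi.1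
    intro z hz
    have hzK : z ∈ K' := hball k x hx (ball_subset_closedBall hz)
    rw [indicator_of_mem hzK, indicator_of_mem (hKK' hx)]
    exact (hr2 z hzK x (hKK' hx) (lt_trans hz hk)).le
  refine ⟨Fk, hsm, hcs, hunif, ?_⟩
  intro Θ C hΘ hΘb
  have hDi : ∀ i j, Integrable (K'.indicator (fun x => D x i j)) := fun i j =>
    (integrable_indicator_iff hK'.measurableSet).2
      ((hW.int i j).integrableOn_compact_subset hδΩ hK')
  have hMi : ∀ i j, Integrable (K'.indicator (fun x => |D x i j| ^ n)) := fun i j =>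
    (integrable_indicator_iff hK'.measurableSet).2
      ((hW.intp i j).integrableOn_compact_subset hδΩ hK')
  -- the convolution facts
  let cD : ℕ → Fin n → Fin n → Euc n → ℝ := fun k i j =>
    ((φ k).normed volume ⋆[ContinuousLinearMap.lsmul ℝ ℝ, volume]
      (K'.indicator (fun x => D x i j)))
  let cM : ℕ → Fin n → Fin n → Euc n → ℝ := fun k i j =>
    ((φ k).normed volume ⋆[ContinuousLinearMap.lsmul ℝ ℝ, volume]
      (K'.indicator (fun x => |D x i j| ^ n)))
  have hJ : ∀ k, ∀ x ∈ K, ∀ i j, JM (Fk k) x i j = cD k i j x := fun k x hx i j =>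
    moll_deriv hΩ hW hK' hδΩ (φ k) x (hball k x hx) i j
  have hjen : ∀ k, ∀ x ∈ K, ∀ i j, |cD k i j x| ^ n ≤ cM k i j x := by
    intro k x hx i j
    simp only [cD, cM, conv_eq]
    have hρi : Integrable (fun t => (φ k).normed volume (x - t)) :=
      (φ k).integrable_normed.comp_sub_left x
    have e : ∀ t, (φ k).normed volume (x - t) * K'.indicator (fun x => |D x i j| ^ n) t =
      (φ k).normed volume (x - t) * |K'.indicator (fun x => D x i j) t| ^ n := by
      intro t
      by_cases ht : t ∈ K'
      · simp [ht]
      · have : (φ k).normed volume (x - t) = 0 := by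
          by_contra h0
          have h1 : x - t ∈ Function.support ((φ k).normed volume) := h0
          rw [(φ k).support_normed_eq] at h1
          apply ht
          apply hball k x hx
          apply ball_subset_closedBall
          simpa [dist_eq_norm, norm_sub_rev] using h1
        simp [this]
    have i2 := ((φ k).hasCompactSupport_normed (μ := volume)).convolutionExists_left
      (ContinuousLinearMap.lsmul ℝ ℝ)
      (φ k).continuous_normed (hMi i j).locallyIntegrable x |>.integrable_swap
    have i1 := ((φ k).hasCompactSupport_normed (μ := volume)).convolutionExists_left
      (ContinuousLinearMap.lsmul ℝ ℝ)
      (φ k).continuous_normed (hDi i j).locallyIntegrable x |>.integrable_swap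
    simp only [ContinuousLinearMap.lsmul_apply, smul_eq_mul] at i1 i2
    simp_rw [e] at i2 ⊢
    apply jensen_pow _ _ (fun t => (φ k).nonneg_normed _) hρi _ i1 n i2
    rw [integral_sub_left_eq_self (fun t => (φ k).normed volume t) volume x]
    exact (φ k).integral_normed
  have hcMi : ∀ k i j, Integrable (cM k i j) := fun k i j =>
    (φ k).integrable_normed.integrable_convolution _ (hMi i j)
  have hcMint : ∀ k i j, ∫ x, cM k i j x = ∫ x, K'.indicator (fun x => |D x i j| ^ n) x := by
    intro k i j
    simp only [cM]
    rw [integral_convolution _ (φ k).integrable_normed (hMi i j), (φ k).integral_normed]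
    simp
  have hratio : ∀ᶠ k in atTop, (φ k).rOut ≤ 2 * (φ k).rIn := by
    filter_upwards with k
    rw [hrO, hrI]; linarith
  have hDl : ∀ᵐ x, ∀ i j, Tendsto (fun k => cD k i j x) atTop
      (𝓝 (K'.indicator (fun x => D x i j) x)) := by
    rw [ae_all_iff]; intro i
    rw [ae_all_iff]; intro j
    exact ContDiffBump.ae_convolution_tendsto_right_of_locallyIntegrable hr0 hratio
      (hDi i j).locallyIntegrable
  have hMl : ∀ᵐ x, ∀ i j, Tendsto (fun k => cM k i j x) atTop
      (𝓝 (K'.indicator (fun x => |D x i j| ^ n) x)) := by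
    rw [ae_all_iff]; intro i
    rw [ae_all_iff]; intro j
    exact ContDiffBump.ae_convolution_tendsto_right_of_locallyIntegrable hr0 hratio
      (hMi i j).locallyIntegrable
  have hone : Integrable (K.indicator (fun _ => (1 : ℝ))) :=
    (integrable_indicator_iff hK.measurableSet).2 (integrableOn_const hK.measure_lt_top.ne)
  have hC : 0 ≤ C := by
    have := (abs_nonneg _).trans (hΘb 0 0 0)
    have h2 : (0 : ℝ) < 1 + ∑ i : Fin n, ∑ j : Fin n, |(0 : Matrix (Fin n) (Fin n) ℝ) i j| ^ n := by
      have : (0 : ℝ) ≤ ∑ i : Fin n, ∑ j : Fin n, |(0 : Matrix (Fin n) (Fin n) ℝ) i j| ^ n :=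
        Finset.sum_nonneg fun i _ => Finset.sum_nonneg fun j _ => by positivity
      linarith
    exact nonneg_of_mul_nonneg_left this h2
  have hcM0 : ∀ k i j x, 0 ≤ cM k i j x := by
    intro k i j x
    simp only [cM, conv_eq]
    apply integral_nonneg
    intro t
    apply mul_nonneg ((φ k).nonneg_normed _)
    apply indicator_nonneg
    intro z _
    positivity
  simp_rw [← integral_indicator hK.measurableSet]
  refine pratt _ _ (fun k x => C * (K.indicator (fun _ => (1 : ℝ)) x + ∑ i, ∑ j, cM k i j x))
    (fun x => C * (K.indicator (fun _ => (1 : ℝ)) x +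
      ∑ i, ∑ j, K'.indicator (fun x => |D x i j| ^ n) x)) ?_ ?_ ?_ ?_ ?_ ?_ ?_
  · intro k
    have hJc : Continuous (fun x => JM (Fk k) x) :=
      continuous_matrix fun i j => (pd_smooth j (comps_smooth (hsm k) i)).continuous
    have : Continuous (fun x => Θ x (Fk k x) (JM (Fk k) x)) :=
      hΘ.comp (continuous_id.prodMk ((hsm k).continuous.prodMk hJc))
    exact this.aestronglyMeasurable.indicator hK.measurableSet
  · intro k
    apply Integrable.const_mul
    apply hone.add
    exact integrable_finsetSum _ fun i _ => integrable_finsetSum _ fun j _ => hcMi k i j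
  · apply Integrable.const_mul
    apply hone.add
    exact integrable_finsetSum _ fun i _ => integrable_finsetSum _ fun j _ => hMi i j
  · intro k
    filter_upwards with x
    by_cases hx : x ∈ K
    · rw [indicator_of_mem hx, indicator_of_mem hx]
      refine (hΘb _ _ _).trans ?_
      apply mul_le_mul_of_nonneg_left _ hC
      gcongr with i _ j _
      rw [hJ k x hx]
      exact hjen k x hx i j
    · rw [indicator_of_notMem hx, indicator_of_notMem hx, abs_zero]
      apply mul_nonneg hC
      rw [zero_add]
      exact Finset.sum_nonneg fun i _ => Finset.sum_nonneg fun j _ => hcM0 k i j x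
  · filter_upwards [hDl] with x hxl
    by_cases hx : x ∈ K
    · simp only [indicator_of_mem hx]
      have h1 : Tendsto (fun k => Fk k x) atTop (𝓝 (F x)) := by
        rw [Metric.tendsto_nhds]
        intro ε hε
        filter_upwards [hunif (ε / 2) (by linarith)] with k hk
        exact (hk x hx).trans_lt (by linarith)
      have h2 : Tendsto (fun k => JM (Fk k) x) atTop (𝓝 (D x)) := by
        refine tendsto_pi_nhds.2 fun i => tendsto_pi_nhds.2 fun j => ?_
        have := hxl i j
        rw [indicator_of_mem (hKK' hx)] at this
        refine this.congr ?_
        intro k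
        exact (hJ k x hx i j).symm
      exact (hΘ.tendsto (x, F x, D x)).comp
        (tendsto_const_nhds.prodMk_nhds (h1.prodMk_nhds h2))
    · simp only [indicator_of_notMem hx]
      exact tendsto_const_nhds
  · filter_upwards [hMl] with x hxl
    apply Tendsto.const_mul
    apply tendsto_const_nhds.add
    exact tendsto_finsetSum _ fun i _ => tendsto_finsetSum _ fun j _ => hxl i j
  · apply tendsto_const_nhds.congr
    intro k
    rw [integral_const_mul, integral_const_mul, integral_add hone, integral_add hone]
    · congr 2
      rw [integral_finsetSum, integral_finsetSum]
      · apply Finset.sum_congr rfl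
        intro i _
        rw [integral_finsetSum, integral_finsetSum]
        · exact Finset.sum_congr rfl fun j _ => (hcMint k i j).symm
        · exact fun j _ => hcMi k i j
        · exact fun j _ => hMi i j
      · exact fun i _ => integrable_finsetSum _ fun j _ => hcMi k i j
      · exact fun i _ => integrable_finsetSum _ fun j _ => hMi i j
    · exact integrable_finsetSum _ fun i _ => integrable_finsetSum _ fun j _ => hcMi k i j
    · exact integrable_finsetSum _ fun i _ => integrable_finsetSum _ fun j _ => hMi i j

end moll

end QC

open MeasureTheory Metric Set
open scoped ENNReal NNReal

namespace QC

open scoped ContDiff Topology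
open Filter

variable {n : ℕ}

lemma ent_bound (hn : n ≠ 0) (A : Matrix (Fin n) (Fin n) ℝ) :
    ∃ a : ℝ, 1 ≤ a ∧ a ^ n = 1 + ∑ i, ∑ j, |A i j| ^ n ∧ ∀ i j, |A i j| ≤ a := by
  have hq : 0 ≤ ∑ i, ∑ j, |A i j| ^ n :=
    Finset.sum_nonneg fun i _ => Finset.sum_nonneg fun j _ => by positivity
  set q := ∑ i, ∑ j, |A i j| ^ n with hqd
  have ha : ((1 + q) ^ ((n : ℝ)⁻¹)) ^ n = 1 + q := Real.rpow_inv_natCast_pow (by linarith) hn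
  have ha0 : 0 ≤ (1 + q) ^ ((n : ℝ)⁻¹) := by positivity
  refine ⟨(1 + q) ^ ((n : ℝ)⁻¹), ?_, ha, ?_⟩
  · rw [← pow_le_pow_iff_left₀ zero_le_one ha0 hn, ha, one_pow]; linarith
  · intro i j
    rw [← pow_le_pow_iff_left₀ (abs_nonneg _) ha0 hn, ha]
    have h1 : |A i j| ^ n ≤ ∑ j, |A i j| ^ n :=
      Finset.single_le_sum (f := fun j => |A i j| ^ n) (fun j _ => by positivity)
        (Finset.mem_univ j)
    have h2 : ∑ j, |A i j| ^ n ≤ q :=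
      Finset.single_le_sum (f := fun i => ∑ j, |A i j| ^ n)
        (fun i _ => Finset.sum_nonneg fun j _ => by positivity) (Finset.mem_univ i)
    linarith

lemma det_bound_ent (A : Matrix (Fin n) (Fin n) ℝ) {a : ℝ} (h : ∀ i j, |A i j| ≤ a) :
    |A.det| ≤ n.factorial * a ^ n := by
  have := Matrix.det_le (A := A) (abv := AbsoluteValue.abs) (x := a) (by simpa using h)
  simpa using this

lemma det_bound (hn : n ≠ 0) (A : Matrix (Fin n) (Fin n) ℝ) :
    |A.det| ≤ n.factorial * (1 + ∑ i, ∑ j, |A i j| ^ n) := by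
  obtain ⟨a, h1, h2, h3⟩ := ent_bound hn A
  rw [← h2]
  exact det_bound_ent A h3

lemma det_upd_bound (hn : n ≠ 0) (A : Matrix (Fin n) (Fin n) ℝ) (j : Fin n) (v : Fin n → ℝ)
    {B : ℝ} (hB : 0 < B) (hv : ∀ i, |v i| ≤ B) :
    |(A.updateRow j v).det| ≤ B * n.factorial * (1 + ∑ i, ∑ j, |A i j| ^ n) := by
  obtain ⟨a, h1, h2, h3⟩ := ent_bound hn A
  have hv' : v = B • (fun i => B⁻¹ * v i) := by
    ext i; simp [hB.ne']
  rw [hv', Matrix.det_updateRow_smul, abs_mul, abs_of_pos hB, mul_assoc, ← h2]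
  gcongr
  apply det_bound_ent
  intro i k
  rw [Matrix.updateRow_apply]
  split_ifs with hi
  · rw [abs_mul, abs_inv, abs_of_pos hB]
    calc B⁻¹ * |v k| ≤ B⁻¹ * B := by gcongr; exact hv k
      _ = 1 := by field_simp
      _ ≤ a := h1
  · exact h3 i k

lemma bdd_of_compact {g : Euc n → ℝ} (hg : Continuous g) (hc : HasCompactSupport g) :
    ∃ B : ℝ, 0 < B ∧ ∀ x, |g x| ≤ B := by
  obtain ⟨C, hC⟩ := hg.bounded_above_of_compact_support hc
  refine ⟨max C 1, by positivity, fun x => ?_⟩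
  exact (hC x).trans (le_max_left _ _)

lemma bdd_of_compact' {g : Fin n → Euc n → ℝ} (hg : ∀ i, Continuous (g i))
    (hc : ∀ i, HasCompactSupport (g i)) :
    ∃ B : ℝ, 0 < B ∧ ∀ i x, |g i x| ≤ B := by
  choose B hB hB' using fun i => bdd_of_compact (hg i) (hc i)
  refine ⟨1 + ∑ i, B i, ?_, fun i x => (hB' i x).trans ?_⟩
  · have : 0 ≤ ∑ i, B i := Finset.sum_nonneg fun i _ => (hB i).le
    linarith
  · have := Finset.single_le_sum (f := B) (fun i _ => (hB i).le) (Finset.mem_univ i)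
    linarith

/-- integrand in the Piola identity -/
def pio (η w : Euc n → ℝ) (j : Fin n) (x y : Euc n) (A : Matrix (Fin n) (Fin n) ℝ) : ℝ :=
  η x * (pd j w y * A.det) + w y * (A.updateRow j (fun i => pd i η x)).det

lemma pio_zero {η w : Euc n → ℝ} {j : Fin n} {x y : Euc n} {A : Matrix (Fin n) (Fin n) ℝ}
    (hx : x ∉ tsupport η) : pio η w j x y A = 0 := by
  have h1 : η x = 0 := image_eq_zero_of_notMem_tsupport hx
  have h2 : ∀ i, pd i η x = 0 := by
    intro i
    unfold pd
    have : fderiv ℝ η x = 0 := by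
      by_contra h
      exact hx (support_fderiv_subset ℝ h)
    simp [this]
  have h3 : (A.updateRow j (fun i => pd i η x)).det = 0 :=
    Matrix.det_eq_zero_of_row_eq_zero j (fun k => by rw [Matrix.updateRow_self]; exact h2 k)
  unfold pio
  rw [h1, h3]
  simp

lemma piola {Ω : Set (Euc n)} {F : Euc n → Euc n} {D : Euc n → Matrix (Fin n) (Fin n) ℝ}
    (hn : n ≠ 0) (hΩ : IsOpen Ω) (hW : WS Ω F D) {η w : Euc n → ℝ} (hη : ContDiff ℝ ∞ η)
    (hηc : HasCompactSupport η) (hηΩ : tsupport η ⊆ Ω) (hw : ContDiff ℝ ∞ w)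
    (hwc : HasCompactSupport w) (j : Fin n) :
    ∫ x in tsupport η, pio η w j x (F x) (D x) = 0 := by
  obtain ⟨Fk, hs, hc, hu, hT⟩ := approx hΩ hW hηc hηΩ
  obtain ⟨B1, hB1, hB1'⟩ := bdd_of_compact hη.continuous hηc
  obtain ⟨B2, hB2, hB2'⟩ := bdd_of_compact hw.continuous hwc
  obtain ⟨B3, hB3, hB3'⟩ := bdd_of_compact (pd_smooth j hw).continuous (pd_compact j hwc)
  obtain ⟨B4, hB4, hB4'⟩ := bdd_of_compact' (fun i => (pd_smooth i hη).continuous)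
    (fun i => pd_compact i hηc)
  have key := hT (pio η w j) (B1 * (B3 * n.factorial) + B2 * (B4 * n.factorial)) ?_ ?_
  · refine tendsto_nhds_unique key ?_
    apply tendsto_const_nhds.congr
    intro k
    rw [setIntegral_eq_integral_of_forall_compl_eq_zero]
    · exact (piola_smooth (hs k) hη hηc hw j).symm
    · intro x hx; exact pio_zero hx
  · unfold pio
    have e1 : Continuous (fun p : Euc n × Euc n × Matrix (Fin n) (Fin n) ℝ => p.2.2.det) :=
      (continuous_snd.comp continuous_snd).matrix_det
    have e2 : Continuous (fun p : Euc n × Euc n × Matrix (Fin n) (Fin n) ℝ =>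
        (p.2.2.updateRow j (fun i => pd i η p.1)).det) := by
      apply Continuous.matrix_det
      apply Continuous.matrix_updateRow
      · exact continuous_snd.comp continuous_snd
      · exact continuous_pi fun i => (pd_smooth i hη).continuous.comp continuous_fst
    have e3 := (pd_smooth j hw).continuous
    have e4 := hη.continuous
    have e5 := hw.continuous
    fun_prop
  · intro x y A
    unfold pio
    have h1 := det_bound hn A
    have h2 := det_upd_bound hn A j (fun i => pd i η x) hB4 (fun i => hB4' i x)
    set q := 1 + ∑ i, ∑ j, |A i j| ^ n
    calc |η x * (pd j w y * A.det) + w y * (A.updateRow j (fun i => pd i η x)).det|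
        ≤ |η x| * (|pd j w y| * |A.det|) + |w y| * |(A.updateRow j (fun i => pd i η x)).det| := by
          refine (abs_add_le _ _).trans ?_
          rw [abs_mul, abs_mul, abs_mul]
      _ ≤ B1 * (B3 * (n.factorial * q)) + B2 * (B4 * n.factorial * q) := by
          gcongr
          · exact hB1' x
          · exact hB3' y
          · exact hB2' y
      _ = _ := by ring

end QC

open MeasureTheory Metric Set
open scoped ENNReal NNReal

namespace QC

open scoped ContDiff Topology
open Filter

variable {n : ℕ}

lemma JM_congr {F G : Euc n → Euc n} {x : Euc n} (h : F =ᶠ[𝓝 x] G) : JM F x = JM G x := by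
  ext k i
  simp only [jac, Matrix.of_apply, pd]
  have : comps F k =ᶠ[𝓝 x] comps G k := h.mono fun y hy => by simp [comps, hy]
  rw [this.fderiv_eq]

lemma hcs_comp {g : Euc n → Euc n} (hgc : HasCompactSupport g) (k : Fin n) :
    HasCompactSupport (comps g k) := by
  apply hgc.mono
  intro x hx h0
  apply hx
  have h0' : g x = 0 := by simpa using h0
  simp [comps, h0']

lemma deg_ws (i0 : Fin n) {Ω : Set (Euc n)} {h : Euc n → Euc n}
    {D : Euc n → Matrix (Fin n) (Fin n) ℝ} (hΩ : IsOpen Ω) (hW : WS Ω h D)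
    {V : Euc n → ℝ} (hV : ContDiff ℝ ∞ V) (hVc : HasCompactSupport (pd i0 V))
    {x0 : Euc n} {s : ℝ} (hs : 0 < s) (hVs : ∀ x, pd i0 V x ≠ 0 → dist x x0 < s)
    (hsub : closedBall x0 (2 * s) ⊆ Ω) {g : Euc n → Euc n} (hg : ContDiff ℝ ∞ g)
    (hgc : HasCompactSupport g)
    (hgs : ∀ x ∈ closedBall x0 (2 * s), dist (g (h x)) x ≤ s / 8) :
    ∫ x in closedBall x0 (2 * s), pd i0 V (g (h x)) * (JM g (h x)).det * (D x).det
      = ∫ x, pd i0 V x := by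
  have hn : n ≠ 0 := by rintro rfl; exact i0.elim0
  set K := closedBall x0 (2 * s) with hK
  have hKc : IsCompact K := isCompact_closedBall _ _
  obtain ⟨Fk, hFs, hFc, hFu, hT⟩ := approx hΩ hW hKc hsub
  have hdc : Continuous (fun y => (JM g y).det) := (det_jac_smooth _ (comps_smooth hg)).continuous
  obtain ⟨B1, hB1, hB1'⟩ := bdd_of_compact (pd_smooth i0 hV).continuous hVc
  obtain ⟨B2, hB2, hB2'⟩ := bdd_of_compact hdc (det_jac_compact _ i0 (hcs_comp hgc i0))
  have key := hT (fun x y A => pd i0 V (g y) * (JM g y).det * A.det)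
    (B1 * B2 * n.factorial) ?_ ?_
  · refine tendsto_nhds_unique key ?_
    have huc : UniformContinuous g := hg.continuous.uniformContinuous_of_tendsto_cocompact
      (hgc.is_zero_at_infty)
    rw [Metric.uniformContinuous_iff] at huc
    obtain ⟨δ, hδ, hδ'⟩ := huc (s / 8) (by linarith)
    apply tendsto_const_nhds.congr'
    filter_upwards [hFu (δ / 2) (by linarith)] with k hk
    have hgk : ∀ x ∈ K, dist (g (Fk k x)) x ≤ s / 4 := by
      intro x hx
      have h1 := hδ' ((hk x hx).trans_lt (by linarith))
      have h2 := hgs x hx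
      linarith [dist_triangle (g (Fk k x)) (g (h x)) x]
    let χ : ContDiffBump x0 := ⟨1.75 * s, 2 * s, by positivity, by linarith⟩
    let H : Euc n → Euc n := fun x => x + χ x • (g (Fk k x) - x)
    have hgF : ContDiff ℝ ∞ (fun x => g (Fk k x)) := hg.comp (hFs k)
    have hH : ContDiff ℝ ∞ H := contDiff_id.add (χ.contDiff.smul (hgF.sub contDiff_id))
    have hHc : HasCompactSupport (fun x => H x - x) := by
      have : (fun x => H x - x) = fun x => χ x • (g (Fk k x) - x) := by
        ext1 x; simp [H]
      rw [this]
      exact χ.hasCompactSupport.smul_right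
    rw [← deg_smooth i0 hV hVc hH hHc]
    have hz : ∀ x y, 1.5 * s ≤ dist x x0 → dist y x ≤ s / 4 → pd i0 V y = 0 := by
      intro x y hx hy
      by_contra hne
      have := hVs y hne
      have := dist_triangle_left x x0 y
      linarith
    rw [← setIntegral_eq_integral_of_forall_compl_eq_zero (s := K)]
    · apply setIntegral_congr_fun hKc.measurableSet
      intro x hx
      simp only
      have hHx : dist (H x) x ≤ s / 4 := by
        have : dist (H x) x = χ x * ‖g (Fk k x) - x‖ := by
          rw [dist_eq_norm]
          simp only [H, add_sub_cancel_left, norm_smul, Real.norm_eq_abs, abs_of_nonneg χ.nonneg]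
        rw [this]
        have h2 := hgk x hx
        rw [dist_eq_norm] at h2
        calc χ x * ‖g (Fk k x) - x‖ ≤ 1 * ‖g (Fk k x) - x‖ := by gcongr; exact χ.le_one
          _ ≤ s / 4 := by linarith
      by_cases hd : dist x x0 < 1.6 * s
      · have hev : H =ᶠ[𝓝 x] fun x => g (Fk k x) := by
          have : ball x0 (1.75 * s) ∈ 𝓝 x := isOpen_ball.mem_nhds (by
            rw [mem_ball]; linarith)
          filter_upwards [this] with z hz
          have : χ z = 1 := χ.one_of_mem_closedBall (ball_subset_closedBall hz)
          simp [H, this]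
        rw [JM_congr hev, JM_comp hg (hFs k), Matrix.det_mul, hev.eq_of_nhds]
        ring
      · rw [hz x (H x) (by linarith) hHx, hz x _ (by linarith) (hgk x hx)]
        simp
    · intro x hx
      have hx' : 2 * s < dist x x0 := by simpa [hK] using hx
      have : χ x = 0 := χ.zero_of_le_dist hx'.le
      have hHx : H x = x := by simp [H, this]
      rw [hHx, hz x x (by linarith) (by simp; linarith), zero_mul]
  · have e1 : Continuous (fun p : Euc n × Euc n × Matrix (Fin n) (Fin n) ℝ => p.2.2.det) :=
      (continuous_snd.comp continuous_snd).matrix_det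
    have e3 := (pd_smooth i0 hV).continuous
    have e4 := hg.continuous
    exact ((e3.comp (e4.comp (continuous_fst.comp continuous_snd))).mul
      (hdc.comp (continuous_fst.comp continuous_snd))).mul e1
  · intro x y A
    simp only [abs_mul]
    rw [mul_assoc (B1 * B2)]
    gcongr
    · exact hB1' _
    · exact hB2' _
    · exact det_bound hn A

end QC

open MeasureTheory Metric Set
open scoped ENNReal NNReal

namespace QC

open scoped ContDiff Topology Convolution
open Filter

variable {n : ℕ}

lemma fderiv_zero_of_pd {g : Euc n → ℝ} {x : Euc n} (h : ∀ j, pd j g x = 0) : fderiv ℝ g x = 0 := by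
  apply ContinuousLinearMap.coe_injective
  apply (EuclideanSpace.basisFun (Fin n) ℝ).toBasis.ext
  intro j
  simpa [pd] using h j

lemma moll_meas_const (ν : Measure (Euc n)) [IsFiniteMeasure ν] (y0 : Euc n) {R : ℝ} (hR : 0 < R)
    (hν : ∀ φ : Euc n → ℝ, ContDiff ℝ ∞ φ → HasCompactSupport φ → tsupport φ ⊆ ball y0 R →
      ∀ j, ∫ z, pd j φ z ∂ν = 0) {ρ : Euc n → ℝ} (hρ : ContDiff ℝ ∞ ρ)
    (hρc : HasCompactSupport ρ) {ε : ℝ} (hε : ε < R / 2) (hρs : tsupport ρ ⊆ closedBall 0 ε)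
    {y : Euc n} (hy : y ∈ ball y0 (R / 2)) :
    ∫ z, ρ (z - y) ∂ν = ∫ z, ρ (z - y0) ∂ν := by
  obtain ⟨B, hB⟩ := (hρ.continuous_fderiv (by simp)).bounded_above_of_compact_support
    (hρc.fderiv ℝ)
  obtain ⟨B0, hB0, hB0'⟩ := bdd_of_compact hρ.continuous hρc
  have hder : ∀ y, HasFDerivAt (fun y => ∫ z, ρ (z - y) ∂ν) (∫ z, - fderiv ℝ ρ (z - y) ∂ν) y := by
    intro y
    apply hasFDerivAt_integral_of_dominated_of_fderiv_le (s := univ) (bound := fun _ => B)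
      (F := fun y z => ρ (z - y)) (F' := fun y z => - fderiv ℝ ρ (z - y))
    · exact univ_mem
    · exact Eventually.of_forall fun y =>
        (hρ.continuous.comp (continuous_id.sub continuous_const)).aestronglyMeasurable
    · exact (integrable_const B0).mono'
        (hρ.continuous.comp (continuous_id.sub continuous_const)).aestronglyMeasurable
        (Eventually.of_forall fun z => hB0' _)
    · exact (((hρ.continuous_fderiv (by simp)).comp
        (continuous_id.sub continuous_const)).neg).aestronglyMeasurable
    · exact Eventually.of_forall fun z y _ => by rw [norm_neg]; exact hB _
    · exact integrable_const _
    · refine Eventually.of_forall fun z y _ => ?_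
      have h1 : HasFDerivAt (fun y : Euc n => z - y) (-ContinuousLinearMap.id ℝ (Euc n)) y :=
        (hasFDerivAt_id y).const_sub z
      have h2 : HasFDerivAt ρ (fderiv ℝ ρ (z - y)) (z - y) :=
        (hρ.differentiable (by simp) _).hasFDerivAt
      have h3 := h2.comp y h1
      rw [ContinuousLinearMap.comp_neg, ContinuousLinearMap.comp_id] at h3
      exact h3
  have hinteg : ∀ y, Integrable (fun z => - fderiv ℝ ρ (z - y)) ν := fun y =>
    (integrable_const B).mono' (((hρ.continuous_fderiv (by simp)).comp
        (continuous_id.sub continuous_const)).neg).aestronglyMeasurable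
        (Eventually.of_forall fun z => by rw [norm_neg]; exact hB _)
  have hz : ∀ y ∈ ball y0 (R / 2), fderiv ℝ (fun y => ∫ z, ρ (z - y) ∂ν) y = 0 := by
    intro y hy
    apply fderiv_zero_of_pd
    intro j
    rw [pd, (hder y).fderiv, ContinuousLinearMap.integral_apply (hinteg y)]
    have hsm : ContDiff ℝ ∞ (fun z => ρ (z - y)) := hρ.comp (contDiff_id.sub contDiff_const)
    have hts : tsupport (fun z => ρ (z - y)) ⊆ closedBall y ε := by
      apply closure_minimal _ isClosed_closedBall
      intro z hz
      have : z - y ∈ closedBall (0 : Euc n) ε := hρs (subset_tsupport _ hz)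
      simpa [dist_eq_norm] using this
    have hcs : HasCompactSupport (fun z => ρ (z - y)) :=
      (isCompact_closedBall y ε).of_isClosed_subset (isClosed_tsupport _) hts
    have := hν _ hsm hcs (hts.trans (closedBall_subset_ball' (by
      rw [mem_ball] at hy; linarith))) j
    have e : ∀ z, pd j (fun z => ρ (z - y)) z = fderiv ℝ ρ (z - y) (EuclideanSpace.single j 1) := by
      intro z
      have h1 : HasFDerivAt (fun z : Euc n => z - y) (ContinuousLinearMap.id ℝ (Euc n)) z :=
        (hasFDerivAt_id z).sub_const y
      have h2 : HasFDerivAt ρ (fderiv ℝ ρ (z - y)) (z - y) :=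
        (hρ.differentiable (by simp) _).hasFDerivAt
      have h3 : HasFDerivAt (fun z : Euc n => ρ (z - y)) _ z := h2.comp z h1
      rw [pd, h3.fderiv, ContinuousLinearMap.comp_id]
    simp_rw [e] at this
    simp only [neg_apply, integral_neg, this, neg_zero]
  have := isOpen_ball.is_const_of_fderiv_eq_zero (𝕜 := ℝ)
    (convex_ball y0 (R / 2)).isPreconnected
    (fun y _ => (hder y).differentiableAt.differentiableWithinAt) hz hy
    (mem_ball_self (by linarith : 0 < R / 2))
  exact this

lemma moll_meas_approx (ν : Measure (Euc n)) [IsFiniteMeasure ν] (y0 : Euc n) {R : ℝ} (hR : 0 < R)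
    (hν : ∀ φ : Euc n → ℝ, ContDiff ℝ ∞ φ → HasCompactSupport φ → tsupport φ ⊆ ball y0 R →
      ∀ j, ∫ z, pd j φ z ∂ν = 0) {ψ : Euc n → ℝ} (hψ : Continuous ψ)
    (hψc : HasCompactSupport ψ) (hψs : Function.support ψ ⊆ ball y0 (R / 2))
    {δ : ℝ} (hδ : 0 < δ) :
    ∃ ε0 > 0, ∀ φ : ContDiffBump (0 : Euc n), φ.rOut < ε0 →
      |∫ z, ψ z ∂ν - (∫ z, φ.normed volume (z - y0) ∂ν) * ∫ y, ψ y| ≤ δ := by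
  have huc := hψ.uniformContinuous_of_tendsto_cocompact hψc.is_zero_at_infty
  rw [Metric.uniformContinuous_iff] at huc
  set M := ν.real univ + 1 with hM
  have hM0 : 0 < M := by positivity
  obtain ⟨ε0, hε0, hε0'⟩ := huc (δ / M) (by positivity)
  refine ⟨min ε0 (R / 2), by positivity, fun φ hφ => ?_⟩
  have hφ1 : φ.rOut < ε0 := hφ.trans_le (min_le_left _ _)
  have hφ2 : φ.rOut < R / 2 := hφ.trans_le (min_le_right _ _)
  set ρ : Euc n → ℝ := φ.normed volume with hρdef
  have hρ : ContDiff ℝ ∞ ρ := φ.contDiff_normed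
  have hρc : HasCompactSupport ρ := φ.hasCompactSupport_normed
  have hρs : tsupport ρ ⊆ closedBall 0 φ.rOut := (φ.tsupport_normed_eq (μ := volume)).subset
  obtain ⟨B0, hB0, hB0'⟩ := bdd_of_compact hρ.continuous hρc
  have hψi : Integrable ψ := hψ.integrable_of_hasCompactSupport hψc
  have h1 : (∫ z, ρ (z - y0) ∂ν) * ∫ y, ψ y = ∫ y, ∫ z, ψ y * ρ (z - y) ∂ν := by
    rw [← integral_const_mul]
    congr 1
    ext y
    rw [integral_const_mul]
    by_cases hy : ψ y = 0
    · simp [hy]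
    · rw [moll_meas_const ν y0 hR hν hρ hρc hφ2 hρs (hψs hy), mul_comm]
  have hprod : Integrable (Function.uncurry fun y z => ψ y * ρ (z - y)) (volume.prod ν) := by
    have := hψi.mul_prod (integrable_const (μ := ν) B0)
    refine this.mono ?_ ?_
    · apply Continuous.aestronglyMeasurable
      exact (hψ.comp continuous_fst).mul
        (hρ.continuous.comp (continuous_snd.sub continuous_fst))
    · refine Eventually.of_forall fun p => ?_
      simp only [Function.uncurry, norm_mul, Real.norm_eq_abs]
      exact mul_le_mul_of_nonneg_left ((hB0' _).trans (le_abs_self _)) (abs_nonneg _)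
  have h2 : ∫ y, ∫ z, ψ y * ρ (z - y) ∂ν = ∫ z, (∫ y, ψ y * ρ (z - y)) ∂ν :=
    integral_integral_swap hprod
  have hcv : ∀ z, dist (∫ y, ψ y * ρ (z - y)) (ψ z) ≤ δ / M := by
    intro z
    have := φ.dist_normed_convolution_le (μ := volume) (g := ψ) (x₀ := z) (ε := δ / M)
      hψ.aestronglyMeasurable (fun x hx => (hε0' ((mem_ball.1 hx).trans hφ1)).le)
    rw [conv_eq] at this
    simpa only [mul_comm] using this
  have hψν : Integrable ψ ν := hψ.integrable_of_hasCompactSupport hψc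
  have hpi : Integrable (fun z => ∫ y, ψ y * ρ (z - y)) ν := hprod.integral_prod_right
  rw [h1, h2, ← integral_sub hψν hpi, ← Real.norm_eq_abs]
  refine (norm_integral_le_of_norm_le_const (C := δ / M) ?_).trans ?_
  · refine Eventually.of_forall fun z => ?_
    rw [← dist_eq_norm, dist_comm]; exact hcv z
  · rw [div_mul_eq_mul_div, div_le_iff₀ hM0]
    gcongr
    linarith

lemma const_measure (ν : Measure (Euc n)) [IsFiniteMeasure ν] (y0 : Euc n) {R : ℝ} (hR : 0 < R)
    (hν : ∀ φ : Euc n → ℝ, ContDiff ℝ ∞ φ → HasCompactSupport φ → tsupport φ ⊆ ball y0 R →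
      ∀ j, ∫ z, pd j φ z ∂ν = 0) :
    ∃ c : ℝ≥0, ν.restrict (ball y0 (R / 4)) = c • volume.restrict (ball y0 (R / 4)) := by
  let θ : ContDiffBump y0 := ⟨R / 4, R / 3, by positivity, by linarith⟩
  have hθs : ∀ z, θ z ≠ 0 → z ∈ ball y0 (R / 2) := by
    intro z hz
    have : z ∈ Function.support θ := hz
    rw [θ.support_eq] at this
    exact ball_subset_ball (show R / 3 ≤ R / 2 by linarith) this
  have hI0 : 0 < ∫ y, θ y := θ.integral_pos
  have key : ∀ ψ : Euc n → ℝ, Continuous ψ → HasCompactSupport ψ →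
      Function.support ψ ⊆ ball y0 (R / 2) →
      (∫ z, ψ z ∂ν) * (∫ y, θ y) = (∫ z, θ z ∂ν) * ∫ y, ψ y := by
    intro ψ hψ hψc hψs
    apply eq_of_abs_sub_le_all
    intro δ hδ
    set I := ∫ y, ψ y
    set I0 := ∫ y, θ y
    have hp : 0 < |I| + |I0| := by positivity
    obtain ⟨e1, he1, h1⟩ := moll_meas_approx ν y0 hR hν hψ hψc hψs
      (δ := δ / (|I| + |I0|)) (by positivity)
    obtain ⟨e2, he2, h2⟩ := moll_meas_approx ν y0 hR hν θ.continuous θ.hasCompactSupport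
      (fun z hz => hθs z hz) (δ := δ / (|I| + |I0|)) (by positivity)
    let φ : ContDiffBump (0 : Euc n) := ⟨min e1 e2 / 3, min e1 e2 / 2, by positivity, by
      have : 0 < min e1 e2 := by positivity
      linarith⟩
    have hφ : φ.rOut < min e1 e2 := by
      have : 0 < min e1 e2 := by positivity
      show min e1 e2 / 2 < _
      linarith
    have h1 := h1 φ (hφ.trans_le (min_le_left _ _))
    have h2 := h2 φ (hφ.trans_le (min_le_right _ _))
    set c := ∫ z, φ.normed volume (z - y0) ∂ν
    set a := ∫ z, ψ z ∂ν
    set a0 := ∫ z, θ z ∂ν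
    calc |a * I0 - a0 * I| = |(a - c * I) * I0 - (a0 - c * I0) * I| := by congr 1; ring
      _ ≤ |(a - c * I) * I0| + |(a0 - c * I0) * I| := abs_sub _ _
      _ = |a - c * I| * |I0| + |a0 - c * I0| * |I| := by rw [abs_mul, abs_mul]
      _ ≤ δ / (|I| + |I0|) * |I0| + δ / (|I| + |I0|) * |I| := by gcongr
      _ = δ := by field_simp; ring
  have hc0 : 0 ≤ (∫ z, θ z ∂ν) / ∫ y, θ y :=
    div_nonneg (integral_nonneg fun z => θ.nonneg) hI0.le
  refine ⟨⟨_, hc0⟩, ?_⟩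
  set c : ℝ≥0 := ⟨_, hc0⟩ with hcdef
  have hcv : (c : ℝ) = (∫ z, θ z ∂ν) / ∫ y, θ y := rfl
  let w : Euc n → ℝ≥0 := fun z => Real.toNNReal (θ z)
  have hw : Continuous w := continuous_real_toNNReal.comp θ.continuous
  have hwm : Measurable w := hw.measurable
  have hfin : ∀ μ : Measure (Euc n), IsFiniteMeasureOnCompacts μ →
      IsFiniteMeasure (μ.withDensity fun z => (w z : ℝ≥0∞)) := by
    intro μ hμ
    apply isFiniteMeasure_withDensity
    have : Integrable θ μ := θ.continuous.integrable_of_hasCompactSupport θ.hasCompactSupport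
    have h2 := this.lintegral_lt_top
    exact h2.ne
  have i1 := hfin ν inferInstance
  have i2 := hfin (volume : Measure (Euc n)) inferInstance
  have heq : ν.withDensity (fun z => (w z : ℝ≥0∞)) =
      c • (volume : Measure (Euc n)).withDensity (fun z => (w z : ℝ≥0∞)) := by
    apply ext_of_forall_integral_eq_of_IsFiniteMeasure
    intro g
    rw [integral_withDensity_eq_integral_smul hwm, integral_smul_nnreal_measure,
      integral_withDensity_eq_integral_smul hwm]
    have := key (fun z => θ z * g z) (θ.continuous.mul g.continuous)
      (θ.hasCompactSupport.mul_right) (fun z hz => hθs z (left_ne_zero_of_mul hz))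
    have e : ∀ z, w z • g z = θ z * g z := fun z => by
      rw [NNReal.smul_def, smul_eq_mul, Real.coe_toNNReal _ θ.nonneg]
    simp_rw [e]
    rw [NNReal.smul_def, hcv, smul_eq_mul, div_mul_eq_mul_div, eq_div_iff hI0.ne']
    exact this
  ext S hS
  have h1 := congrArg (fun μ => μ (S ∩ ball y0 (R / 4))) heq
  have hSm : MeasurableSet (S ∩ ball y0 (R / 4)) := hS.inter measurableSet_ball
  have h3 : ∀ μ : Measure (Euc n), (μ.withDensity fun z => (w z : ℝ≥0∞)) (S ∩ ball y0 (R / 4)) =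
      μ (S ∩ ball y0 (R / 4)) := by
    intro μ
    rw [withDensity_apply _ hSm, ← setLIntegral_one]
    apply setLIntegral_congr_fun hSm
    intro z hz
    have : θ z = 1 := θ.one_of_mem_closedBall (ball_subset_closedBall hz.2)
    simp only [w]
    rw [this]; simp
  simp only [Measure.smul_apply, h3] at h1
  rw [Measure.restrict_apply hS, Measure.smul_apply, Measure.restrict_apply hS]
  exact h1

end QC

open MeasureTheory Metric Set
open scoped ENNReal NNReal

namespace QC

open scoped ContDiff Topology
open Filter

variable {n : ℕ}

/-- normalized setting -/
structure ST (𝕏 𝕐 : Set (Euc n)) (h f : Euc n → Euc n) (D : Euc n → Matrix (Fin n) (Fin n) ℝ)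
    (C : ℝ) : Prop where
  hn : 2 ≤ n
  hX : IsOpen 𝕏
  hY : IsOpen 𝕐
  hom : IsHomeoOn h f 𝕏 𝕐
  hm : Measurable h
  fm : Measurable f
  Dm : ∀ i j, Measurable fun x => D x i j
  ws : WS 𝕏 h D
  hJ : ∀ x, 0 ≤ (D x).det
  hadj : ∀ x i j, |(D x).adjugate i j| ^ n ≤ C * (D x).det ^ (n - 1)

lemma meas_det {D : Euc n → Matrix (Fin n) (Fin n) ℝ} (Dm : ∀ i j, Measurable fun x => D x i j) :
    Measurable fun x => (D x).det := by
  simp only [Matrix.det_apply']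
  exact Finset.measurable_fun_sum _ fun σ _ =>
    (Finset.measurable_fun_prod _ fun i _ => Dm _ _).const_mul _

lemma meas_adj {D : Euc n → Matrix (Fin n) (Fin n) ℝ} (Dm : ∀ i j, Measurable fun x => D x i j)
    (i j : Fin n) : Measurable fun x => (D x).adjugate i j := by
  simp only [Matrix.adjugate_apply]
  apply meas_det
  intro k l
  simp only [Matrix.updateRow_apply]
  split_ifs
  · exact measurable_const
  · exact Dm k l

lemma cutoff {K Ω : Set (Euc n)} (hK : IsCompact K) (hΩ : IsOpen Ω) (hKΩ : K ⊆ Ω) :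
    ∃ η : Euc n → ℝ, ContDiff ℝ ∞ η ∧ HasCompactSupport η ∧ tsupport η ⊆ Ω ∧
      ∀ x ∈ K, η =ᶠ[𝓝 x] fun _ => 1 := by
  obtain ⟨δ, hδ, hδΩ⟩ := hK.exists_cthickening_subset_open hΩ hKΩ
  obtain ⟨η, h1, h2, h3⟩ := exists_contMDiffMap_one_nhds_of_subset_interior
    (modelWithCornersSelf ℝ (Euc n)) (n := ⊤) hK.isClosed (t := cthickening δ K)
    (by
      refine (self_subset_thickening hδ K).trans ?_
      exact interior_maximal (thickening_subset_cthickening δ K) isOpen_thickening)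
  have hts : tsupport η ⊆ cthickening δ K := by
    apply closure_minimal _ isClosed_cthickening
    intro x hx
    by_contra hx'
    exact hx (h2 x hx')
  refine ⟨η, η.contMDiff.contDiff, hK.cthickening.of_isClosed_subset (isClosed_tsupport _) hts,
    hts.trans hδΩ, ?_⟩
  intro x hx
  exact eventually_nhdsSet_iff_forall.1 h1 x hx

section
variable {𝕏 𝕐 : Set (Euc n)} {h f : Euc n → Euc n} {D : Euc n → Matrix (Fin n) (Fin n) ℝ}
    {C : ℝ}

lemma ST.detm (G : ST 𝕏 𝕐 h f D C) : Measurable fun x => (D x).det := meas_det G.Dm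

lemma ST.adjm (G : ST 𝕏 𝕐 h f D C) (i j : Fin n) : Measurable fun x => (D x).adjugate i j :=
  meas_adj G.Dm i j

lemma ST.det_int (G : ST 𝕏 𝕐 h f D C) {K : Set (Euc n)} (hK : IsCompact K) (hKX : K ⊆ 𝕏) :
    IntegrableOn (fun x => (D x).det) K volume := by
  have hn : n ≠ 0 := by have := G.hn; omega
  have : IntegrableOn (fun x => (n.factorial : ℝ) * (1 + ∑ i, ∑ j, |D x i j| ^ n)) K volume := by
    apply Integrable.const_mul
    apply Integrable.add
    · exact continuousOn_const.integrableOn_compact hK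
    · exact integrable_finsetSum _ fun i _ => integrable_finsetSum _ fun j _ =>
        (G.ws.intp i j).integrableOn_compact_subset hKX hK
  exact this.mono' G.detm.aestronglyMeasurable (Eventually.of_forall fun x => det_bound hn (D x))

/-- the part of `𝕏` mapped to the ball -/
abbrev Om (𝕏 : Set (Euc n)) (h : Euc n → Euc n) (y0 : Euc n) (r : ℝ) : Set (Euc n) :=
  𝕏 ∩ h ⁻¹' (ball y0 r)

/-- the measure `J dx` -/
abbrev mJ (𝕏 : Set (Euc n)) (h : Euc n → Euc n) (D : Euc n → Matrix (Fin n) (Fin n) ℝ)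
    (y0 : Euc n) (r : ℝ) : Measure (Euc n) :=
  (volume.restrict (Om 𝕏 h y0 r)).withDensity fun x => ENNReal.ofReal (D x).det

lemma ST.Om_meas (G : ST 𝕏 𝕐 h f D C) (y0 : Euc n) (r : ℝ) : MeasurableSet (Om 𝕏 h y0 r) :=
  G.hX.measurableSet.inter (G.hm measurableSet_ball)

lemma ST.Om_open (G : ST 𝕏 𝕐 h f D C) (y0 : Euc n) (r : ℝ) : IsOpen (Om 𝕏 h y0 r) :=
  G.hom.continuousOn.isOpen_inter_preimage G.hX isOpen_ball

lemma ST.comp_img (G : ST 𝕏 𝕐 h f D C) {y0 : Euc n} {R : ℝ} (hR : closedBall y0 R ⊆ 𝕐) :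
    IsCompact (f '' closedBall y0 R) ∧ f '' closedBall y0 R ⊆ 𝕏 ∧
      ∀ x ∈ 𝕏, h x ∈ closedBall y0 R → x ∈ f '' closedBall y0 R := by
  refine ⟨(isCompact_closedBall _ _).image_of_continuousOn (G.hom.continuousOn_inv.mono hR), ?_, ?_⟩
  · rintro _ ⟨y, hy, rfl⟩; exact G.hom.mapsTo_inv (hR hy)
  · intro x hx hy; exact ⟨h x, hy, G.hom.left_inv x hx⟩

lemma ST.mJ_int (G : ST 𝕏 𝕐 h f D C) (y0 : Euc n) (R : ℝ) (φ : Euc n → ℝ) :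
    ∫ x, φ x ∂(mJ 𝕏 h D y0 R) = ∫ x in Om 𝕏 h y0 R, (D x).det * φ x := by
  rw [mJ, integral_withDensity_eq_integral_toReal_smul G.detm.ennreal_ofReal
    (Eventually.of_forall fun x => ENNReal.ofReal_lt_top)]
  simp only [ENNReal.toReal_ofReal (G.hJ _), smul_eq_mul]

lemma ST.mJ_fin (G : ST 𝕏 𝕐 h f D C) {y0 : Euc n} {R : ℝ} (hR : closedBall y0 R ⊆ 𝕐) :
    IsFiniteMeasure (mJ 𝕏 h D y0 R) := by
  obtain ⟨h1, h2, h3⟩ := G.comp_img hR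
  apply isFiniteMeasure_withDensity
  have := (G.det_int h1 h2).mono_set (s := Om 𝕏 h y0 R)
    (fun x hx => h3 x hx.1 (ball_subset_closedBall hx.2))
  exact this.lintegral_lt_top.ne

lemma ST.div_zero (G : ST 𝕏 𝕐 h f D C) {y0 : Euc n} {R : ℝ} (hR : closedBall y0 R ⊆ 𝕐)
    {φ : Euc n → ℝ} (hφ : ContDiff ℝ ∞ φ) (hφc : HasCompactSupport φ)
    (hφs : tsupport φ ⊆ ball y0 R) (j : Fin n) :
    ∫ x in Om 𝕏 h y0 R, (D x).det * pd j φ (h x) = 0 := by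
  have hn : n ≠ 0 := by have := G.hn; omega
  obtain ⟨h1, h2, h3⟩ := G.comp_img hR
  obtain ⟨η, hη, hηc, hηs, hη1⟩ := cutoff h1 G.hX h2
  have key := piola hn G.hX G.ws hη hηc hηs hφ hφc j
  have hsub : Om 𝕏 h y0 R ⊆ tsupport η := by
    intro x hx
    apply subset_tsupport
    have := (hη1 x (h3 x hx.1 (ball_subset_closedBall hx.2))).eq_of_nhds
    simp [this]
  have hout : ∀ y, y ∉ ball y0 R → φ y = 0 ∧ pd j φ y = 0 := by
    intro y hy
    have hy' : y ∉ tsupport φ := fun h => hy (hφs h)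
    refine ⟨image_eq_zero_of_notMem_tsupport hy', ?_⟩
    have : fderiv ℝ φ y = 0 := by
      by_contra h
      exact hy' (support_fderiv_subset ℝ h)
    simp [pd, this]
  rw [← setIntegral_eq_of_subset_of_forall_sdiff_eq_zero (isClosed_tsupport η).measurableSet hsub,
    ← key]
  · apply setIntegral_congr_fun (isClosed_tsupport η).measurableSet
    intro x hx
    unfold pio
    by_cases hy : h x ∈ ball y0 R
    · have e := hη1 x (h3 x (hηs hx) (ball_subset_closedBall hy))
      have e2 : ∀ i, pd i η x = 0 := by
        intro i; unfold pd; rw [e.fderiv_eq]; simp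
      have e3 : ((D x).updateRow j (fun i => pd i η x)).det = 0 :=
        Matrix.det_eq_zero_of_row_eq_zero j (fun k => by rw [Matrix.updateRow_self]; exact e2 k)
      simp only [e3, e.eq_of_nhds]
      ring
    · simp [hout _ hy]
  · intro x hx
    have : h x ∉ ball y0 R := fun hy => hx.2 ⟨hηs hx.1, hy⟩
    simp [hout _ this]

lemma ST.meas_eq (G : ST 𝕏 𝕐 h f D C) {x0 : Euc n} (hx0 : x0 ∈ 𝕏) :
    ∃ r > 0, closedBall (h x0) r ⊆ 𝕐 ∧ ∃ c : ℝ≥0,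
      (mJ 𝕏 h D (h x0) r).map h = c • volume.restrict (ball (h x0) r) := by
  obtain ⟨R, hR, hRY⟩ := nhds_basis_closedBall.mem_iff.1 (G.hY.mem_nhds (G.hom.mapsTo hx0))
  set y0 := h x0
  have hfin := G.mJ_fin hRY
  have : IsFiniteMeasure ((mJ 𝕏 h D y0 R).map h) := inferInstance
  obtain ⟨c, hc⟩ := const_measure ((mJ 𝕏 h D y0 R).map h) y0 hR (by
    intro φ hφ hφc hφs j
    rw [integral_map G.hm.aemeasurable (pd_smooth j hφ).continuous.aestronglyMeasurable,
      G.mJ_int]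
    exact G.div_zero hRY hφ hφc hφs j)
  refine ⟨R / 4, by positivity, (closedBall_subset_closedBall (by linarith)).trans hRY, c, ?_⟩
  have e : h ⁻¹' (ball y0 (R / 4)) ∩ Om 𝕏 h y0 R = Om 𝕏 h y0 (R / 4) := by
    ext x
    simp only [mem_inter_iff, mem_preimage]
    constructor
    · rintro ⟨a, b, _⟩; exact ⟨b, a⟩
    · rintro ⟨a, b⟩
      exact ⟨b, a, ball_subset_ball (by linarith) b⟩
  have e2 : (mJ 𝕏 h D y0 R).restrict (h ⁻¹' (ball y0 (R / 4))) = mJ 𝕏 h D y0 (R / 4) := by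
    rw [mJ, restrict_withDensity (G.hm measurableSet_ball),
      Measure.restrict_restrict (G.hm measurableSet_ball), e]
  rw [← hc, Measure.restrict_map G.hm measurableSet_ball, e2]

lemma ST.trans (G : ST 𝕏 𝕐 h f D C) {y0 : Euc n} {r : ℝ} {c : ℝ≥0}
    (hc : (mJ 𝕏 h D y0 r).map h = c • volume.restrict (ball y0 r))
    {g : Euc n → ℝ} (hg : Measurable g) :
    ∫ x in Om 𝕏 h y0 r, (D x).det * g (h x) = c * ∫ y in ball y0 r, g y := by
  rw [← G.mJ_int, ← integral_map G.hm.aemeasurable hg.aestronglyMeasurable, hc,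
    integral_smul_nnreal_measure]
  rfl

lemma ST.ltrans (G : ST 𝕏 𝕐 h f D C) {y0 : Euc n} {r : ℝ} {c : ℝ≥0}
    (hc : (mJ 𝕏 h D y0 r).map h = c • volume.restrict (ball y0 r))
    {g : Euc n → ℝ≥0∞} (hg : Measurable g) :
    ∫⁻ x in Om 𝕏 h y0 r, ENNReal.ofReal (D x).det * g (h x) = c * ∫⁻ y in ball y0 r, g y := by
  have h1 : ∫⁻ y, g y ∂((mJ 𝕏 h D y0 r).map h) = ∫⁻ y, g y ∂(c • volume.restrict (ball y0 r)) := by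
    rw [hc]
  rw [lintegral_map hg G.hm, mJ, lintegral_withDensity_eq_lintegral_mul _ G.detm.ennreal_ofReal
    (g := fun x => g (h x)) (hg.comp G.hm), lintegral_smul_measure] at h1
  exact h1

lemma ST.trans' (G : ST 𝕏 𝕐 h f D C) {y0 : Euc n} {r : ℝ} {c : ℝ≥0}
    (hc : (mJ 𝕏 h D y0 r).map h = c • volume.restrict (ball y0 r))
    {g : Euc n → ℝ} (hg : Measurable g) :
    ∫ x in Om 𝕏 h y0 r, (D x).det * g x = c * ∫ y in ball y0 r, g (f y) := by
  rw [← G.trans hc (g := fun y => g (f y)) (hg.comp G.fm)]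
  apply setIntegral_congr_fun (G.Om_meas _ _)
  intro x hx
  simp only [G.hom.left_inv x hx.1]

lemma ST.ltrans' (G : ST 𝕏 𝕐 h f D C) {y0 : Euc n} {r : ℝ} {c : ℝ≥0}
    (hc : (mJ 𝕏 h D y0 r).map h = c • volume.restrict (ball y0 r))
    {g : Euc n → ℝ≥0∞} (hg : Measurable g) :
    ∫⁻ x in Om 𝕏 h y0 r, ENNReal.ofReal (D x).det * g x = c * ∫⁻ y in ball y0 r, g (f y) := by
  rw [← G.ltrans hc (g := fun y => g (f y)) (hg.comp G.fm)]
  apply setLIntegral_congr_fun (G.Om_meas _ _)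
  intro x hx
  simp only [G.hom.left_inv x hx.1]

end

end QC

open MeasureTheory Metric Set
open scoped ENNReal NNReal

namespace QC

open scoped ContDiff Topology Convolution
open Filter

variable {n : ℕ}

lemma smooth_approx {K Ω : Set (Euc n)} {F : Euc n → Euc n} (hF : ContinuousOn F Ω)
    (hK : IsCompact K) (hΩ : IsOpen Ω) (hKΩ : K ⊆ Ω) {ε : ℝ} (hε : 0 < ε) :
    ∃ g : Euc n → Euc n, ContDiff ℝ ∞ g ∧ HasCompactSupport g ∧ ∀ x ∈ K, dist (g x) (F x) ≤ ε := by
  obtain ⟨δ, hδ, hδΩ⟩ := hK.exists_cthickening_subset_open hΩ hKΩ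
  set K' := cthickening δ K with hK'def
  have hK' : IsCompact K' := hK.cthickening
  have hKK' : K ⊆ K' := self_subset_cthickening K
  have huc := hK'.uniformContinuousOn_of_continuous (hF.mono hδΩ)
  rw [Metric.uniformContinuousOn_iff] at huc
  obtain ⟨r, hr, hr2⟩ := huc ε hε
  have hFi : Integrable (K'.indicator F) :=
    (integrable_indicator_iff hK'.measurableSet).2 ((hF.mono hδΩ).integrableOn_compact hK')
  have hm : 0 < min δ r := lt_min hδ hr
  let φ : ContDiffBump (0 : Euc n) := ⟨min δ r / 2, min δ r, by positivity, by linarith⟩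
  refine ⟨φ.normed volume ⋆[ContinuousLinearMap.lsmul ℝ ℝ, volume] (K'.indicator F),
    φ.hasCompactSupport_normed.contDiff_convolution_left _ φ.contDiff_normed
      hFi.locallyIntegrable,
    φ.hasCompactSupport_normed.convolution _
      (HasCompactSupport.of_support_subset_isCompact hK' support_indicator_subset), ?_⟩
  intro x hx
  have e : F x = K'.indicator F x := by rw [indicator_of_mem (hKK' hx)]
  rw [e]
  apply ContDiffBump.dist_normed_convolution_le hFi.1
  intro z hz
  have hz' : dist z x < min δ r := hz
  have hzK : z ∈ K' :=
    closedBall_subset_cthickening hx _ (mem_closedBall.2 (hz'.le.trans (min_le_left _ _)))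
  rw [indicator_of_mem hzK, indicator_of_mem (hKK' hx)]
  exact (hr2 z hzK x (hKK' hx) (hz'.trans_le (min_le_right _ _))).le

section
variable {𝕏 𝕐 : Set (Euc n)} {h f : Euc n → Euc n} {D : Euc n → Matrix (Fin n) (Fin n) ℝ}
    {C : ℝ}

lemma ST.degL (G : ST 𝕏 𝕐 h f D C) {y0 : Euc n} {r : ℝ} (hr : 0 < r) {c : ℝ≥0}
    (hc : (mJ 𝕏 h D y0 r).map h = c • volume.restrict (ball y0 r)) (i0 : Fin n)
    {V : Euc n → ℝ} (hV : ContDiff ℝ ∞ V) (hVc : HasCompactSupport (pd i0 V))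
    {x0 : Euc n} {s : ℝ} (hs : 0 < s) (hVs : ∀ x, pd i0 V x ≠ 0 → dist x x0 < s)
    (hsub : closedBall x0 (2 * s) ⊆ Om 𝕏 h y0 (r / 2)) {g : Euc n → Euc n} (hg : ContDiff ℝ ∞ g)
    (hgc : HasCompactSupport g)
    (hgs : ∀ y ∈ closedBall y0 (r / 2), dist (g y) (f y) ≤ s / 8) :
    c * ∫ y in closedBall y0 (r / 2), pd i0 V (g y) * (JM g y).det = ∫ x, pd i0 V x := by
  have hdc : Continuous (fun y => (JM g y).det) := (det_jac_smooth _ (comps_smooth hg)).continuous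
  set L := closedBall y0 (r / 2) with hL
  have hLB : L ⊆ ball y0 r := closedBall_subset_ball (by linarith)
  have hLm : MeasurableSet L := measurableSet_closedBall
  have e1 : ∫ y in L, pd i0 V (g y) * (JM g y).det =
      ∫ y in ball y0 r, L.indicator (fun y => pd i0 V (g y) * (JM g y).det) y := by
    rw [setIntegral_indicator hLm, inter_eq_self_of_subset_right hLB]
  have hcont : Continuous fun y => pd i0 V (g y) * (JM g y).det :=
    ((pd_smooth i0 hV).continuous.comp hg.continuous).mul hdc
  rw [e1, ← G.trans hc (hcont.measurable.indicator hLm)]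
  have hxL : ∀ x ∈ 𝕏, h x ∈ L → dist (g (h x)) x ≤ s / 8 := by
    intro x hx hxL
    have := hgs (h x) hxL
    rwa [G.hom.left_inv x hx] at this
  rw [← deg_ws i0 G.hX G.ws hV hVc hs hVs (fun x hx => (hsub hx).1) hg hgc
    (fun x hx => hxL x (hsub hx).1 (ball_subset_closedBall (hsub hx).2))]
  rw [setIntegral_eq_of_subset_of_forall_sdiff_eq_zero (s := closedBall x0 (2 * s))
    (G.Om_meas _ _)]
  · apply setIntegral_congr_fun measurableSet_closedBall
    intro x hx
    simp only
    have hb : h x ∈ ball y0 (r / 2) := (hsub hx).2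
    have hxl : h x ∈ L := ball_subset_closedBall hb
    rw [indicator_of_mem hxl]
    ring
  · intro x hx
    have hb : h x ∈ ball y0 (r / 2) := (hsub hx).2
    have hb' : h x ∈ ball y0 r := ball_subset_ball (half_le_self hr.le) hb
    exact ⟨(hsub hx).1, hb'⟩
  · intro x hx
    by_cases hxl : h x ∈ L
    · rw [indicator_of_mem hxl]
      have h1 := hxL x hx.1.1 hxl
      have h2 : 2 * s < dist x x0 := by simpa using hx.2
      have : pd i0 V (g (h x)) = 0 := by
        by_contra hne
        have := hVs _ hne
        have := dist_triangle_left x x0 (g (h x))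
        linarith
      rw [this]; simp
    · rw [indicator_of_notMem hxl, mul_zero]

lemma ST.c_pos (G : ST 𝕏 𝕐 h f D C) {x0 : Euc n} (hx0 : x0 ∈ 𝕏) {r : ℝ} (hr : 0 < r)
    (hrY : closedBall (h x0) r ⊆ 𝕐) {c : ℝ≥0}
    (hc : (mJ 𝕏 h D (h x0) r).map h = c • volume.restrict (ball (h x0) r)) : c ≠ 0 := by
  have hx2 : h x0 ∈ ball (h x0) (r / 2) := mem_ball_self (half_pos hr)
  have hx1 : x0 ∈ Om 𝕏 h (h x0) (r / 2) := ⟨hx0, hx2⟩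
  obtain ⟨s', hs', hsub⟩ := nhds_basis_closedBall.mem_iff.1 ((G.Om_open (h x0) (r / 2)).mem_nhds hx1)
  have hi : 0 < n := by have := G.hn; omega
  set i0 : Fin n := ⟨0, hi⟩
  obtain ⟨V, hV, hVc, hV0, hVx, hVs⟩ := exists_bump i0 x0 (s := s' / 2) (by linarith)
  obtain ⟨g, hg, hgc, hgs⟩ := smooth_approx (K := closedBall (h x0) (r / 2))
    G.hom.continuousOn_inv (isCompact_closedBall _ _) G.hY
    ((closedBall_subset_closedBall (by linarith)).trans hrY) (ε := s' / 2 / 8) (by linarith)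
  have := G.degL hr hc i0 hV hVc (s := s' / 2) (by linarith) hVs
    (by rw [mul_div_cancel₀ _ (two_ne_zero)]; exact hsub) hg hgc hgs
  rintro rfl
  have hp := (pd_smooth i0 hV).continuous.integral_pos_of_hasCompactSupport_nonneg_nonzero
    (μ := volume) hVc hV0 hVx.ne'
  rw [← this] at hp
  simp at hp

end

end QC

open MeasureTheory Metric Set
open scoped ENNReal NNReal

namespace QC

open scoped ContDiff Topology
open Filter

variable {n : ℕ}

section
variable {𝕏 𝕐 : Set (Euc n)} {h f : Euc n → Euc n} {D : Euc n → Matrix (Fin n) (Fin n) ℝ}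
    {C : ℝ}

/-- candidate derivative of the inverse -/
def invD (f : Euc n → Euc n) (D : Euc n → Matrix (Fin n) (Fin n) ℝ) (y : Euc n) :
    Matrix (Fin n) (Fin n) ℝ := (D (f y)).det⁻¹ • (D (f y)).adjugate

lemma invD_apply (f : Euc n → Euc n) (D : Euc n → Matrix (Fin n) (Fin n) ℝ) (y : Euc n)
    (i j : Fin n) : invD f D y i j = (D (f y)).det⁻¹ * (D (f y)).adjugate i j := rfl

lemma ST.adj_zero (G : ST 𝕏 𝕐 h f D C) {x : Euc n} (hx : (D x).det = 0) (i j : Fin n) :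
    (D x).adjugate i j = 0 := by
  have h1 := G.hadj x i j
  have hn := G.hn
  rw [hx, zero_pow (by omega), mul_zero] at h1
  have h2 : |(D x).adjugate i j| ^ n = 0 := le_antisymm h1 (by positivity)
  simpa using eq_zero_of_pow_eq_zero h2

lemma ST.mul_inv (G : ST 𝕏 𝕐 h f D C) (x : Euc n) (i j : Fin n) :
    (D x).det * ((D x).det⁻¹ * (D x).adjugate i j) = (D x).adjugate i j := by
  by_cases hx : (D x).det = 0
  · simp [hx, G.adj_zero hx]
  · field_simp

lemma ST.invm (G : ST 𝕏 𝕐 h f D C) (i j : Fin n) :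
    Measurable fun x => (D x).det⁻¹ * (D x).adjugate i j :=
  G.detm.inv.mul (G.adjm i j)

lemma ST.C_nonneg_or (G : ST 𝕏 𝕐 h f D C) (x : Euc n) (i j : Fin n) :
    (D x).det * |(D x).det⁻¹ * (D x).adjugate i j| ^ n ≤ max C 0 := by
  have hn := G.hn
  rcases (G.hJ x).eq_or_lt with hx | hx
  · rw [← hx]; simp
  · rw [abs_mul, mul_pow, abs_of_pos (inv_pos.2 hx)]
    have h1 := G.hadj x i j
    set J := (D x).det
    have e : J ^ n = J * J ^ (n - 1) := by
      rw [← pow_succ']; congr 1; omega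
    calc J * (J⁻¹ ^ n * |(D x).adjugate i j| ^ n) ≤ J * (J⁻¹ ^ n * (C * J ^ (n - 1))) := by gcongr
      _ = C := by rw [inv_pow, e]; field_simp
      _ ≤ max C 0 := le_max_left _ _

lemma ST.adj_int (G : ST 𝕏 𝕐 h f D C) {K : Set (Euc n)} (hK : IsCompact K) (hKX : K ⊆ 𝕏)
    (i j : Fin n) : IntegrableOn (fun x => (D x).adjugate i j) K volume := by
  have hn : n ≠ 0 := by have := G.hn; omega
  have : IntegrableOn (fun x => (1 * n.factorial : ℝ) * (1 + ∑ i, ∑ j, |D x i j| ^ n)) K volume := by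
    apply Integrable.const_mul
    apply Integrable.add
    · exact continuousOn_const.integrableOn_compact hK
    · exact integrable_finsetSum _ fun i _ => integrable_finsetSum _ fun j _ =>
        (G.ws.intp i j).integrableOn_compact_subset hKX hK
  refine this.mono' (G.adjm i j).aestronglyMeasurable (Eventually.of_forall fun x => ?_)
  rw [Matrix.adjugate_apply]
  refine det_upd_bound hn (D x) j _ one_pos ?_
  intro k
  by_cases hk : k = i
  · subst hk; simp
  · simp [hk]

lemma ST.inv_intp (G : ST 𝕏 𝕐 h f D C) {y0 : Euc n} {r : ℝ} (hrY : closedBall y0 r ⊆ 𝕐) {c : ℝ≥0}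
    (hc : (mJ 𝕏 h D y0 r).map h = c • volume.restrict (ball y0 r)) (hc0 : c ≠ 0) (i j : Fin n) :
    IntegrableOn (fun y => |invD f D y i j| ^ n) (ball y0 r) volume := by
  have hmeas : Measurable fun x => |(D x).det⁻¹ * (D x).adjugate i j| ^ n :=
    (_root_.measurable_norm.comp (G.invm i j)).pow_const n
  refine ⟨(hmeas.comp G.fm).aestronglyMeasurable, ?_⟩
  rw [hasFiniteIntegral_iff_ofReal (Eventually.of_forall fun y => by positivity)]
  have key := G.ltrans' hc (g := fun x => ENNReal.ofReal (|(D x).det⁻¹ * (D x).adjugate i j| ^ n))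
    hmeas.ennreal_ofReal
  have hlt : ∫⁻ x in Om 𝕏 h y0 r, ENNReal.ofReal (D x).det *
      ENNReal.ofReal (|(D x).det⁻¹ * (D x).adjugate i j| ^ n) < ⊤ := by
    have h1 : ∫⁻ x in Om 𝕏 h y0 r, ENNReal.ofReal (D x).det *
        ENNReal.ofReal (|(D x).det⁻¹ * (D x).adjugate i j| ^ n) ≤
        ∫⁻ x in Om 𝕏 h y0 r, ENNReal.ofReal (max C 0) := by
      apply lintegral_mono
      intro x
      simp only
      rw [← ENNReal.ofReal_mul (G.hJ x)]
      exact ENNReal.ofReal_le_ofReal (G.C_nonneg_or x i j)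
    refine h1.trans_lt ?_
    rw [setLIntegral_const]
    apply ENNReal.mul_lt_top ENNReal.ofReal_lt_top
    obtain ⟨h1, h2, h3⟩ := G.comp_img hrY
    exact (measure_mono (fun x hx => h3 x hx.1 (ball_subset_closedBall hx.2))).trans_lt
      h1.measure_lt_top
  rw [key] at hlt
  rcases ENNReal.mul_lt_top_iff.1 hlt with h1 | h1 | h1
  · exact h1.2
  · exact absurd h1 (by simpa using hc0)
  · simp only [invD_apply]; rw [h1]; exact ENNReal.zero_lt_top

lemma ST.inv_ws (G : ST 𝕏 𝕐 h f D C) {y0 : Euc n} {r : ℝ} (hrY : closedBall y0 r ⊆ 𝕐) {c : ℝ≥0}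
    (hc : (mJ 𝕏 h D y0 r).map h = c • volume.restrict (ball y0 r)) (hc0 : c ≠ 0) :
    WS (ball y0 r) f (invD f D) := by
  have hn : n ≠ 0 := by have := G.hn; omega
  refine ⟨G.hom.continuousOn_inv.mono (ball_subset_closedBall.trans hrY), ?_, ?_, ?_⟩
  · intro i j
    apply IntegrableOn.locallyIntegrableOn
    have h1 : IntegrableOn (fun y => 1 + |invD f D y i j| ^ n) (ball y0 r) volume :=
      Integrable.add (integrableOn_const (by simp [measure_ball_lt_top.ne]))
        (G.inv_intp hrY hc hc0 i j)
    refine h1.mono' ((G.invm i j).comp G.fm).aestronglyMeasurable (Eventually.of_forall fun y => ?_)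
    rw [Real.norm_eq_abs]
    rcases le_total (|invD f D y i j|) 1 with h | h
    · have : 0 ≤ |invD f D y i j| ^ n := by positivity
      linarith
    · have := le_self_pow₀ h hn
      linarith
  · intro i j
    exact (G.inv_intp hrY hc hc0 i j).locallyIntegrableOn
  · intro φ hφ hφc hφs i j
    have hc0' : (c : ℝ) ≠ 0 := by simpa using hc0
    apply mul_left_cancel₀ hc0'
    have e1 := G.trans hc (g := fun y => f y i * pd j φ y)
      (((pr i).continuous.measurable.comp G.fm).mul (pd_smooth j hφ).continuous.measurable)
    have e2 := G.trans hc (g := fun y => invD f D y i j * φ y)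
      (((G.invm i j).comp G.fm).mul hφ.continuous.measurable)
    rw [mul_neg, ← e1, ← e2, eq_neg_iff_add_eq_zero]
    obtain ⟨h1, h2, h3⟩ := G.comp_img hrY
    have hOK : Om 𝕏 h y0 r ⊆ f '' closedBall y0 r :=
      fun x hx => h3 x hx.1 (ball_subset_closedBall hx.2)
    have f1 : ∫ x in Om 𝕏 h y0 r, (D x).det * (f (h x) i * pd j φ (h x)) =
        ∫ x in Om 𝕏 h y0 r, x i * (pd j φ (h x) * (D x).det) := by
      apply setIntegral_congr_fun (G.Om_meas _ _)
      intro x hx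
      simp only
      rw [G.hom.left_inv x hx.1]; ring
    have f2 : ∫ x in Om 𝕏 h y0 r, (D x).det * (invD f D (h x) i j * φ (h x)) =
        ∫ x in Om 𝕏 h y0 r, φ (h x) * (D x).adjugate i j := by
      apply setIntegral_congr_fun (G.Om_meas _ _)
      intro x hx
      simp only
      rw [invD_apply, G.hom.left_inv x hx.1, ← mul_assoc, G.mul_inv, mul_comm]
    rw [f1, f2]
    obtain ⟨B1, hB1, hB1'⟩ := bdd_of_compact hφ.continuous hφc
    obtain ⟨B2, hB2, hB2'⟩ := bdd_of_compact (pd_smooth j hφ).continuous (pd_compact j hφc)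
    have g1 : IntegrableOn (fun x => x i * (pd j φ (h x) * (D x).det)) (Om 𝕏 h y0 r) volume := by
      obtain ⟨B3, hB3⟩ := h1.exists_bound_of_continuousOn (f := fun x : Euc n => x i)
        (pr i).continuous.continuousOn
      have := ((G.det_int h1 h2).mono_set hOK).bdd_mul (c := |B3| * B2)
        (f := fun x => x i * pd j φ (h x))
        ((((pr i).continuous.measurable).mul
          ((pd_smooth j hφ).continuous.measurable.comp G.hm)).aestronglyMeasurable) (by
          rw [ae_restrict_iff' (G.Om_meas _ _)]
          refine Eventually.of_forall fun x hx => ?_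
          rw [norm_mul]
          gcongr
          · exact (hB3 x (hOK hx)).trans (le_abs_self _)
          · exact hB2' _)
      simp only [mul_assoc] at this
      exact this
    have g2 : IntegrableOn (fun x => φ (h x) * (D x).adjugate i j) (Om 𝕏 h y0 r) volume :=
      ((G.adj_int h1 h2 i j).mono_set hOK).bdd_mul (c := B1)
        (hφ.continuous.measurable.comp G.hm).aestronglyMeasurable
        (Eventually.of_forall fun x => hB1' _)
    rw [← integral_add g1 g2]
    obtain ⟨χ, hχ, hχc, hχs, hχ1⟩ := cutoff h1 G.hX h2
    set η : Euc n → ℝ := fun x => x i * χ x with hηd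
    have hη : ContDiff ℝ ∞ η := (coord_smooth i).mul hχ
    have hηc : HasCompactSupport η := hχc.mul_left
    have hηχ : tsupport η ⊆ tsupport χ := closure_mono (fun x hx => right_ne_zero_of_mul hx)
    have hηs : tsupport η ⊆ 𝕏 := hηχ.trans hχs
    have key := piola hn G.hX G.ws hη hηc hηs hφ hφc j
    have hout : ∀ y, y ∉ ball y0 r → φ y = 0 ∧ pd j φ y = 0 := by
      intro y hy
      have hy' : y ∉ tsupport φ := fun h => hy (hφs h)
      refine ⟨image_eq_zero_of_notMem_tsupport hy', ?_⟩
      have : fderiv ℝ φ y = 0 := by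
        by_contra h
        exact hy' (support_fderiv_subset ℝ h)
      simp [pd, this]
    have k1 : ∫ x in tsupport η, pio η φ j x (h x) (D x) = ∫ x in 𝕏, pio η φ j x (h x) (D x) :=
      (setIntegral_eq_of_subset_of_forall_sdiff_eq_zero G.hX.measurableSet hηs
        (fun x hx => pio_zero hx.2)).symm
    have k2 : ∫ x in 𝕏, pio η φ j x (h x) (D x) =
        ∫ x in Om 𝕏 h y0 r, pio η φ j x (h x) (D x) := by
      apply setIntegral_eq_of_subset_of_forall_sdiff_eq_zero G.hX.measurableSet inter_subset_left
      intro x hx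
      have : h x ∉ ball y0 r := fun hy => hx.2 ⟨hx.1, hy⟩
      simp [pio, hout _ this]
    rw [← key, k1, k2]
    apply setIntegral_congr_fun (G.Om_meas _ _)
    intro x hx
    have e := hχ1 x (hOK hx)
    have e2 : ∀ k, pd k η x = Pi.single (M := fun _ => ℝ) i 1 k := by
      intro k
      rw [hηd, pd_mul k (coord_smooth i) hχ, pd_coord]
      have : pd k χ x = 0 := by unfold pd; rw [e.fderiv_eq]; simp
      rw [this, e.eq_of_nhds, Pi.single_apply]
      simp [eq_comm]
    have e3 : (fun k => pd k η x) = Pi.single i 1 := funext e2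
    simp only [pio, e3]
    rw [← Matrix.adjugate_apply]
    simp only [hηd, e.eq_of_nhds, mul_one]

end

end QC

open MeasureTheory Metric Set
open scoped ENNReal NNReal

namespace QC

open scoped ContDiff Topology
open Filter

variable {n : ℕ}

section
variable {𝕏 𝕐 : Set (Euc n)} {h f : Euc n → Euc n} {D : Euc n → Matrix (Fin n) (Fin n) ℝ}
    {C : ℝ}

lemma det_inv_smul (hn : n ≠ 0) (A : Matrix (Fin n) (Fin n) ℝ) :
    A.det * (A.det⁻¹ • A.adjugate).det = if A.det = 0 then 0 else 1 := by
  rw [Matrix.det_smul, Matrix.det_adjugate, Fintype.card_fin]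
  split_ifs with h0
  · rw [h0]; simp
  · have e : A.det ^ n = A.det * A.det ^ (n - 1) := by
      rw [← pow_succ']; congr 1; omega
    rw [inv_pow, e]; field_simp

lemma ST.loc (G : ST 𝕏 𝕐 h f D C) {x0 : Euc n} (hx0 : x0 ∈ 𝕏) :
    ∃ U ∈ 𝓝 x0, volume (U ∩ {x | (D x).det = 0}) = 0 := by
  have hn : n ≠ 0 := by have := G.hn; omega
  obtain ⟨r, hr, hrY, c, hc⟩ := G.meas_eq hx0
  have hc0 := G.c_pos hx0 hr hrY hc
  have hW := G.inv_ws hrY hc hc0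
  set y0 := h x0 with hy0
  have hx2 : h x0 ∈ ball y0 (r / 2) := mem_ball_self (half_pos hr)
  have hx1 : x0 ∈ Om 𝕏 h y0 (r / 2) := ⟨hx0, hx2⟩
  obtain ⟨s', hs', hsub⟩ := nhds_basis_closedBall.mem_iff.1 ((G.Om_open y0 (r / 2)).mem_nhds hx1)
  obtain ⟨s, hs, hss⟩ : ∃ s : ℝ, 0 < s ∧ 2 * s = s' := ⟨s' / 2, by linarith, by ring⟩
  rw [← hss] at hsub
  set i0 : Fin n := ⟨0, Nat.pos_of_ne_zero hn⟩
  obtain ⟨V, hV, hVc, hV0, hVx, hVs⟩ := exists_bump i0 x0 hs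
  set u := pd i0 V with hu
  have huc : Continuous u := (pd_smooth i0 hV).continuous
  set L := closedBall y0 (r / 2) with hL
  have hLB : L ⊆ ball y0 r := closedBall_subset_ball (by linarith)
  have hLm : MeasurableSet L := measurableSet_closedBall
  have hLc : IsCompact L := isCompact_closedBall _ _
  have huO : ∀ x, u x ≠ 0 → x ∈ Om 𝕏 h y0 (r / 2) := by
    intro x hx
    apply hsub
    have := hVs x hx
    rw [mem_closedBall]; linarith
  have hOO : Om 𝕏 h y0 (r / 2) ⊆ Om 𝕏 h y0 r := by
    intro x hx
    have hb : h x ∈ ball y0 (r / 2) := hx.2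
    have hb' : h x ∈ ball y0 r := ball_subset_ball (half_le_self hr.le) hb
    exact ⟨hx.1, hb'⟩
  obtain ⟨B, hB, hB'⟩ := bdd_of_compact huc hVc
  obtain ⟨Fk, h1, h2, h3, h4⟩ := approx isOpen_ball hW hLc hLB
  have h5 := h4 (fun x y A => u y * A.det) (B * n.factorial)
    ((huc.comp (by fun_prop)).mul (Continuous.matrix_det (by fun_prop))) (by
      intro x y A
      rw [abs_mul, mul_assoc]
      gcongr
      · exact hB' y
      · exact det_bound hn A)
  have h6 : Tendsto (fun k => (c : ℝ) * ∫ y in L, u (Fk k y) * (JM (Fk k) y).det) atTop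
      (𝓝 (∫ x, u x)) := by
    apply tendsto_const_nhds.congr'
    filter_upwards [h3 (s / 8) (by positivity)] with k hk
    exact (G.degL hr hc i0 hV hVc hs hVs hsub (h1 k) (h2 k) hk).symm
  have h7 : (c : ℝ) * ∫ y in L, u (f y) * (invD f D y).det = ∫ x, u x :=
    tendsto_nhds_unique (h5.const_mul (c : ℝ)) h6
  have hgm : Measurable (L.indicator fun y => u (f y) * (invD f D y).det) :=
    Measurable.indicator ((huc.measurable.comp G.fm).mul
      (meas_det (D := invD f D) fun i j => (G.invm i j).comp G.fm)) hLm
  have e1 : ∫ y in L, u (f y) * (invD f D y).det =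
      ∫ y in ball y0 r, L.indicator (fun y => u (f y) * (invD f D y).det) y := by
    rw [setIntegral_indicator hLm, inter_eq_self_of_subset_right hLB]
  rw [e1, ← G.trans hc hgm] at h7
  have e2 : ∫ x in Om 𝕏 h y0 r, (D x).det *
      (L.indicator (fun y => u (f y) * (invD f D y).det)) (h x) =
      ∫ x in Om 𝕏 h y0 r, u x * (if (D x).det = 0 then 0 else 1) := by
    apply setIntegral_congr_fun (G.Om_meas _ _)
    intro x hx
    simp only
    by_cases hxl : h x ∈ L
    · rw [indicator_of_mem hxl, G.hom.left_inv x hx.1, ← det_inv_smul hn, invD,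
        G.hom.left_inv x hx.1]
      ring
    · rw [indicator_of_notMem hxl]
      have : u x = 0 := by
        by_contra hne
        have hb : h x ∈ ball y0 (r / 2) := (huO x hne).2
        exact hxl (ball_subset_closedBall hb)
      rw [this]; simp
  have e3 : ∫ x, u x = ∫ x in Om 𝕏 h y0 r, u x := by
    symm
    apply setIntegral_eq_integral_of_forall_compl_eq_zero
    intro x hx
    by_contra hne
    exact hx (hOO (huO x hne))
  rw [e2, e3] at h7
  have hui : Integrable u (volume.restrict (Om 𝕏 h y0 r)) :=
    (huc.integrable_of_hasCompactSupport hVc).integrableOn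
  have hwm : Measurable fun x => (if (D x).det = 0 then (0 : ℝ) else 1) :=
    Measurable.ite (G.detm (measurableSet_singleton 0)) measurable_const measurable_const
  have huwi : Integrable (fun x => u x * (if (D x).det = 0 then (0 : ℝ) else 1))
      (volume.restrict (Om 𝕏 h y0 r)) := by
    refine hui.mono (huc.measurable.mul hwm).aestronglyMeasurable (Eventually.of_forall fun x => ?_)
    split_ifs <;> simp
  have h8 : ∫ x in Om 𝕏 h y0 r, (u x - u x * (if (D x).det = 0 then (0 : ℝ) else 1)) = 0 := by
    rw [integral_sub hui huwi, h7, sub_self]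
  have hnn : 0 ≤ fun x => u x - u x * (if (D x).det = 0 then (0 : ℝ) else 1) := by
    intro x
    have := hV0 x
    simp only [Pi.zero_apply]
    split_ifs <;> simp [this]
  replace h8 := (integral_eq_zero_iff_of_nonneg hnn (hui.sub huwi)).1 h8
  · refine ⟨Om 𝕏 h y0 r ∩ {x | 0 < u x}, ?_, ?_⟩
    · exact ((G.Om_open _ _).inter (isOpen_lt continuous_const huc)).mem_nhds ⟨hOO hx1, hVx⟩
    · rw [Filter.EventuallyEq, ae_restrict_iff' (G.Om_meas _ _)] at h8
      refine measure_mono_null ?_ h8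
      rintro x ⟨⟨hxO, hxu⟩, hxJ⟩ hcon
      have := hcon hxO
      rw [mem_setOf_eq] at hxJ hxu
      simp only [hxJ, if_true, mul_zero, sub_zero, Pi.zero_apply] at this
      exact hxu.ne' this

lemma ST.pos (G : ST 𝕏 𝕐 h f D C) : ∀ᵐ x ∂(volume.restrict 𝕏), 0 < (D x).det := by
  rw [ae_restrict_iff' G.hX.measurableSet]
  have : volume (𝕏 ∩ {x | (D x).det = 0}) = 0 := by
    apply measure_null_of_locally_null
    intro x hx
    obtain ⟨U, hU, hU0⟩ := G.loc hx.1
    refine ⟨U ∩ (𝕏 ∩ {x | (D x).det = 0}), ?_, ?_⟩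
    · exact inter_mem (mem_nhdsWithin_of_mem_nhds hU) self_mem_nhdsWithin
    · exact measure_mono_null (inter_subset_inter_right _ inter_subset_right) hU0
  refine measure_mono_null ?_ this
  intro x hx
  simp only [mem_compl_iff, mem_setOf_eq, Classical.not_imp, not_lt] at hx
  exact ⟨hx.1, le_antisymm hx.2 (G.hJ x)⟩

end

end QC

open MeasureTheory Metric Set
open scoped ENNReal NNReal

namespace QC

open scoped ContDiff Topology
open Filter

variable {n : ℕ}

lemma ent_le_op (M : Matrix (Fin n) (Fin n) ℝ) (i j : Fin n) : |M i j| ≤ opNorm M := by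
  have h1 := (LinearMap.toContinuousLinearMap (Matrix.toEuclideanLin M)).le_opNorm
    (EuclideanSpace.single j 1)
  have h2 : (LinearMap.toContinuousLinearMap (Matrix.toEuclideanLin M)
    (EuclideanSpace.single j 1)) i = M i j := by
    simp [Matrix.toLpLin_apply]
  have h3 := PiLp.norm_apply_le (LinearMap.toContinuousLinearMap (Matrix.toEuclideanLin M)
    (EuclideanSpace.single j 1)) i
  rw [h2] at h3
  simp only [EuclideanSpace.norm_single, norm_one, mul_one] at h1
  exact h3.trans h1

lemma op_nonneg (M : Matrix (Fin n) (Fin n) ℝ) : 0 ≤ opNorm M := norm_nonneg _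

lemma op_smul (t : ℝ) (M : Matrix (Fin n) (Fin n) ℝ) : opNorm (t • M) = |t| * opNorm M := by
  simp [opNorm, map_smul, norm_smul]

lemma op_le {M : Matrix (Fin n) (Fin n) ℝ} {a : ℝ} (ha : ∀ i j, |M i j| ≤ a) :
    opNorm M ≤ n * n * |a| := by
  apply ContinuousLinearMap.opNorm_le_bound _ (by positivity)
  intro v
  have hb : ∀ w : Euc n, ‖w‖ ≤ ∑ i, |w i| := by
    intro w
    rw [EuclideanSpace.norm_eq, Real.sqrt_le_iff]
    refine ⟨by positivity, ?_⟩
    exact Finset.sum_sq_le_sq_sum_of_nonneg (fun i _ => norm_nonneg _)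
  refine (hb _).trans ?_
  have : ∀ i, |(LinearMap.toContinuousLinearMap (Matrix.toEuclideanLin M) v) i| ≤
      n * (|a| * ‖v‖) := by
    intro i
    have e : (LinearMap.toContinuousLinearMap (Matrix.toEuclideanLin M) v) i =
      ∑ j, M i j * v j := by
      simp [Matrix.toLpLin_apply, Matrix.mulVec, dotProduct]
    rw [e]
    refine (Finset.abs_sum_le_sum_abs _ _).trans ?_
    refine (Finset.sum_le_sum (g := fun _ => |a| * ‖v‖) fun j _ => ?_).trans ?_
    · rw [abs_mul]
      exact mul_le_mul ((ha i j).trans (le_abs_self _)) (PiLp.norm_apply_le v j)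
        (abs_nonneg _) (abs_nonneg _)
    · simp
  refine (Finset.sum_le_sum fun i _ => this i).trans ?_
  simp only [Finset.sum_const, Finset.card_univ, Fintype.card_fin, nsmul_eq_mul]
  apply le_of_eq; ring

lemma adj_ent_bound (hn : 2 ≤ n) (A : Matrix (Fin n) (Fin n) ℝ) {a : ℝ} (h0 : 0 ≤ a)
    (ha : ∀ i j, |A i j| ≤ a) (i j : Fin n) :
    |A.adjugate i j| ≤ n.factorial * a ^ (n - 1) := by
  haveI : Nontrivial (Fin n) := Fin.nontrivial_iff_two_le.2 hn
  rcases h0.eq_or_lt with h | h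
  · have : A = 0 := by
      ext k l
      have := ha k l
      rw [← h] at this
      simpa using this
    rw [this, Matrix.adjugate_zero]
    simp; positivity
  · have e : A = a • (a⁻¹ • A) := by rw [smul_smul, mul_inv_cancel₀ h.ne', one_smul]
    have hb : ∀ k l, |(a⁻¹ • A) k l| ≤ 1 := by
      intro k l
      rw [Matrix.smul_apply, smul_eq_mul, abs_mul, abs_of_pos (inv_pos.2 h), inv_mul_le_iff₀ h]
      simpa using ha k l
    have h1 : |(a⁻¹ • A).adjugate i j| ≤ n.factorial := by
      rw [Matrix.adjugate_apply]
      have := det_bound_ent (a := 1) ((a⁻¹ • A).updateRow j (Pi.single i 1)) (by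
        intro k l
        rw [Matrix.updateRow_apply]
        split_ifs
        · by_cases hl : l = i
          · subst hl; simp
          · simp [hl]
        · exact hb k l)
      simpa using this
    rw [e, Matrix.adjugate_smul, Fintype.card_fin, Matrix.smul_apply, smul_eq_mul, abs_mul,
      abs_of_pos (pow_pos h _), mul_comm]
    gcongr

lemma op_adj (hn : 2 ≤ n) (A : Matrix (Fin n) (Fin n) ℝ) :
    opNorm A.adjugate ≤ (n * n * n.factorial : ℝ) * opNorm A ^ (n - 1) := by
  have h0 := op_nonneg A
  have := op_le (adj_ent_bound hn A h0 (ent_le_op A))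
  rw [abs_of_nonneg (by positivity)] at this
  linarith

lemma op_eq_zero {A : Matrix (Fin n) (Fin n) ℝ} (h : opNorm A ≤ 0) : A = 0 := by
  ext i j
  have := (ent_le_op A i j).trans h
  simpa using this

lemma fwd (hn : 2 ≤ n) (A : Matrix (Fin n) (Fin n) ℝ) {K : ℝ} (hK : 1 ≤ K)
    (h : opNorm A ^ n ≤ K * A.det) :
    opNorm A.adjugate ^ n ≤ (n * n * n.factorial : ℝ) ^ n * K ^ (n - 1) * A.det ^ (n - 1) := by
  have h0 := op_nonneg A
  have h1 := op_nonneg A.adjugate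
  calc opNorm A.adjugate ^ n ≤ ((n * n * n.factorial : ℝ) * opNorm A ^ (n - 1)) ^ n := by
        gcongr; exact op_adj hn A
    _ = (n * n * n.factorial : ℝ) ^ n * (opNorm A ^ n) ^ (n - 1) := by
        rw [mul_pow, ← pow_mul, ← pow_mul, mul_comm n (n - 1)]
    _ ≤ (n * n * n.factorial : ℝ) ^ n * (K * A.det) ^ (n - 1) := by gcongr
    _ = _ := by rw [mul_pow]; ring

lemma bwd (hn : 2 ≤ n) (A : Matrix (Fin n) (Fin n) ℝ) {C : ℝ} (hC : 0 ≤ C) (hA : 0 < A.det)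
    (h : opNorm A.adjugate ^ n ≤ C * A.det ^ (n - 1)) :
    opNorm A ^ n ≤ (n * n * n.factorial : ℝ) ^ n * C ^ (n - 1) * A.det := by
  have h0 := op_nonneg A
  have h1 := op_nonneg A.adjugate
  have h2 := op_adj hn A.adjugate
  rw [Matrix.adjugate_adjugate _ (by simp; omega), Fintype.card_fin, op_smul,
    abs_of_pos (pow_pos hA _)] at h2
  have h3 : (A.det ^ (n - 2) * opNorm A) ^ n ≤
      (n * n * n.factorial : ℝ) ^ n * (C * A.det ^ (n - 1)) ^ (n - 1) := by
    calc (A.det ^ (n - 2) * opNorm A) ^ n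
        ≤ ((n * n * n.factorial : ℝ) * opNorm A.adjugate ^ (n - 1)) ^ n := by gcongr
      _ = (n * n * n.factorial : ℝ) ^ n * (opNorm A.adjugate ^ n) ^ (n - 1) := by
        rw [mul_pow, ← pow_mul, ← pow_mul, mul_comm n (n - 1)]
      _ ≤ _ := by gcongr
  obtain ⟨m, rfl⟩ : ∃ m, n = m + 2 := ⟨n - 2, by omega⟩
  have e1 : m + 2 - 2 = m := by omega
  have e2 : m + 2 - 1 = m + 1 := by omega
  rw [e1, e2] at h3
  rw [e2]
  set M : ℝ := (((m + 2 : ℕ) : ℝ) * ((m + 2 : ℕ) : ℝ) * ((m + 2).factorial : ℝ)) ^ (m + 2)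
  have hp : 0 < A.det ^ (m * (m + 2)) := pow_pos hA _
  refine le_of_mul_le_mul_left ?_ hp
  calc A.det ^ (m * (m + 2)) * opNorm A ^ (m + 2) = (A.det ^ m * opNorm A) ^ (m + 2) := by
        rw [mul_pow, ← pow_mul]
    _ ≤ _ := h3
    _ = A.det ^ (m * (m + 2)) * (M * C ^ (m + 1) * A.det) := by
        rw [mul_pow, ← pow_mul]
        have : (m + 1) * (m + 1) = m * (m + 2) + 1 := by ring
        rw [this, pow_succ]; ring

lemma toST (hn : 2 ≤ n) {𝕏 𝕐 : Set (Euc n)} (hX : IsOpen 𝕏) (hY : IsOpen 𝕐)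
    {h f : Euc n → Euc n} (hhf : IsHomeoOn h f 𝕏 𝕐)
    {Dh : Euc n → Matrix (Fin n) (Fin n) ℝ}
    (hSob : MemSobolev (n : ℝ) 𝕏 h Dh)
    (hOrient : ∀ᵐ x ∂(volume.restrict 𝕏), 0 ≤ (Dh x).det) {C : ℝ}
    (hC : ∀ᵐ x ∂(volume.restrict 𝕏), opNorm (Dh x).adjugate ^ n ≤ C * (Dh x).det ^ (n - 1)) :
    ∀ᵐ x ∂(volume.restrict 𝕏), 0 < (Dh x).det := by
  classical
  haveI : Nontrivial (Fin n) := Fin.nontrivial_iff_two_le.2 hn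
  have hn0 : n ≠ 0 := by omega
  have hae : ∀ i j, AEStronglyMeasurable (fun x => Dh x i j) (volume.restrict 𝕏) :=
    fun i j => (hSob.locIntD i j).aestronglyMeasurable
  set D0 : Euc n → Matrix (Fin n) (Fin n) ℝ := fun x => Matrix.of fun i j => (hae i j).mk _ x
    with hD0
  have hD0m : ∀ i j, Measurable fun x => D0 x i j :=
    fun i j => (hae i j).stronglyMeasurable_mk.measurable
  have hD0e : ∀ᵐ x ∂(volume.restrict 𝕏), D0 x = Dh x := by
    have : ∀ᵐ x ∂(volume.restrict 𝕏), ∀ i j, Dh x i j = (hae i j).mk _ x := by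
      rw [ae_all_iff]; intro i; rw [ae_all_iff]; intro j
      exact (hae i j).ae_eq_mk
    filter_upwards [this] with x hx
    ext i j
    exact (hx i j).symm
  let P : Euc n → Prop := fun x => 0 ≤ (D0 x).det ∧ ∀ i j,
    |(D0 x).adjugate i j| ^ n ≤ C * (D0 x).det ^ (n - 1)
  have hPm : MeasurableSet {x | P x} := by
    have e : {x | P x} = {x | 0 ≤ (D0 x).det} ∩
        ⋂ i, ⋂ j, {x | |(D0 x).adjugate i j| ^ n ≤ C * (D0 x).det ^ (n - 1)} := by
      ext x; simp [P]
    rw [e]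
    apply MeasurableSet.inter
    · exact measurableSet_le measurable_const (meas_det hD0m)
    · refine MeasurableSet.iInter fun i => MeasurableSet.iInter fun j => ?_
      exact measurableSet_le ((_root_.measurable_norm.comp (meas_adj hD0m i j)).pow_const n)
        (((meas_det hD0m).pow_const _).const_mul _)
  set D1 : Euc n → Matrix (Fin n) (Fin n) ℝ := fun x => if P x then D0 x else 0 with hD1
  have hD1e : ∀ᵐ x ∂(volume.restrict 𝕏), D1 x = Dh x := by
    filter_upwards [hD0e, hOrient, hC] with x h1 h2 h3
    have hP : P x := by
      refine ⟨h1 ▸ h2, fun i j => ?_⟩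
      rw [h1]
      refine le_trans ?_ h3
      gcongr
      exact ent_le_op _ i j
    rw [hD1]; simp only [hP, if_true, h1]
  have hD1m : ∀ i j, Measurable fun x => D1 x i j := by
    intro i j
    have : (fun x => D1 x i j) = fun x => if P x then D0 x i j else 0 := by
      ext x; rw [hD1]; simp only; split_ifs <;> rfl
    rw [this]
    exact Measurable.ite hPm (hD0m i j) measurable_const
  have hpw : ∀ {S : Set (Euc n)} {g : Euc n → Euc n}, IsOpen S → ContinuousOn g S →
      Measurable (S.piecewise g 0) := fun hS hg =>
    hg.measurable_piecewise continuousOn_const hS.measurableSet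
  have hh' : EqOn (𝕏.piecewise h 0) h 𝕏 := fun x hx => piecewise_eq_of_mem _ _ _ hx
  have hf' : EqOn (𝕐.piecewise f 0) f 𝕐 := fun x hx => piecewise_eq_of_mem _ _ _ hx
  have hopi : LocallyIntegrableOn (fun x => opNorm (Dh x) ^ n) 𝕏 volume := by
    have := hSob.lp.locallyIntegrableOn
    simpa only [Real.rpow_natCast] using this
  have G : ST 𝕏 𝕐 (𝕏.piecewise h 0) (𝕐.piecewise f 0) D1 C := by
    refine ⟨hn, hX, hY, ?_, hpw hX hhf.continuousOn, hpw hY hhf.continuousOn_inv, hD1m, ?_, ?_, ?_⟩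
    · refine ⟨?_, ?_, ?_, ?_, ?_, ?_⟩
      · intro x hx; rw [hh' hx]; exact hhf.mapsTo hx
      · intro x hx; rw [hf' hx]; exact hhf.mapsTo_inv hx
      · intro x hx; rw [hh' hx, hf' (hhf.mapsTo hx)]; exact hhf.left_inv x hx
      · intro x hx; rw [hf' hx, hh' (hhf.mapsTo_inv hx)]; exact hhf.right_inv x hx
      · exact hhf.continuousOn.congr hh'
      · exact hhf.continuousOn_inv.congr hf'
    · refine ⟨hhf.continuousOn.congr hh', ?_, ?_, ?_⟩
      · intro i j
        rw [locallyIntegrableOn_iff hX.isLocallyClosed]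
        intro k hk hkc
        have := (locallyIntegrableOn_iff hX.isLocallyClosed).1 (hSob.locIntD i j) k hk hkc
        refine this.congr ?_
        filter_upwards [ae_restrict_of_ae_restrict_of_subset hk hD1e] with x hx
        rw [hx]
      · intro i j
        rw [locallyIntegrableOn_iff hX.isLocallyClosed]
        intro k hk hkc
        have := (locallyIntegrableOn_iff hX.isLocallyClosed).1 hopi k hk hkc
        refine Integrable.mono' this
          ((_root_.measurable_norm.comp (hD1m i j)).pow_const n).aestronglyMeasurable ?_
        filter_upwards [ae_restrict_of_ae_restrict_of_subset hk hD1e] with x hx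
        rw [hx, Real.norm_eq_abs, abs_of_nonneg (by positivity)]
        gcongr
        exact ent_le_op _ i j
      · intro φ hφ hφc hφs i j
        have := hSob.parts φ hφ hφc hφs i j
        have e1 : ∫ x in 𝕏, (𝕏.piecewise h 0 x) i * pd j φ x =
            ∫ x in 𝕏, h x i * fderiv ℝ φ x (EuclideanSpace.single j 1) := by
          apply setIntegral_congr_fun hX.measurableSet
          intro x hx
          simp only [hh' hx]
          rfl
        have e2 : ∫ x in 𝕏, D1 x i j * φ x = ∫ x in 𝕏, Dh x i j * φ x := by
          apply integral_congr_ae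
          filter_upwards [hD1e] with x hx
          rw [hx]
        rw [e1, e2, this]
    · intro x
      rw [hD1]; simp only
      split_ifs with hP
      · exact hP.1
      · rw [Matrix.det_zero]
    · intro x i j
      rw [hD1]; simp only
      split_ifs with hP
      · exact hP.2 i j
      · rw [Matrix.det_zero, Matrix.adjugate_zero, zero_pow (by omega : n - 1 ≠ 0)]
        simp [hn0]
  filter_upwards [G.pos, hD1e] with x h1 h2
  rwa [h2] at h1

end QC

/-- An orientation-preserving `W^{1,n}`-homeomorphism is quasiconformal iff
its inner distortion is essentially bounded on `𝕏`. -/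
theorem stmt_1 {n : ℕ} (hn : 2 ≤ n) (𝕏 𝕐 : Set (Euc n))
    (hX : IsOpen 𝕏) (hXc : IsConnected 𝕏) (hY : IsOpen 𝕐) (hYc : IsConnected 𝕐)
    (h f : Euc n → Euc n) (hhf : IsHomeoOn h f 𝕏 𝕐)
    (Dh : Euc n → Matrix (Fin n) (Fin n) ℝ)
    (hSob : MemSobolev (n : ℝ) 𝕏 h Dh)
    (hOrient : ∀ᵐ x ∂(volume.restrict 𝕏), 0 ≤ (Dh x).det) :
    (∃ K : ℝ, 1 ≤ K ∧
        ∀ᵐ x ∂(volume.restrict 𝕏), opNorm (Dh x) ^ n ≤ K * (Dh x).det) ↔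
      (∃ C : ℝ≥0∞, C < ⊤ ∧ ∀ᵐ x ∂(volume.restrict 𝕏), innerDistortion Dh x ≤ C) := by
  haveI : Nontrivial (Fin n) := Fin.nontrivial_iff_two_le.2 hn
  have hn0 : n ≠ 0 := by omega
  constructor
  · rintro ⟨K, hK, hKa⟩
    refine ⟨max 1 (ENNReal.ofReal ((n * n * n.factorial : ℝ) ^ n * K ^ (n - 1))),
      max_lt ENNReal.one_lt_top ENNReal.ofReal_lt_top, ?_⟩
    filter_upwards [hKa] with x hx
    unfold innerDistortion
    split_ifs with h1 h2
    · refine le_trans (ENNReal.ofReal_le_ofReal ?_) (le_max_right _ _)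
      rw [div_le_iff₀ (pow_pos h1 _)]
      exact QC.fwd hn _ hK hx
    · exact le_max_left _ _
    · exfalso
      apply h2
      have h3 : opNorm (Dh x) ^ n ≤ 0 :=
        hx.trans (mul_nonpos_of_nonneg_of_nonpos (by linarith) (not_lt.1 h1))
      have h4 : opNorm (Dh x) ^ n = 0 := le_antisymm h3 (pow_nonneg (QC.op_nonneg _) _)
      rw [QC.op_eq_zero (pow_eq_zero_iff hn0 |>.1 h4).le, Matrix.adjugate_zero]
  · rintro ⟨C, hC, hCa⟩
    have hCb : ∀ᵐ x ∂(volume.restrict 𝕏),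
        opNorm (Dh x).adjugate ^ n ≤ C.toReal * (Dh x).det ^ (n - 1) := by
      filter_upwards [hCa, hOrient] with x hx hx0
      unfold innerDistortion at hx
      split_ifs at hx with h1 h2
      · rw [ENNReal.ofReal_le_iff_le_toReal hC.ne, div_le_iff₀ (pow_pos h1 _)] at hx
        exact hx
      · rw [h2]
        have : opNorm (0 : Matrix (Fin n) (Fin n) ℝ) = 0 := by simp [opNorm]
        rw [this, zero_pow hn0]
        positivity
      · exact absurd (top_le_iff.1 hx) hC.ne
    have hpos := QC.toST hn hX hY hhf hSob hOrient hCb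
    refine ⟨max 1 ((n * n * n.factorial : ℝ) ^ n * C.toReal ^ (n - 1)), le_max_left _ _, ?_⟩
    filter_upwards [hpos, hCb] with x h1 h2
    refine (QC.bwd hn _ ENNReal.toReal_nonneg h1 h2).trans ?_
    gcongr
    exact le_max_right _ _
end
end

section
/- Let n ≥ 3. There exists a Lipschitz homeomorphism h : 𝔹 → 𝔹 ∖ I from the unit ball onto the slit ball whose inverse f = h⁻¹ belongs to W^{1,p}(𝔹 ∖ I, ℝⁿ) for every exponent 1 ≤ p < n − 1. In particular, for every p < n − 1 there is a homeomorphism h : 𝔹 → 𝔹 ∖ I of finite conformal energy whose inverse lies in W^{1,p}(𝔹 ∖ I, ℝⁿ). -/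
open MeasureTheory Metric Set
open scoped ENNReal NNReal

noncomputable section

open Filter Topology

/-- Jacobian matrix. -/
def jac {n : ℕ} (g : Euc n → Euc n) (x : Euc n) : Matrix (Fin n) (Fin n) ℝ :=
  Matrix.of fun i j => (fderiv ℝ g x (EuclideanSpace.single j 1)) i

lemma opNorm_jac {n : ℕ} (g : Euc n → Euc n) (x : Euc n) :
    opNorm (jac g x) = ‖fderiv ℝ g x‖ := by
  unfold opNorm
  congr 1
  apply ContinuousLinearMap.coe_injective
  refine (EuclideanSpace.basisFun (Fin n) ℝ).toBasis.ext fun j => ?_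
  ext i
  simp [jac, Matrix.toLpLin_apply]

lemma measurable_jac {n : ℕ} (g : Euc n → Euc n) (i j : Fin n) :
    Measurable fun x => jac g x i j := by
  have h := measurable_fderiv_apply_const ℝ g (EuclideanSpace.single j (1 : ℝ))
  exact (EuclideanSpace.proj (𝕜 := ℝ) i).continuous.measurable.comp h

lemma abs_jac_le {n : ℕ} (g : Euc n → Euc n) (x : Euc n) (i j : Fin n) :
    |jac g x i j| ≤ ‖fderiv ℝ g x‖ := by
  have h1 : |jac g x i j| ≤ ‖fderiv ℝ g x (EuclideanSpace.single j 1)‖ := by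
    have := PiLp.norm_apply_le (fderiv ℝ g x (EuclideanSpace.single j 1)) i
    simpa [jac] using this
  refine h1.trans ?_
  have := (fderiv ℝ g x).le_opNorm (EuclideanSpace.single j 1)
  simpa using this

lemma lipschitz_of_compactSupport {n : ℕ} (u : Euc n → ℝ) (hu : LocallyLipschitz u)
    (hc : HasCompactSupport u) : ∃ K, LipschitzWith K u := by
  obtain ⟨R, hR0, hR⟩ := hc.isCompact.isBounded.exists_pos_norm_lt
  obtain ⟨K, hK⟩ := (hu.locallyLipschitzOn (s := closedBall 0 (R + 1))).exists_lipschitzOnWith_of_compact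
    (isCompact_closedBall 0 (R + 1))
  obtain ⟨M, hM⟩ := hu.continuous.bounded_above_of_compact_support hc
  have hM0 : 0 ≤ M := (norm_nonneg _).trans (hM 0)
  have hz : ∀ x, R ≤ ‖x‖ → u x = 0 := by
    intro x hx
    by_contra h
    exact absurd (hR x (subset_tsupport _ h)) (not_lt.2 hx)
  have key : ∀ x y : Euc n, ‖x‖ ≤ R → R + 1 < ‖y‖ → dist (u x) (u y) ≤ (K + M) * dist x y := by
    intro x y hx hy
    rw [hz y (by linarith), dist_zero_right]
    have : 1 ≤ dist x y := by
      have := norm_sub_norm_le y x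
      rw [dist_comm, dist_eq_norm]; linarith
    have h2 := hM x
    have h3 : (0 : ℝ) ≤ K := K.2
    nlinarith
  refine ⟨K + ⟨M, hM0⟩, LipschitzWith.of_dist_le_mul fun x y => ?_⟩
  change dist (u x) (u y) ≤ (K + M) * dist x y
  have h3 : (0 : ℝ) ≤ K := K.2
  have hd := dist_nonneg (x := x) (y := y)
  by_cases hx : ‖x‖ ≤ R + 1
  · by_cases hy : ‖y‖ ≤ R + 1
    · have := hK.dist_le_mul x (by simpa using hx) y (by simpa using hy)
      nlinarith
    · by_cases hx' : ‖x‖ ≤ R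
      · exact key x y hx' (not_le.1 hy)
      · rw [hz x (not_le.1 hx').le, hz y (by linarith [not_le.1 hy]), dist_self]; positivity
  · by_cases hy' : ‖y‖ ≤ R
    · rw [dist_comm, dist_comm x]; exact key y x hy' (not_le.1 hx)
    · rw [hz y (not_le.1 hy').le, hz x (by linarith [not_le.1 hx]), dist_self]; positivity

lemma ae_diff {n : ℕ} {Ω : Set (Euc n)} (hΩ : IsOpen Ω) {g : Euc n → Euc n}
    (hg : ∀ x ∈ Ω, ∃ K : ℝ≥0, ∃ t ∈ 𝓝 x, LipschitzOnWith K g t) :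
    ∀ᵐ x, x ∈ Ω → DifferentiableAt ℝ g x := by
  rw [ae_iff]
  apply measure_null_of_locally_null
  intro x hx
  have hxΩ : x ∈ Ω := by
    by_contra h
    exact hx (fun h' => absurd h' h)
  obtain ⟨K, t, ht, hK⟩ := hg x hxΩ
  have h1 := (hK.mono interior_subset).ae_differentiableWithinAt_of_mem (μ := volume)
  rw [ae_iff] at h1
  refine ⟨_ , ?_, h1⟩
  filter_upwards [self_mem_nhdsWithin, mem_nhdsWithin_of_mem_nhds (interior_mem_nhds.2 ht)]
    with y hy hy'
  intro h
  exact hy fun _ => (h hy').differentiableAt (isOpen_interior.mem_nhds hy')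

lemma parts_of_locLip {n : ℕ} {Ω : Set (Euc n)} (hΩ : IsOpen Ω) {g : Euc n → Euc n}
    (hg : ∀ x ∈ Ω, ∃ K : ℝ≥0, ∃ t ∈ 𝓝 x, LipschitzOnWith K g t)
    (hgc : ContinuousOn g Ω)
    (hJ : ∀ i j : Fin n, LocallyIntegrableOn (fun x => jac g x i j) Ω volume)
    (φ : Euc n → ℝ) (hφ : ContDiff ℝ ((⊤ : ℕ∞) : WithTop ℕ∞) φ) (hc : HasCompactSupport φ)
    (hs : tsupport φ ⊆ Ω) (i j : Fin n) :
      ∫ x in Ω, g x i * fderiv ℝ φ x (EuclideanSpace.single j 1) =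
        - ∫ x in Ω, jac g x i j * φ x := by
  set v : Euc n := EuclideanSpace.single j 1 with hv
  have hφ1 : ContDiff ℝ 1 φ := hφ.of_le (by exact_mod_cast le_top)
  set u : Euc n → ℝ := fun x => g x i * φ x with hu
  have huc : HasCompactSupport u := hc.mul_left
  have hul : LocallyLipschitz u := by
    intro x
    by_cases hx : x ∈ tsupport φ
    · obtain ⟨K, t, ht, hK⟩ := hg x (hs hx)
      obtain ⟨L, s, hs', hL⟩ := hφ1.locallyLipschitz x
      have hgi : LipschitzOnWith K (fun x => g x i) t := by
        refine LipschitzOnWith.of_dist_le_mul fun a ha b hb => ?_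
        refine le_trans ?_ (hK.dist_le_mul a ha b hb)
        have := PiLp.norm_apply_le (g a - g b) i
        simpa [dist_eq_norm] using this
      have hA : ∀ᶠ y in 𝓝 x, |g y i| < |g x i| + 1 := by
        have h1 : ContinuousAt (fun x => |g x i|) x :=
          (hgi.continuousOn.continuousAt ht).abs
        exact h1.eventually (gt_mem_nhds (by linarith))
      have hB : ∀ᶠ y in 𝓝 x, |φ y| < |φ x| + 1 :=
        (hφ1.continuous.abs.continuousAt (x := x)).eventually (gt_mem_nhds (by linarith))
      refine ⟨⟨(|g x i| + 1) * L + (|φ x| + 1) * K, by positivity⟩, _,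
        inter_mem (inter_mem ht hs') (inter_mem hA hB), ?_⟩
      refine LipschitzOnWith.of_dist_le_mul ?_
      rintro a ⟨⟨hat, has⟩, haA, haB⟩ b ⟨⟨hbt, hbs⟩, hbA, hbB⟩
      change _ ≤ ((|g x i| + 1) * L + (|φ x| + 1) * K) * dist a b
      have e1 := hgi.dist_le_mul a hat b hbt
      have e2 := hL.dist_le_mul a has b hbs
      rw [Real.dist_eq] at e1 e2 ⊢
      have : u a - u b = g a i * (φ a - φ b) + φ b * (g a i - g b i) := by simp only [hu]; ring
      rw [this]
      refine (abs_add_le _ _).trans ?_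
      rw [abs_mul, abs_mul]
      have haA' : |g a i| < |g x i| + 1 := haA
      have hbB' : |φ b| < |φ x| + 1 := hbB
      have := mul_le_mul haA'.le e2 (abs_nonneg _) (by positivity)
      have := mul_le_mul hbB'.le e1 (abs_nonneg _) (by positivity)
      linarith
    · refine ⟨0, (tsupport φ)ᶜ, (isClosed_tsupport φ).isOpen_compl.mem_nhds hx, ?_⟩
      refine LipschitzOnWith.of_dist_le_mul fun a ha b hb => ?_
      simp [hu, image_eq_zero_of_notMem_tsupport ha, image_eq_zero_of_notMem_tsupport hb]
  obtain ⟨K, hK⟩ := lipschitz_of_compactSupport u hul huc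
  have h0 := LipschitzWith.integral_lineDeriv_mul_eq (μ := volume)
    (LipschitzWith.const (1 : ℝ) (α := Euc n)) hK huc (-v)
  simp only [neg_neg, mul_one] at h0
  have hz : ∫ x, lineDeriv ℝ u x v = 0 := by
    rw [← h0]; simp [lineDeriv]
  have hae : ∀ᵐ x, lineDeriv ℝ u x v = Ω.indicator (fun x => g x i * fderiv ℝ φ x v) x
      + Ω.indicator (fun x => jac g x i j * φ x) x := by
    filter_upwards [ae_diff hΩ hg] with x hx
    by_cases hxΩ : x ∈ Ω
    · have hd := (hx hxΩ).hasFDerivAt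
      have hdi : HasFDerivAt (fun x => g x i) ((EuclideanSpace.proj (𝕜 := ℝ) i).comp (fderiv ℝ g x)) x :=
        (EuclideanSpace.proj (𝕜 := ℝ) i).hasFDerivAt.comp x hd
      have hm := hdi.mul (hφ1.differentiable (by simp) x).hasFDerivAt
      have hl := (hm.hasLineDerivAt v).lineDeriv
      rw [indicator_of_mem hxΩ, indicator_of_mem hxΩ]
      change lineDeriv ℝ (fun x => g x i * φ x) x v = _
      erw [hl]
      simp [jac, mul_comm, hv]
    · have hxt : x ∉ tsupport u := fun h => hxΩ (hs (closure_mono (fun y hy => by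
        intro h0; apply hy; simp [hu, h0]) h))
      have : u =ᶠ[𝓝 x] fun _ => (0 : ℝ) := notMem_tsupport_iff_eventuallyEq.1 hxt
      rw [indicator_of_notMem hxΩ, indicator_of_notMem hxΩ]
      have hl : HasLineDerivAt ℝ u 0 x v := by
        have h2 : HasFDerivAt u (0 : Euc n →L[ℝ] ℝ) x :=
          (hasFDerivAt_const (0 : ℝ) x).congr_of_eventuallyEq this
        simpa using h2.hasLineDerivAt v
      simp [hl.lineDeriv]
  have hm := hΩ.measurableSet
  have hφK := hc.isCompact
  have i1 : Integrable (fun x => g x i * fderiv ℝ φ x v) (volume.restrict Ω) := by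
    have hcont : ContinuousOn (fun x => g x i * fderiv ℝ φ x v) (tsupport φ) := by
      refine ContinuousOn.mul ?_ ?_
      · exact (EuclideanSpace.proj (𝕜 := ℝ) i).continuous.comp_continuousOn (hgc.mono hs)
      · exact ((hφ1.continuous_fderiv (by simp)).clm_apply continuous_const).continuousOn
    have := hcont.integrableOn_compact (μ := volume) hφK
    refine this.of_forall_sdiff_eq_zero hm fun x hx => ?_
    have : fderiv ℝ φ x = 0 := by
      by_contra h
      exact hx.2 (support_fderiv_subset ℝ h)
    simp [this]
  have i2 : Integrable (fun x => jac g x i j * φ x) (volume.restrict Ω) := by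
    have h1 : IntegrableOn (fun x => jac g x i j) (tsupport φ) :=
      (hJ i j).integrableOn_compact_subset hs hφK
    have h2 := h1.mul_continuousOn (hφ1.continuous.continuousOn (s := tsupport φ)) hφK
    refine h2.of_forall_sdiff_eq_zero hm fun x hx => ?_
    simp [image_eq_zero_of_notMem_tsupport hx.2]
  rw [integral_congr_ae hae, integral_add, integral_indicator hm, integral_indicator hm] at hz
  · linarith
  · exact (integrable_indicator_iff hm).2 i1
  · exact (integrable_indicator_iff hm).2 i2

lemma memSobolev_of_locLip {n : ℕ} {p : ℝ} {Ω : Set (Euc n)} (hΩ : IsOpen Ω)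
    {g : Euc n → Euc n}
    (hg : ∀ x ∈ Ω, ∃ K : ℝ≥0, ∃ t ∈ 𝓝 x, LipschitzOnWith K g t)
    (w : Euc n → ℝ) (hw : IntegrableOn w Ω)
    (hb : ∀ᵐ x ∂(volume.restrict Ω), ‖fderiv ℝ g x‖ ^ p ≤ w x) :
    MemSobolev p Ω g (jac g) := by
  have hgc : ContinuousOn g Ω := fun x hx => by
    obtain ⟨K, t, ht, hK⟩ := hg x hx
    exact (hK.continuousOn.continuousAt ht).continuousWithinAt
  have hJ : ∀ i j : Fin n, LocallyIntegrableOn (fun x => jac g x i j) Ω volume := by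
    intro i j x hx
    obtain ⟨K, t, ht, hK⟩ := hg x hx
    refine ⟨interior t ∩ ball x 1, mem_nhdsWithin_of_mem_nhds
      (inter_mem (interior_mem_nhds.2 ht) (ball_mem_nhds x one_pos)), ?_⟩
    refine Measure.integrableOn_of_bounded (M := K) ?_
      (measurable_jac g i j).aestronglyMeasurable ?_
    · exact ((measure_mono inter_subset_right).trans_lt measure_ball_lt_top).ne
    · refine (ae_restrict_iff' (isOpen_interior.inter isOpen_ball).measurableSet).2
        (ae_of_all _ fun y hy => ?_)
      exact (abs_jac_le g y i j).trans
        (norm_fderiv_le_of_lipschitzOn ℝ (mem_interior_iff_mem_nhds.1 hy.1) hK)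
  refine ⟨fun i => ?_, hJ, parts_of_locLip hΩ hg hgc hJ, ?_⟩
  · exact ((EuclideanSpace.proj (𝕜 := ℝ) i).continuous.comp_continuousOn hgc).locallyIntegrableOn
      hΩ.measurableSet
  · simp only [opNorm_jac]
    refine Integrable.mono' hw ?_ ?_
    · exact ((measurable_fderiv ℝ g).norm.pow_const p).aestronglyMeasurable
    · filter_upwards [hb] with x hx
      rwa [Real.norm_of_nonneg (by positivity)]

section geometry

variable {E : Type*} [NormedAddCommGroup E] [InnerProductSpace ℝ E]

lemma lip_ratio (a b : E → ℝ) {A B : ℝ≥0} (ha : LipschitzWith A a) (hb : LipschitzWith B b)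
    (ha0 : a 0 = 0) {c : ℝ} (hc : 0 < c) (hbc : ∀ x, c * ‖x‖ ≤ b x) :
    ∃ K, LipschitzWith K (fun x => (a x / b x) • x) := by
  have haN : ∀ x, |a x| ≤ A * ‖x‖ := fun x => by
    have := ha.dist_le_mul x 0
    simpa [ha0, Real.dist_eq] using this
  have hbp : ∀ x, x ≠ 0 → 0 < b x := fun x hx =>
    (mul_pos hc (norm_pos_iff.2 hx)).trans_le (hbc x)
  have hr : ∀ x, x ≠ 0 → ‖x‖ / b x ≤ 1 / c := fun x hx => by
    rw [div_le_div_iff₀ (hbp x hx) hc]; linarith [hbc x]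
  have har : ∀ x, |a x / b x| ≤ A / c := fun x => by
    rcases eq_or_ne x 0 with rfl | hx
    · simp [ha0]; positivity
    · rw [abs_div, abs_of_pos (hbp x hx)]
      calc |a x| / b x ≤ (A * ‖x‖) / b x := by
            have := hbp x hx; gcongr; exact haN x
        _ = A * (‖x‖ / b x) := by ring
        _ ≤ A * (1 / c) := mul_le_mul_of_nonneg_left (hr x hx) A.2
        _ = A / c := by ring
  refine ⟨⟨A / c + A / c * (B / c) + A / c, by positivity⟩, LipschitzWith.of_dist_le_mul ?_⟩
  intro x y
  change _ ≤ (A / c + A / c * (B / c) + A / c) * dist x y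
  have hT : ∀ z : E, ‖(a z / b z) • z‖ ≤ A / c * ‖z‖ := fun z => by
    rw [norm_smul]; gcongr; exact har z
  have hpos : 0 ≤ A / c + A / c * (B / c) := by positivity
  have hpos' : 0 ≤ A / c := by positivity
  rcases eq_or_ne x 0 with rfl | hx
  · simp only [smul_zero, dist_zero_left]
    have := hT y
    nlinarith [norm_nonneg y]
  rcases eq_or_ne y 0 with rfl | hy
  · simp only [smul_zero, dist_zero_right]
    have := hT x
    nlinarith [norm_nonneg x]
  have hbx := hbp x hx
  have hby := hbp y hy
  have e : (a x / b x) • x - (a y / b y) • y =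
      ((a x - a y) / b x) • x + (a y / b y * ((b y - b x) / b x)) • x + (a y / b y) • (x - y) := by
    rw [smul_sub, ← add_smul]
    rw [add_sub, ← add_smul]
    congr 2
    field_simp
    ring
  rw [dist_eq_norm, e]
  have d1 := ha.dist_le_mul x y
  have d2 := hb.dist_le_mul y x
  rw [dist_comm y x] at d2
  rw [Real.dist_eq] at d1 d2
  have t1 : ‖((a x - a y) / b x) • x‖ ≤ A / c * dist x y := by
    rw [norm_smul, Real.norm_eq_abs, abs_div, abs_of_pos hbx]
    calc |a x - a y| / b x * ‖x‖ = |a x - a y| * (‖x‖ / b x) := by ring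
      _ ≤ (A * dist x y) * (1 / c) := mul_le_mul d1 (hr x hx) (by positivity) (by positivity)
      _ = _ := by ring
  have t2 : ‖(a y / b y * ((b y - b x) / b x)) • x‖ ≤ A / c * (B / c) * dist x y := by
    rw [norm_smul, Real.norm_eq_abs, abs_mul, abs_div (b y - b x), abs_of_pos hbx]
    calc |a y / b y| * (|b y - b x| / b x) * ‖x‖
        = |a y / b y| * (|b y - b x| * (‖x‖ / b x)) := by ring
      _ ≤ (A / c) * ((B * dist x y) * (1 / c)) :=
          mul_le_mul (har y) (mul_le_mul d2 (hr x hx) (by positivity) (by positivity))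
            (by positivity) (by positivity)
      _ = _ := by ring
  have t3 : ‖(a y / b y) • (x - y)‖ ≤ A / c * dist x y := by
    rw [norm_smul, dist_eq_norm]; gcongr; exact har y
  refine (norm_add₃_le).trans ?_
  linarith

/-- The folding map. -/
def h1 (e z : E) : E := ‖z‖ • e - ((2 * inner ℝ e z) / ‖z‖) • z

/-- The vector `‖y‖ e - y`, vanishing exactly on the ray of `e`. -/
def vv (e y : E) : E := ‖y‖ • e - y

/-- The inverse of the folding map. -/
def f1 (e y : E) : E := (‖y‖ / ‖vv e y‖) • vv e y

lemma h1_lip (e : E) : ∃ K, LipschitzWith K (h1 e) := by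
  obtain ⟨K, hK⟩ := lip_ratio (fun z : E => 2 * inner ℝ e z) (fun z => ‖z‖)
    (((2 : ℝ) • innerSL ℝ e).lipschitz) lipschitzWith_one_norm (by simp) one_pos (by simp)
  have h2 : LipschitzWith (1 * ‖e‖₊) (fun z : E => ‖z‖ • e) := by
    have := ((ContinuousLinearMap.toSpanSingleton ℝ e).lipschitz).comp (lipschitzWith_one_norm (E := E))
    refine LipschitzWith.of_dist_le_mul fun x y => ?_
    rw [dist_eq_norm, ← sub_smul, norm_smul, mul_comm]
    simp only [NNReal.coe_mul, NNReal.coe_one, one_mul, coe_nnnorm]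
    gcongr
    rw [dist_eq_norm]; exact abs_norm_sub_norm_le x y
  exact ⟨_, h2.sub hK⟩

variable {e : E}

lemma vv_norm_sq (he : ‖e‖ = 1) (y : E) : ‖vv e y‖ ^ 2 = 2 * ‖y‖ * (‖y‖ - inner ℝ e y) := by
  rw [vv, norm_sub_sq_real, norm_smul, inner_smul_left]
  simp [he]; ring

lemma vv_h1 (he : ‖e‖ = 1) {z : E} : ‖h1 e z‖ = ‖z‖ ∧ vv e (h1 e z) = ((2 * inner ℝ e z) / ‖z‖) • z := by
  have h : ‖h1 e z‖ = ‖z‖ := by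
    rcases eq_or_ne z 0 with rfl | hz
    · simp [h1]
    have hz' : ‖z‖ ≠ 0 := norm_ne_zero_iff.2 hz
    rw [← sq_eq_sq₀ (norm_nonneg _) (norm_nonneg _), h1, norm_sub_sq_real, norm_smul, norm_smul,
      inner_smul_left, inner_smul_right, he, mul_pow, mul_pow]
    simp only [Real.norm_eq_abs, sq_abs, abs_norm, conj_trivial]
    field_simp
    ring
  refine ⟨h, ?_⟩
  rw [vv, h, h1]; abel

lemma f1_h1 (he : ‖e‖ = 1) {z : E} (hz : 0 < inner ℝ e z) : f1 e (h1 e z) = z := by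
  have hz0 : z ≠ 0 := by rintro rfl; simp at hz
  have hz' : 0 < ‖z‖ := norm_pos_iff.2 hz0
  obtain ⟨a, b⟩ := vv_h1 he (z := z)
  have hn : ‖vv e (h1 e z)‖ = 2 * inner ℝ e z := by
    rw [b, norm_smul, Real.norm_of_nonneg (by positivity)]; field_simp
  rw [f1, hn, a, b, smul_smul]
  convert one_smul ℝ z
  field_simp

lemma inner_lt (he : ‖e‖ = 1) {y : E} (hy : vv e y ≠ 0) : inner ℝ e y < ‖y‖ ∧ 0 < ‖y‖ := by
  have h1 : 0 < ‖vv e y‖ ^ 2 := pow_pos (norm_pos_iff.2 hy) 2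
  rw [vv_norm_sq he] at h1
  have h0 : 0 < ‖y‖ := by
    rcases (norm_nonneg y).eq_or_lt with h | h
    · rw [← h] at h1; simp at h1
    · exact h
  refine ⟨?_, h0⟩
  by_contra h
  nlinarith

lemma norm_f1 {y : E} (hy : vv e y ≠ 0) : ‖f1 e y‖ = ‖y‖ := by
  have := norm_pos_iff.2 hy
  rw [f1, norm_smul, Real.norm_of_nonneg (by positivity)]; field_simp

lemma inner_f1 (he : ‖e‖ = 1) {y : E} : inner ℝ e (f1 e y) = ‖y‖ / ‖vv e y‖ * (‖y‖ - inner ℝ e y) := by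
  rw [f1, inner_smul_right, vv, inner_sub_right, inner_smul_right]
  simp [he]

lemma inner_f1_pos (he : ‖e‖ = 1) {y : E} (hy : vv e y ≠ 0) : 0 < inner ℝ e (f1 e y) := by
  have := norm_pos_iff.2 hy
  obtain ⟨a, b⟩ := inner_lt he hy
  rw [inner_f1 he]
  have : 0 < ‖y‖ - inner ℝ e y := by linarith
  positivity

lemma h1_f1 (he : ‖e‖ = 1) {y : E} (hy : vv e y ≠ 0) : h1 e (f1 e y) = y := by
  have hp := norm_pos_iff.2 hy
  obtain ⟨a, b⟩ := inner_lt he hy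
  have hs := vv_norm_sq he y
  rw [h1, norm_f1 hy, inner_f1 he]
  rw [show f1 e y = (‖y‖ / ‖vv e y‖) • vv e y from rfl, smul_smul]
  have : 2 * (‖y‖ / ‖vv e y‖ * (‖y‖ - inner ℝ e y)) / ‖y‖ * (‖y‖ / ‖vv e y‖) = 1 := by
    field_simp
    linarith
  rw [this, one_smul, vv]; abel

lemma vv_lip (he : ‖e‖ = 1) (x y : E) : ‖vv e x - vv e y‖ ≤ 2 * ‖x - y‖ := by
  have : vv e x - vv e y = (‖x‖ - ‖y‖) • e - (x - y) := by simp only [vv, sub_smul]; abel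
  rw [this]
  refine (norm_sub_le _ _).trans ?_
  rw [norm_smul, he, Real.norm_eq_abs]
  have := abs_norm_sub_norm_le x y
  linarith

lemma f1_dist (he : ‖e‖ = 1) {x y : E} (hx : vv e x ≠ 0) (hy : vv e y ≠ 0) (hyb : ‖y‖ ≤ 1) (hxb : ‖x‖ ≤ 1) :
    ‖f1 e x - f1 e y‖ ≤ 6 / ‖vv e x‖ * ‖x - y‖ := by
  have hx' := norm_pos_iff.2 hx
  have hy' := norm_pos_iff.2 hy
  have hd := vv_lip he x y
  have hn := abs_norm_sub_norm_le x y
  have hvn := abs_norm_sub_norm_le (vv e y) (vv e x)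
  rw [norm_sub_rev] at hvn
  have hv2 : ‖vv e x‖ ≤ 2 := by
    refine (norm_sub_le _ _).trans ?_
    rw [norm_smul, he]; simp; linarith
  have e1 : f1 e x - f1 e y = ((‖x‖ - ‖y‖) / ‖vv e x‖) • vv e x
      + (‖y‖ / ‖vv e x‖) • (vv e x - vv e y)
      + (‖y‖ * (‖vv e y‖ - ‖vv e x‖) / (‖vv e x‖ * ‖vv e y‖)) • vv e y := by
    rw [f1, f1, smul_sub, add_sub, ← add_smul, sub_add, ← sub_smul]
    congr 2
    · field_simp; ring
    · field_simp; ring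
  rw [e1]
  refine norm_add₃_le.trans ?_
  rw [norm_smul, norm_smul, norm_smul]
  simp only [Real.norm_eq_abs, abs_div, abs_mul, abs_norm]
  have t1 : |‖x‖ - ‖y‖| / ‖vv e x‖ * ‖vv e x‖ ≤ 2 / ‖vv e x‖ * ‖x - y‖ := by
    rw [div_mul_cancel₀ _ hx'.ne']
    refine hn.trans ?_
    have : 1 ≤ 2 / ‖vv e x‖ := by rw [le_div_iff₀ hx']; linarith
    nlinarith [norm_nonneg (x - y)]
  have t2 : ‖y‖ / ‖vv e x‖ * ‖vv e x - vv e y‖ ≤ 1 / ‖vv e x‖ * (2 * ‖x - y‖) := by gcongr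
  have t3 : ‖y‖ * |‖vv e y‖ - ‖vv e x‖| / (‖vv e x‖ * ‖vv e y‖) * ‖vv e y‖
      ≤ 1 / ‖vv e x‖ * (2 * ‖x - y‖) := by
    calc _ = ‖y‖ / ‖vv e x‖ * |‖vv e y‖ - ‖vv e x‖| := by field_simp
      _ ≤ _ := by gcongr; linarith
  calc _ ≤ _ := add_le_add (add_le_add t1 t2) t3
    _ = _ := by ring

lemma f1_lip (he : ‖e‖ = 1) {x : E} (hx : vv e x ≠ 0) (hxb : ‖x‖ < 1) :
    ∃ t ∈ 𝓝 x, LipschitzOnWith ⟨12 / ‖vv e x‖, by positivity⟩ (f1 e) t := by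
  have hx' := norm_pos_iff.2 hx
  have hcont : Continuous fun y : E => ‖vv e y‖ := by unfold vv; fun_prop
  have h1 : ∀ᶠ y in 𝓝 x, ‖vv e x‖ / 2 < ‖vv e y‖ :=
    hcont.continuousAt.eventually (lt_mem_nhds (by linarith))
  have h2 : ∀ᶠ y in 𝓝 x, ‖y‖ < 1 := continuous_norm.continuousAt.eventually (gt_mem_nhds hxb)
  refine ⟨_, h1.and h2, LipschitzOnWith.of_dist_le_mul ?_⟩
  rintro a ⟨ha, ha'⟩ b ⟨hb, hb'⟩
  change _ ≤ 12 / ‖vv e x‖ * dist a b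
  have hap : 0 < ‖vv e a‖ := by linarith
  have hbp : 0 < ‖vv e b‖ := by linarith
  rw [dist_eq_norm, dist_eq_norm]
  refine (f1_dist he (norm_pos_iff.1 hap) (norm_pos_iff.1 hbp) hb'.le ha'.le).trans ?_
  gcongr ?_ * _
  rw [div_le_div_iff₀ hap hx']
  linarith

/-- The open half ball, centred at `e/2`. -/
def halfBall (e : E) : Set E := {w | ‖w + (1 / 2 : ℝ) • e‖ < 1 ∧ 0 < inner ℝ e (w + (1 / 2 : ℝ) • e)}

lemma halfBall_open : IsOpen (halfBall e) := by
  have h1 : Continuous fun w : E => ‖w + (1 / 2 : ℝ) • e‖ := by fun_prop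
  have h2 : Continuous fun w : E => inner ℝ e (w + (1 / 2 : ℝ) • e) := by fun_prop
  exact (isOpen_lt h1 continuous_const).inter (isOpen_lt continuous_const h2)

lemma halfBall_zero (he : ‖e‖ = 1) : (0 : E) ∈ halfBall e := by
  constructor
  · rw [zero_add, norm_smul, he]; norm_num
  · rw [zero_add, inner_smul_right]; simp [he]

lemma halfBall_convex : Convex ℝ (halfBall e) := by
  have h : halfBall e = (fun w => w + (1 / 2 : ℝ) • e) ⁻¹' (ball 0 1 ∩ {z | 0 < inner ℝ e z}) := by
    ext w; simp only [halfBall, mem_preimage, mem_inter_iff, mem_ball_zero_iff, mem_ofPred_eq]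
  rw [h]
  refine Convex.translate_preimage_left ((convex_ball 0 1).inter ?_) _
  exact convex_halfSpace_gt (innerSL ℝ e).isLinear 0

lemma halfBall_sub (he : ‖e‖ = 1) : halfBall e ⊆ closedBall 0 2 := by
  intro w hw
  rw [mem_closedBall_zero_iff]
  have h1 := hw.1
  have := norm_sub_le (w + (1 / 2 : ℝ) • e) ((1 / 2 : ℝ) • e)
  rw [add_sub_cancel_right, norm_smul, he] at this
  norm_num at this ⊢
  norm_num at h1
  linarith

lemma exists_straighten (he : ‖e‖ = 1) : ∃ P Q : E → E, (∃ K, LipschitzWith K P) ∧ (∃ K, LipschitzWith K Q) ∧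
    (∀ x, P (Q x) = x) ∧ (∀ x, Q (P x) = x) ∧
    (∀ z, ‖P z‖ < 1 ↔ ‖z‖ < 1 ∧ 0 < inner ℝ e z) := by
  have hn0 := (halfBall_open (e := e)).mem_nhds (halfBall_zero he)
  have hab : Absorbent ℝ (halfBall e) := absorbent_nhds_zero hn0
  have hbd : Bornology.IsVonNBounded ℝ (halfBall e) :=
    (NormedSpace.isVonNBounded_closedBall ℝ E 2).subset (halfBall_sub he)
  have hab' : Absorbent ℝ (ball (0 : E) 1) := absorbent_ball_zero one_pos
  have hbd' : Bornology.IsVonNBounded ℝ (ball (0 : E) 1) := NormedSpace.isVonNBounded_ball ℝ E 1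
  obtain ⟨A, hA⟩ := (halfBall_convex (e := e)).lipschitz_gauge hn0
  have hB : LipschitzWith 1 (gauge (ball (0 : E) 1)) := by
    rw [show gauge (ball (0 : E) 1) = norm from funext gauge_unit_ball]
    exact lipschitzWith_one_norm
  obtain ⟨K1, hK1⟩ := lip_ratio _ _ hA hB gauge_zero one_pos (fun x => by simp [gauge_unit_ball])
  obtain ⟨K2, hK2⟩ := lip_ratio _ _ hB hA gauge_zero (c := 1 / 2) (by norm_num) (fun x => by
    have := le_gauge_of_subset_closedBall hab (by norm_num) (halfBall_sub he) (x := x)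
    linarith)
  refine ⟨fun z => gaugeRescale (halfBall e) (ball 0 1) (z - (1 / 2 : ℝ) • e),
    fun x => gaugeRescale (ball 0 1) (halfBall e) x + (1 / 2 : ℝ) • e, ⟨K1, ?_⟩, ⟨K2, ?_⟩, ?_, ?_, ?_⟩
  · refine LipschitzWith.of_dist_le_mul fun x y => ?_
    have := hK1.dist_le_mul (x - (1 / 2 : ℝ) • e) (y - (1 / 2 : ℝ) • e)
    rwa [dist_sub_right] at this
  · refine LipschitzWith.of_dist_le_mul fun x y => ?_
    rw [dist_add_right]
    exact hK2.dist_le_mul x y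
  · intro x
    simp only [add_sub_cancel_right]
    rw [gaugeRescale_gaugeRescale hab hbd, gaugeRescale_self_apply hab' hbd']
  · intro x
    simp only
    rw [gaugeRescale_gaugeRescale hab' hbd', gaugeRescale_self_apply hab hbd, sub_add_cancel]
  · intro z
    simp only
    rw [← gauge_unit_ball, gauge_gaugeRescale _ hab' hbd',
      gauge_lt_one_iff_mem_interior halfBall_convex hn0, halfBall_open.interior_eq]
    simp [halfBall]

end geometry

lemma integrable_cyl {m : ℕ} (hm : 1 ≤ m) {p : ℝ} (hp : p < m) :
    IntegrableOn (fun y : Euc (m + 1) => ‖(fun i : Fin m => y i.succ)‖ ^ (-p)) (ball 0 1) := by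
  have h1 : IntegrableOn (fun x : Fin m → ℝ => ‖x‖ ^ (-p)) (ball 0 1) := by
    refine integrableOn_ball_of_norm_le_rpow (C := 1) (α := p) (by simpa using hm) (by simpa using hp)
      (ae_of_all _ fun x => ?_) ?_
    · rw [one_mul, Real.norm_of_nonneg (by positivity)]
    · exact (measurable_norm.pow_const _).aestronglyMeasurable
  have h2 : IntegrableOn (fun _ : ℝ => (1 : ℝ)) (ball 0 1) := by simp
  have h3 := Integrable.mul_prod h2 h1
  rw [Measure.prod_restrict] at h3
  have mp := (volume_preserving_piFinSuccAbove (fun _ : Fin (m + 1) => ℝ) 0).comp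
    (PiLp.volume_preserving_ofLp (Fin (m + 1)))
  have h4 := (mp.integrableOn_comp_preimage
    ((MeasurableEquiv.measurableEmbedding _).comp
      (MeasurableEquiv.toLp 2 (Fin (m + 1) → ℝ)).symm.measurableEmbedding)
    (f := fun z : ℝ × (Fin m → ℝ) => 1 * ‖z.2‖ ^ (-p)) (s := ball 0 1 ×ˢ ball 0 1)).2 h3
  refine (h4.mono_set ?_).congr_fun ?_ measurableSet_ball
  · intro y hy
    have hy' : ‖y‖ < 1 := by simpa using hy
    have hc : ∀ i, |y i| < 1 := fun i => (PiLp.norm_apply_le y i).trans_lt hy'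
    refine ⟨?_, ?_⟩
    · rw [mem_ball_zero_iff]; exact hc 0
    · rw [mem_ball_zero_iff]
      exact (pi_norm_lt_iff one_pos).2 fun i => hc i.succ
  · intro y _
    simp only [one_mul]
    rfl

lemma ae_cyl {m : ℕ} (hm : 1 ≤ m) :
    ∀ᵐ y : Euc (m + 1), (fun i : Fin m => y i.succ) ≠ 0 := by
  let i0 : Fin m := ⟨0, hm⟩
  have h := Measure.addHaar_submodule (volume : Measure (Euc (m + 1)))
    (LinearMap.ker (EuclideanSpace.proj i0.succ : Euc (m + 1) →L[ℝ] ℝ).toLinearMap) (by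
      intro h
      have h2 : EuclideanSpace.single i0.succ (1 : ℝ) ∈ (⊤ : Submodule ℝ (Euc (m + 1))) := trivial
      rw [← h] at h2
      simp at h2)
  rw [ae_iff]
  refine measure_mono_null (fun y hy => ?_) h
  simp only [ne_eq, not_not, mem_ofPred_eq] at hy
  have := congrFun hy i0
  simpa using this
/-- For `n ≥ 3` there is a Lipschitz homeomorphism `h : 𝔹 → 𝔹 ∖ I`
(of finite conformal energy) whose inverse lies in `W^{1,p}(𝔹 ∖ I)` for every `1 ≤ p < n−1`. -/
theorem stmt_5 {n : ℕ} [NeZero n] (hn : 3 ≤ n) :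
    ∃ h f : Euc n → Euc n,
      IsHomeoOn h f (unitBall n) (unitBall n \ slit n) ∧
      (∃ L : ℝ≥0, LipschitzOnWith L h (unitBall n)) ∧
      (∃ Dh, MemSobolev (n : ℝ) (unitBall n) h Dh) ∧
      ∀ p : ℝ, 1 ≤ p → p < (n : ℝ) - 1 →
        ∃ Df, MemSobolev p (unitBall n \ slit n) f Df := by
  obtain ⟨m, rfl⟩ : ∃ m, n = m + 1 := ⟨n - 1, by omega⟩
  have hm : 1 ≤ m := by omega
  set e : Euc (m + 1) := EuclideanSpace.single 0 1 with hedef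
  have he : ‖e‖ = 1 := by simp [hedef]
  have hslit : ∀ y : Euc (m + 1), ‖y‖ < 1 → (y ∉ slit (m + 1) ↔ vv e y ≠ 0) := by
    intro y hy
    rw [not_iff_not]
    constructor
    · rintro ⟨h0, -, h2⟩
      have hy2 : y = y 0 • e := by
        ext i
        by_cases hi : i = 0
        · subst hi; simp [hedef]
        · simp [hedef, h2 i hi, hi]
      have hyn : ‖y‖ = y 0 := by
        rw [hy2, norm_smul, he, Real.norm_of_nonneg h0]; simp [hedef]
      rw [vv, hyn, ← hy2, sub_self]
    · intro h
      rw [vv, sub_eq_zero] at h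
      have hi : ∀ i, y i = ‖y‖ * e i := fun i => by
        conv_lhs => rw [← h]
        simp
      have h0 : y 0 = ‖y‖ := by rw [hi 0]; simp [hedef]
      refine ⟨h0 ▸ norm_nonneg _, h0 ▸ hy, fun i hne => ?_⟩
      rw [hi i]; simp [hedef, hne]
  obtain ⟨P, Q, ⟨KP, hP⟩, ⟨KQ, hQ⟩, hPQ, hQP, hball⟩ := exists_straighten he
  obtain ⟨K1, hK1⟩ := h1_lip e
  have hmem : ∀ y, y ∈ unitBall (m + 1) \ slit (m + 1) ↔ ‖y‖ < 1 ∧ vv e y ≠ 0 := by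
    intro y
    simp only [unitBall, Set.mem_sdiff, mem_ball_zero_iff]
    exact and_congr_right fun h => hslit y h
  have hcont : Continuous fun y : Euc (m + 1) => vv e y := by unfold vv; fun_prop
  have hopen : IsOpen (unitBall (m + 1) \ slit (m + 1)) := by
    have : unitBall (m + 1) \ slit (m + 1) = ball 0 1 ∩ {y | vv e y ≠ 0} := by
      ext y; rw [hmem]; simp
    rw [this]
    exact isOpen_ball.inter (isOpen_ne_fun hcont continuous_const)
  have hlip : LipschitzWith (K1 * KQ) (h1 e ∘ Q) := hK1.comp hQ
  have hfl : ∀ x ∈ unitBall (m + 1) \ slit (m + 1), ∃ t ∈ 𝓝 x,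
      LipschitzOnWith (KP * ⟨12 / ‖vv e x‖, by positivity⟩) (P ∘ f1 e) t := by
    intro x hx
    obtain ⟨ha, hb⟩ := (hmem x).1 hx
    obtain ⟨t, ht, hl⟩ := f1_lip he hb ha
    exact ⟨t, ht, hP.comp_lipschitzOnWith hl⟩
  have hQb : ∀ x ∈ unitBall (m + 1), ‖Q x‖ < 1 ∧ 0 < inner ℝ e (Q x) := by
    intro x hx
    rw [← hball, hPQ]
    simpa [unitBall] using hx
  refine ⟨h1 e ∘ Q, P ∘ f1 e, ⟨?_, ?_, ?_, ?_, ?_, ?_⟩, ⟨_, hlip.lipschitzOnWith⟩,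
    ⟨jac (h1 e ∘ Q), ?_⟩, ?_⟩
  · intro x hx
    obtain ⟨a, b⟩ := hQb x hx
    obtain ⟨c, d⟩ := vv_h1 he (z := Q x)
    have hq : Q x ≠ 0 := by intro h; rw [h] at b; simp at b
    rw [hmem]
    refine ⟨by simpa [c] using a, ?_⟩
    simp only [Function.comp]
    rw [d]
    have := norm_pos_iff.2 hq
    exact smul_ne_zero (by positivity) hq
  · intro y hy
    obtain ⟨a, b⟩ := (hmem y).1 hy
    simp only [unitBall, mem_ball_zero_iff, Function.comp, hball]
    exact ⟨by rwa [norm_f1 b], inner_f1_pos he b⟩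
  · intro x hx
    simp only [Function.comp]
    rw [f1_h1 he (hQb x hx).2, hPQ]
  · intro y hy
    simp only [Function.comp]
    rw [hQP, h1_f1 he ((hmem y).1 hy).2]
  · exact hlip.continuous.continuousOn
  · intro x hx
    obtain ⟨t, ht, hl⟩ := hfl x hx
    exact (hl.continuousOn.continuousAt ht).continuousWithinAt
  · refine memSobolev_of_locLip isOpen_ball (fun x _ => ⟨_, univ, univ_mem, hlip.lipschitzOnWith⟩)
      (fun _ => ((K1 * KQ : ℝ≥0) : ℝ) ^ ((m + 1 : ℕ) : ℝ)) ?_ (ae_of_all _ fun x => ?_)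
    · exact integrableOn_const measure_ball_lt_top.ne
    · exact Real.rpow_le_rpow (norm_nonneg _) (norm_fderiv_le_of_lipschitz ℝ hlip) (by positivity)
  · intro p hp1 hp2
    refine ⟨jac (P ∘ f1 e), memSobolev_of_locLip hopen (fun x hx => ⟨_, hfl x hx⟩)
      (fun y => ((KP : ℝ) * 12) ^ p * ‖(fun i : Fin m => y i.succ)‖ ^ (-p)) ?_ ?_⟩
    · refine Integrable.const_mul ?_ _
      have hp3 : p < m := by push_cast at hp2; linarith
      exact (integrable_cyl hm hp3).mono_set sdiff_subset
    · rw [ae_restrict_iff' hopen.measurableSet]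
      filter_upwards [ae_cyl hm] with y hy hyΩ
      obtain ⟨t, ht, hl⟩ := hfl y hyΩ
      have hb := norm_fderiv_le_of_lipschitzOn ℝ ht hl
      have hX : 0 < ‖(fun i : Fin m => y i.succ)‖ := norm_pos_iff.2 hy
      have hvX : ‖(fun i : Fin m => y i.succ)‖ ≤ ‖vv e y‖ := by
        refine (pi_norm_le_iff_of_nonneg (norm_nonneg _)).2 fun i => ?_
        refine le_trans (le_of_eq ?_) (PiLp.norm_apply_le (vv e y) i.succ)
        simp [vv, hedef]
      have hb2 : ‖fderiv ℝ (P ∘ f1 e) y‖ ≤ (KP : ℝ) * 12 * ‖(fun i : Fin m => y i.succ)‖⁻¹ := by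
        refine hb.trans ?_
        change (KP : ℝ) * (12 / ‖vv e y‖) ≤ _
        rw [div_eq_mul_inv, mul_assoc]
        gcongr
      refine (Real.rpow_le_rpow (norm_nonneg _) hb2 (by linarith)).trans (le_of_eq ?_)
      rw [Real.mul_rpow (by positivity) (by positivity), Real.inv_rpow hX.le, Real.rpow_neg hX.le]
end
end
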